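/- arXiv:math-ph/0502025 — 2 statements merged into one kernel-verified Lean document; each statement's English description precedes it below -/
import Mathlib

section
/- (Two Denominator Lemma, with point singularity.) Let κ > 0. There exist C > 0 and λ₀ ∈ (0,1) (depending only on κ) such that for all 0 < λ ≤ λ₀, with η := λ^{2+κ}, and for every q ∈ 𝕋³: sup_{|α| ≤ 12, |β| ≤ 12} sup_{r ∈ 𝕋³} ∫_{𝕋³} dp / ( |α − ω̄(p) − iη| · |β − ω(p+q) + iη| · |||p − r||| ) ≤ C η^{−7/8−κ} / |||q|||. -/
open MeasureTheory Filter Topology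

noncomputable section

/-- The torus `𝕋³ = [-1/2, 1/2]³` realized as a box in `ℝ³`. -/
def T3 : Set (Fin 3 → ℝ) := Set.pi Set.univ fun _ => Set.Icc (-(1/2) : ℝ) (1/2)

/-- The lattice dispersion relation `e(p) = ∑_j (1 - cos(2π p_j))`. -/
def edisp (p : Fin 3 → ℝ) : ℝ := ∑ j, (1 - Real.cos (2 * Real.pi * p j))

/-- `Θ_ε(α) = ∫_{𝕋³} dq / (α - e(q) + iε)`. -/
def ThetaEps (ε α : ℝ) : ℂ := ∫ q in T3, ((α : ℂ) - (edisp q : ℂ) + (ε : ℂ) * Complex.I)⁻¹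

/-- `Θ` is the limit of `Θ_ε` as `ε → 0⁺`. -/
def IsThetaLimit (Θ : ℝ → ℂ) : Prop :=
  ∀ α : ℝ, Tendsto (fun ε => ThetaEps ε α) (𝓝[>] (0 : ℝ)) (𝓝 (Θ α))

/-- The renormalized dispersion `ω(p) = e(p) + λ² Θ(e(p))`. -/
def omegaR (Θ : ℝ → ℂ) (lam : ℝ) (p : Fin 3 → ℝ) : ℂ :=
  (edisp p : ℂ) + (lam : ℂ) ^ 2 * Θ (edisp p)

/-- A function on `𝕋³`, i.e. a `ℤ³`-periodic function on `ℝ³`. -/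
def ZPeriodic (g : (Fin 3 → ℝ) → ℂ) : Prop :=
  ∀ (p : Fin 3 → ℝ) (n : Fin 3 → ℤ), g (p + fun j => (n j : ℝ)) = g p

/-- The `C¹` norm `‖g‖_∞ + ‖∇g‖_∞`. -/
def C1Norm (g : (Fin 3 → ℝ) → ℂ) : ℝ :=
  (⨆ p : Fin 3 → ℝ, ‖g p‖) + ⨆ p : Fin 3 → ℝ, ‖fderiv ℝ g p‖

/-- `|||α||| = min {|α|, |α-2|, |α-3|, |α-4|, |α-6|}`. -/
def anorm (a : ℝ) : ℝ := min (min (min |a| |a - 2|) (min |a - 3| |a - 4|)) |a - 6|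

/-- Distance between two points of the circle `ℝ/ℤ`. -/
def cdist (x y : ℝ) : ℝ := |x - y - (round (x - y) : ℝ)|

/-- `|||q||| = η + min {dist(q, γ) : γ a critical point of e}` (torus distance);
the critical points are exactly the points with all coordinates in `{0, 1/2}` mod `1`,
and minimizing over them coordinatewise gives the formula below. -/
def tnorm (η : ℝ) (q : Fin 3 → ℝ) : ℝ :=
  η + Real.sqrt (∑ j, (min (cdist (q j) 0) (cdist (q j) (1/2))) ^ 2)

/-- `|∇e(q)|`, the Euclidean length of the gradient of the dispersion relation. -/
def gradNorm (q : Fin 3 → ℝ) : ℝ := Real.sqrt (∑ j, (2 * Real.pi * Real.sin (2 * Real.pi * q j)) ^ 2)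


lemma bes_quarter (r a : ℝ) (ha : 0 < a) (ha4 : a ≤ 1/4) (hr : r ≠ 0) :
    ‖∫ x in a..(1/4), Complex.exp (Complex.I * ((r * Real.cos (2 * Real.pi * x) : ℝ) : ℂ))‖ ≤ 1 / (4 * |r| * a) := by
  have hpi := Real.pi_pos
  set v : ℝ → ℂ := fun x => Complex.exp (Complex.I * ((r * Real.cos (2 * Real.pi * x) : ℝ) : ℂ)) with hv
  set v' : ℝ → ℂ := fun x => v x * (Complex.I * ((r * (-Real.sin (2 * Real.pi * x) * (2 * Real.pi)) : ℝ) : ℂ)) with hv'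
  set u : ℝ → ℂ := fun x => (((Real.sin (2 * Real.pi * x))⁻¹ : ℝ) : ℂ) with hu
  set w : ℝ → ℝ := fun x => -(Real.cos (2 * Real.pi * x) * (2 * Real.pi)) / (Real.sin (2 * Real.pi * x))^2 with hw
  have hsub : ∀ x ∈ Set.uIcc a (1/4), a ≤ x ∧ x ≤ 1/4 := by
    intro x hx; rwa [Set.uIcc_of_le ha4] at hx
  have hsin : ∀ x ∈ Set.uIcc a (1/4), 0 < Real.sin (2 * Real.pi * x) := by
    intro x hx
    obtain ⟨h1, h2⟩ := hsub x hx
    apply Real.sin_pos_of_pos_of_lt_pi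
    · have : 0 < x := by linarith
      positivity
    · nlinarith
  have hlin : ∀ x : ℝ, HasDerivAt (fun x : ℝ => 2 * Real.pi * x) (2 * Real.pi) x := by
    intro x; simpa using (hasDerivAt_id x).const_mul (2 * Real.pi)
  have hwd : ∀ x ∈ Set.uIcc a (1/4), HasDerivAt (fun x => (Real.sin (2 * Real.pi * x))⁻¹) (w x) x := by
    intro x hx
    exact ((hlin x).sin).inv (hsin x hx).ne'
  have hud : ∀ x ∈ Set.uIcc a (1/4), HasDerivAt u ((w x : ℝ) : ℂ) x := by
    intro x hx; exact (hwd x hx).ofReal_comp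
  have hvd : ∀ x ∈ Set.uIcc a (1/4), HasDerivAt v (v' x) x := by
    intro x _
    have h1 := (((hlin x).cos.const_mul r).ofReal_comp).const_mul Complex.I
    exact h1.cexp
  have hwc : ContinuousOn w (Set.uIcc a (1/4)) := by
    apply ContinuousOn.div (by fun_prop) (by fun_prop)
    intro x hx; exact (pow_pos (hsin x hx) 2).ne'
  have hvc : Continuous v := by rw [hv]; fun_prop
  have hv'c : Continuous v' := by rw [hv']; fun_prop
  have hwi : IntervalIntegrable w volume a (1/4) := hwc.intervalIntegrable
  have hui : IntervalIntegrable (fun x => ((w x : ℝ) : ℂ)) volume a (1/4) := by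
    apply ContinuousOn.intervalIntegrable
    exact Complex.continuous_ofReal.comp_continuousOn hwc
  have key := intervalIntegral.integral_mul_deriv_eq_deriv_mul hud hvd hui (hv'c.intervalIntegrable _ _)
  have hvn : ∀ x, ‖v x‖ = 1 := by
    intro x; rw [hv]; simp only; rw [mul_comm]; exact Complex.norm_exp_ofReal_mul_I _
  have hun : ∀ x ∈ Set.uIcc a (1/4), ‖u x‖ = (Real.sin (2 * Real.pi * x))⁻¹ := by
    intro x hx; rw [hu]; simp only [Complex.norm_real, Real.norm_eq_abs]
    exact abs_of_pos (inv_pos.2 (hsin x hx))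
  have hwint : ∫ x in a..(1/4), w x = (Real.sin (2 * Real.pi * (1/4)))⁻¹ - (Real.sin (2 * Real.pi * a))⁻¹ :=
    intervalIntegral.integral_eq_sub_of_hasDerivAt hwd hwi
  have hwneg : ∀ x ∈ Set.uIcc a (1/4), w x ≤ 0 := by
    intro x hx
    obtain ⟨h1, h2⟩ := hsub x hx
    have : 0 ≤ Real.cos (2 * Real.pi * x) := by
      apply Real.cos_nonneg_of_neg_pi_div_two_le_of_le <;> nlinarith
    rw [hw]; simp only
    apply div_nonpos_of_nonpos_of_nonneg _ (sq_nonneg _)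
    have := mul_nonneg this (by positivity : 0 ≤ 2 * Real.pi)
    linarith
  have h2 : ‖∫ x in a..(1/4), ((w x : ℝ) : ℂ) * v x‖ ≤ (Real.sin (2 * Real.pi * a))⁻¹ - (Real.sin (2 * Real.pi * (1/4)))⁻¹ := by
    calc _ ≤ ∫ x in a..(1/4), - w x := by
          apply intervalIntegral.norm_integral_le_of_norm_le ha4 _ hwi.neg
          apply ae_of_all
          intro x hx
          have hx' : x ∈ Set.uIcc a (1/4) := by rw [Set.uIcc_of_le ha4]; exact ⟨hx.1.le, hx.2⟩
          rw [norm_mul, hvn, mul_one, Complex.norm_real, Real.norm_eq_abs, abs_of_nonpos (hwneg x hx')]; rfl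
      _ = _ := by rw [intervalIntegral.integral_neg, hwint]; ring
  have h3 : ∫ x in a..(1/4), u x * v' x = (-(2 * Real.pi * r) * Complex.I) * ∫ x in a..(1/4), v x := by
    rw [← intervalIntegral.integral_const_mul]
    apply intervalIntegral.integral_congr
    intro x hx
    have := (hsin x hx).ne'
    have : ((Real.sin (2 * Real.pi * x) : ℝ) : ℂ) ≠ 0 := by exact_mod_cast this
    simp only [hu, hv']
    push_cast at this ⊢
    field_simp
  have e1 : a ∈ Set.uIcc a (1/4) := Set.left_mem_uIcc
  have e2 : (1/4 : ℝ) ∈ Set.uIcc a (1/4) := Set.right_mem_uIcc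
  have h4 : ‖∫ x in a..(1/4), u x * v' x‖ ≤ 2 * (Real.sin (2 * Real.pi * a))⁻¹ := by
    rw [key]
    calc _ ≤ ‖u (1/4) * v (1/4)‖ + ‖u a * v a‖ + ‖∫ x in a..(1/4), ((w x : ℝ) : ℂ) * v x‖ := by
          refine (norm_sub_le _ _).trans ?_
          gcongr
          exact norm_sub_le _ _
      _ ≤ _ := by
          rw [norm_mul, norm_mul, hvn, hvn, mul_one, mul_one, hun _ e1, hun _ e2]
          linarith
  rw [h3, norm_mul, norm_mul, Complex.norm_I, mul_one, norm_neg] at h4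
  have h5 : ‖(2 * (Real.pi:ℂ) * (r:ℂ))‖ = 2 * Real.pi * |r| := by
    rw [norm_mul, norm_mul, Complex.norm_real, Complex.norm_real, Real.norm_eq_abs, Real.norm_eq_abs, abs_of_pos hpi]; simp
  rw [h5] at h4
  have h6 : 4 * a ≤ Real.sin (2 * Real.pi * a) := by
    have := Real.mul_le_sin (x := 2 * Real.pi * a) (by positivity) (by nlinarith)
    calc 4 * a = 2 / Real.pi * (2 * Real.pi * a) := by field_simp; ring
      _ ≤ _ := this
  have hr' : 0 < |r| := abs_pos.2 hr
  have h7 : (Real.sin (2 * Real.pi * a))⁻¹ ≤ (4 * a)⁻¹ := by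
    apply inv_anti₀ (by positivity) h6
  have h8 : 2 * Real.pi * |r| * ‖∫ x in a..(1/4), v x‖ ≤ 2 * (4*a)⁻¹ := h4.trans (by linarith)
  rw [le_div_iff₀ (by positivity)]
  have h9 : 2 * (4*a)⁻¹ * a = 1/2 := by field_simp; norm_num
  have h10 := mul_le_mul_of_nonneg_right h8 ha.le
  rw [h9] at h10
  have hpi3 := Real.pi_gt_three
  have : 0 ≤ |r| * ‖∫ x in a..(1/4), v x‖ * a := by positivity
  nlinarith

lemma bes_bound (r : ℝ) :
    ‖∫ x in (-(1/2))..(1/2), Complex.exp (Complex.I * ((r * Real.cos (2 * Real.pi * x) : ℝ) : ℂ))‖ ≤ 8 / Real.sqrt (1 + |r|) := by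
  set v : ℝ → ℝ → ℂ := fun r x => Complex.exp (Complex.I * ((r * Real.cos (2 * Real.pi * x) : ℝ) : ℂ)) with hv
  have hvc : ∀ r, Continuous (v r) := by intro r; rw [hv]; fun_prop
  have hvn : ∀ r x, ‖v r x‖ = 1 := by
    intro r x; rw [hv]; simp only; rw [mul_comm]; exact Complex.norm_exp_ofReal_mul_I _
  have hii : ∀ r a b, IntervalIntegrable (v r) volume a b := fun r a b => (hvc r).intervalIntegrable _ _
  change ‖∫ x in (-(1/2))..(1/2), v r x‖ ≤ _
  by_cases hr : |r| < 1
  · have h1 : ‖∫ x in (-(1/2) : ℝ)..(1/2), v r x‖ ≤ 1 * |1/2 - (-(1/2) : ℝ)| :=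
      intervalIntegral.norm_integral_le_of_norm_le_const (fun x _ => (hvn r x).le)
    have h2 : Real.sqrt (1 + |r|) ≤ 2 := by
      rw [Real.sqrt_le_left (by norm_num)]; nlinarith
    have h3 : 0 < Real.sqrt (1 + |r|) := Real.sqrt_pos.2 (by positivity)
    rw [le_div_iff₀ h3]
    norm_num at h1
    nlinarith [norm_nonneg (∫ x in (-(1/2) : ℝ)..(1/2), v r x)]
  push Not at hr
  have hq : ∀ r : ℝ, 1 ≤ |r| → ‖∫ x in (0:ℝ)..(1/4), v r x‖ ≤ 5/4 / Real.sqrt |r| := by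
    intro r hr
    have hs1 : 1 ≤ Real.sqrt |r| := by rwa [Real.one_le_sqrt]
    have hs0 : 0 < Real.sqrt |r| := by linarith
    set a := 1 / (4 * Real.sqrt |r|) with ha
    have ha0 : 0 < a := by positivity
    have ha4 : a ≤ 1/4 := by
      rw [ha]; apply one_div_le_one_div_of_le <;> linarith
    rw [← intervalIntegral.integral_add_adjacent_intervals (hii r 0 a) (hii r a (1/4))]
    have h1 : ‖∫ x in (0:ℝ)..a, v r x‖ ≤ 1 * |a - 0| :=
      intervalIntegral.norm_integral_le_of_norm_le_const (fun x _ => (hvn r x).le)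
    have hr0 : r ≠ 0 := by rintro rfl; simp at hr; linarith
    have h2 := bes_quarter r a ha0 ha4 hr0
    have hsq : Real.sqrt |r| * Real.sqrt |r| = |r| := Real.mul_self_sqrt (abs_nonneg r)
    have h3 : 1 / (4 * |r| * a) = 1 / Real.sqrt |r| := by
      have : 4 * |r| * a = Real.sqrt |r| := by
        rw [ha]; field_simp; nlinarith
      rw [this]
    rw [h3] at h2
    rw [one_mul, sub_zero, abs_of_pos ha0] at h1
    refine (norm_add_le _ _).trans ((add_le_add h1 h2).trans (le_of_eq ?_))
    rw [ha]; field_simp; norm_num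
  have e1 : ∫ x in (-(1/2) : ℝ)..0, v r x = ∫ x in (0:ℝ)..(1/2), v r x := by
    have := intervalIntegral.integral_comp_neg (a := 0) (b := 1/2) (f := v r)
    rw [neg_zero] at this
    rw [← this]
    congr 1; ext x; simp [hv]
  have e2 : ∫ x in (1/4 : ℝ)..(1/2), v r x = ∫ x in (0:ℝ)..(1/4), v (-r) x := by
    have := intervalIntegral.integral_comp_sub_left (a := 0) (b := 1/4) (f := v r) (1/2)
    rw [sub_zero, show (1/2 - 1/4 : ℝ) = 1/4 by norm_num] at this
    rw [← this]
    congr 1; ext x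
    simp only [hv]
    congr 3
    rw [show 2 * Real.pi * (1/2 - x) = Real.pi - 2 * Real.pi * x by ring, Real.cos_pi_sub]; ring
  rw [← intervalIntegral.integral_add_adjacent_intervals (hii r _ 0) (hii r 0 _), e1,
    ← intervalIntegral.integral_add_adjacent_intervals (hii r 0 (1/4)) (hii r (1/4) _), e2]
  have h1 := hq r hr
  have h2 := hq (-r) (by rwa [abs_neg])
  rw [abs_neg] at h2
  have h3 : ∀ A B : ℂ, ‖A + B + (A + B)‖ ≤ 2 * (‖A‖ + ‖B‖) := by
    intro A B
    linarith [norm_add_le (A+B) (A+B), norm_add_le A B]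
  refine (h3 _ _).trans ?_
  have hs1 : 1 ≤ Real.sqrt |r| := by rwa [Real.one_le_sqrt]
  have h4 : Real.sqrt (1+|r|) ≤ 8/5 * Real.sqrt |r| := by
    rw [Real.sqrt_le_left (by positivity), mul_pow, Real.sq_sqrt (abs_nonneg _)]; nlinarith
  have h5 : 5 / Real.sqrt |r| ≤ 8 / Real.sqrt (1 + |r|) := by
    rw [div_le_div_iff₀ (by linarith) (Real.sqrt_pos.2 (by positivity))]; linarith
  have : 2 * (5/4 / Real.sqrt |r| + 5/4 / Real.sqrt |r|) = 5 / Real.sqrt |r| := by ring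
  linarith

lemma psi_bound (ξ τ y : ℝ) :
    ‖∫ x in Set.Icc (-(1/2) : ℝ) (1/2), Complex.exp (Complex.I * ((ξ * (1 - Real.cos (2 * Real.pi * x)) + τ * (1 - Real.cos (2 * Real.pi * (x + y))) : ℝ) : ℂ))‖
      ≤ 8 / Real.sqrt (1 + ‖(ξ : ℂ) + τ * Complex.exp (Complex.I * ((2 * Real.pi * y : ℝ) : ℂ))‖) := by
  set z : ℂ := (ξ : ℂ) + τ * Complex.exp (Complex.I * ((2 * Real.pi * y : ℝ) : ℂ)) with hz
  have hpi := Real.pi_pos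
  have hre : z.re = ξ + τ * Real.cos (2 * Real.pi * y) := by
    rw [hz, mul_comm Complex.I, Complex.add_re, Complex.re_ofReal_mul, Complex.exp_ofReal_mul_I_re]; simp
  have him : z.im = τ * Real.sin (2 * Real.pi * y) := by
    rw [hz, mul_comm Complex.I, Complex.add_im, Complex.im_ofReal_mul, Complex.exp_ofReal_mul_I_im]; simp
  have h1 : ‖z‖ * Real.cos z.arg = z.re := Complex.norm_mul_cos_arg z
  have h2 : ‖z‖ * Real.sin z.arg = z.im := Complex.norm_mul_sin_arg z
  set c := z.arg / (2 * Real.pi) with hc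
  have hph : ∀ x, ξ * (1 - Real.cos (2 * Real.pi * x)) + τ * (1 - Real.cos (2 * Real.pi * (x + y))) = (ξ + τ) + (-‖z‖) * Real.cos (2 * Real.pi * (x + c)) := by
    intro x
    have : 2 * Real.pi * (x + c) = 2 * Real.pi * x + z.arg := by rw [hc]; field_simp
    rw [this, Real.cos_add, mul_add (2 * Real.pi) x y, Real.cos_add]
    have e : -‖z‖ * (Real.cos (2 * Real.pi * x) * Real.cos z.arg - Real.sin (2 * Real.pi * x) * Real.sin z.arg) = -(‖z‖ * Real.cos z.arg) * Real.cos (2 * Real.pi * x) + (‖z‖ * Real.sin z.arg) * Real.sin (2 * Real.pi * x) := by ring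
    rw [e, h1, h2, hre, him]; ring
  set g : ℝ → ℂ := fun x => Complex.exp (Complex.I * (((-‖z‖) * Real.cos (2 * Real.pi * x) : ℝ) : ℂ)) with hg
  have hper : Function.Periodic g 1 := by
    intro x
    simp only [hg]
    rw [show 2 * Real.pi * (x + 1) = 2 * Real.pi * x + 2 * Real.pi by ring, Real.cos_add_two_pi]
  have e3 : ∀ x, Complex.exp (Complex.I * ((ξ * (1 - Real.cos (2 * Real.pi * x)) + τ * (1 - Real.cos (2 * Real.pi * (x + y))) : ℝ) : ℂ)) = Complex.exp (Complex.I * ((ξ + τ : ℝ) : ℂ)) * g (x + c) := by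
    intro x
    rw [hph, hg, ← Complex.exp_add]; congr 1; push_cast; ring
  simp_rw [e3]
  rw [integral_const_mul, norm_mul, mul_comm Complex.I, Complex.norm_exp_ofReal_mul_I, one_mul, integral_Icc_eq_integral_Ioc,
    ← intervalIntegral.integral_of_le (by norm_num), intervalIntegral.integral_comp_add_right g c]
  have e4 : ∫ x in (-(1/2) + c)..(1/2 + c), g x = ∫ x in (-(1/2))..(1/2), g x := by
    have := hper.intervalIntegral_add_eq (-(1/2) + c) (-(1/2))
    convert this using 2 <;> ring
  rw [e4]
  have := bes_bound (-‖z‖)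
  rwa [abs_neg, abs_norm] at this

def Rj (ξ τ y : ℝ) : ℝ := ‖(ξ : ℂ) + τ * Complex.exp (Complex.I * ((2 * Real.pi * y : ℝ) : ℂ))‖

lemma T3_eq : (volume : Measure (Fin 3 → ℝ)).restrict T3 = Measure.pi (fun _ : Fin 3 => (volume : Measure ℝ).restrict (Set.Icc (-(1/2) : ℝ) (1/2))) := by
  rw [T3, volume_pi, Measure.restrict_pi_pi]

lemma Phi_bound (ξ τ : ℝ) (q : Fin 3 → ℝ) :
    ‖∫ p in T3, Complex.exp (Complex.I * ((ξ * edisp p + τ * edisp (p + q) : ℝ) : ℂ))‖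
      ≤ ∏ j, (8 / Real.sqrt (1 + Rj ξ τ (q j))) := by
  have h : ∀ p : Fin 3 → ℝ, Complex.exp (Complex.I * ((ξ * edisp p + τ * edisp (p + q) : ℝ) : ℂ)) = ∏ j, (fun (j : Fin 3) (x : ℝ) => Complex.exp (Complex.I * ((ξ * (1 - Real.cos (2 * Real.pi * x)) + τ * (1 - Real.cos (2 * Real.pi * (x + q j))) : ℝ) : ℂ))) j (p j) := by
    intro p
    simp only
    rw [← Complex.exp_sum]
    congr 1
    rw [← Finset.mul_sum, ← Complex.ofReal_sum]
    congr 2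
    simp only [edisp, Pi.add_apply, Finset.mul_sum, Finset.sum_add_distrib]
  rw [T3_eq, integral_congr_ae (ae_of_all _ h), integral_fintype_prod_eq_prod (fun (j : Fin 3) (x : ℝ) => Complex.exp (Complex.I * ((ξ * (1 - Real.cos (2 * Real.pi * x)) + τ * (1 - Real.cos (2 * Real.pi * (x + q j))) : ℝ) : ℂ))), norm_prod]
  apply Finset.prod_le_prod
  · intros; exact norm_nonneg _
  · intro j _
    exact psi_bound ξ τ (q j)

lemma Rj_sq (ξ τ y : ℝ) : (Rj ξ τ y)^2 = (ξ + τ * Real.cos (2 * Real.pi * y))^2 + (τ * Real.sin (2 * Real.pi * y))^2 := by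
  rw [Rj, Complex.sq_norm, Complex.normSq_apply, mul_comm Complex.I, Complex.add_re, Complex.re_ofReal_mul, Complex.exp_ofReal_mul_I_re, Complex.add_im, Complex.im_ofReal_mul, Complex.exp_ofReal_mul_I_im]
  simp; ring

lemma Rj_nonneg (ξ τ y : ℝ) : 0 ≤ Rj ξ τ y := norm_nonneg _

lemma Rj_diff (ξ τ y : ℝ) : |(|ξ| - |τ|)| ≤ Rj ξ τ y := by
  have h := abs_norm_sub_norm_le (ξ : ℂ) (-(τ * Complex.exp (Complex.I * ((2 * Real.pi * y : ℝ) : ℂ))))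
  rw [sub_neg_eq_add, norm_neg, norm_mul, mul_comm Complex.I, Complex.norm_exp_ofReal_mul_I, mul_one, Complex.norm_real, Complex.norm_real, ← mul_comm Complex.I] at h
  exact h

lemma Rj_sin (ξ τ y : ℝ) : |Real.sin (2 * Real.pi * y)| * Real.sqrt (|ξ| * |τ|) ≤ Rj ξ τ y := by
  have h := Rj_sq ξ τ y
  have hsc := Real.sin_sq_add_cos_sq (2 * Real.pi * y)
  set s := Real.sin (2 * Real.pi * y)
  set c := Real.cos (2 * Real.pi * y)
  apply abs_le_of_sq_le_sq' _ (Rj_nonneg _ _ _) |>.2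
  rw [mul_pow, sq_abs, Real.sq_sqrt (by positivity), h, ← abs_mul]
  have h1 : (ξ + τ * c)^2 + (τ * s)^2 = (τ + ξ * c)^2 + (ξ * s)^2 := by
    have : c^2 = 1 - s^2 := by linarith
    ring_nf; rw [this]; ring
  have h2 : |ξ * τ| ≤ (ξ^2 + τ^2)/2 := by
    rw [abs_le]; constructor <;> nlinarith [sq_nonneg (ξ - τ), sq_nonneg (ξ + τ)]
  have h3 : s^2 * |ξ * τ| ≤ s^2 * ((ξ^2 + τ^2)/2) := by gcongr
  nlinarith [sq_nonneg (ξ + τ * c), sq_nonneg (τ + ξ * c)]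

lemma edisp_cont : Continuous edisp := by unfold edisp; fun_prop

instance T3_fin : IsFiniteMeasure ((volume : Measure (Fin 3 → ℝ)).restrict T3) := by
  rw [T3_eq]; infer_instance

lemma T3_compact : IsCompact T3 := isCompact_univ_pi (fun _ => isCompact_Icc)

lemma T3_meas : MeasurableSet T3 := T3_compact.measurableSet

lemma cont_intT3 {E : Type*} [NormedAddCommGroup E] {f : (Fin 3 → ℝ) → E} (hf : Continuous f) :
    Integrable f ((volume : Measure (Fin 3 → ℝ)).restrict T3) :=
  hf.continuousOn.integrableOn_compact T3_compact

lemma lap (s x : ℝ) (hs : 0 < s) :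
    ∫ t in Set.Ioi (0:ℝ), Complex.exp (-((s : ℂ) + Complex.I * x) * t) = ((s : ℂ) + Complex.I * x)⁻¹ := by
  rw [integral_exp_mul_complex_Ioi (by simpa using hs), Complex.ofReal_zero, mul_zero, Complex.exp_zero, neg_div_neg_eq, one_div]

lemma norm_lap (s x t : ℝ) : ‖Complex.exp (-((s : ℂ) + Complex.I * x) * t)‖ = Real.exp (-s * t) := by
  rw [Complex.norm_exp]; congr 1; simp

lemma exp_int (s : ℝ) (hs : 0 < s) : Integrable (fun t : ℝ => Real.exp (-s * t)) (volume.restrict (Set.Ioi (0:ℝ))) :=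
  exp_neg_integrableOn_Ioi 0 hs

lemma theta_eps_eq (ε α : ℝ) (hε : 0 < ε) :
    ThetaEps ε α = -Complex.I * ∫ t in Set.Ioi (0:ℝ), Complex.exp (-((ε : ℂ) - Complex.I * α) * t) * ∫ p in T3, Complex.exp (Complex.I * (((-t) * edisp p + 0 * edisp (p + 0) : ℝ) : ℂ)) := by
  have h1 : ThetaEps ε α = -Complex.I * ∫ p in T3, ∫ t in Set.Ioi (0:ℝ), Complex.exp (-((ε : ℂ) + Complex.I * ((edisp p - α : ℝ) : ℂ)) * t) := by
    rw [ThetaEps, ← integral_const_mul]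
    apply integral_congr_ae (ae_of_all _ _)
    intro p
    rw [lap _ _ hε]
    have hne : ((α : ℂ) - (edisp p : ℂ) + (ε : ℂ) * Complex.I) ≠ 0 := by
      intro h; have := congrArg Complex.im h; simp at this; exact hε.ne' this
    have e : (ε : ℂ) + Complex.I * ((edisp p - α : ℝ) : ℂ) = -Complex.I * ((α : ℂ) - (edisp p : ℂ) + (ε : ℂ) * Complex.I) := by
      push_cast; linear_combination (ε:ℂ) * Complex.I_sq
    rw [e, mul_inv, ← mul_assoc, mul_inv_cancel₀ (by simp), one_mul]
  rw [h1, integral_integral_swap]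
  · congr 1
    apply integral_congr_ae (ae_of_all _ _)
    intro t
    rw [← integral_const_mul]
    apply integral_congr_ae (ae_of_all _ _)
    intro p
    beta_reduce
    rw [← Complex.exp_add]; congr 1; push_cast; ring
  · have hi := (exp_int ε hε).comp_snd ((volume : Measure (Fin 3 → ℝ)).restrict T3)
    refine hi.mono' ?_ ?_
    · apply Continuous.aestronglyMeasurable
      have := edisp_cont
      simp only [Function.uncurry_def]
      fun_prop
    · apply ae_of_all
      rintro ⟨p, t⟩
      simp only [Function.uncurry]
      rw [norm_lap]

lemma Rj_zero (t y : ℝ) : Rj t 0 y = |t| := by simp [Rj]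

lemma theta_bd : ∃ M : ℝ, 1 ≤ M ∧ ∀ ε α : ℝ, 0 < ε → ‖ThetaEps ε α‖ ≤ M := by
  set g : ℝ → ℝ := fun t => 512 * (1 + ‖t‖) ^ (-(3/2) : ℝ) with hg
  have hgi : Integrable g volume := by
    apply Integrable.const_mul
    apply integrable_one_add_norm
    simp; norm_num
  refine ⟨max 1 (∫ t in Set.Ioi (0:ℝ), g t), le_max_left _ _, ?_⟩
  intro ε α hε
  refine le_trans ?_ (le_max_right _ _)
  rw [theta_eps_eq ε α hε, norm_mul, norm_neg, Complex.norm_I, one_mul]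
  apply norm_integral_le_of_norm_le hgi.integrableOn
  filter_upwards [ae_restrict_mem measurableSet_Ioi] with t ht
  have ht : 0 < t := ht
  have h1 := Phi_bound (-t) 0 0
  simp only [Rj_zero, Finset.prod_const, Finset.card_univ, Fintype.card_fin, abs_neg] at h1
  rw [norm_mul]
  have h2 : ‖Complex.exp (-((ε : ℂ) - Complex.I * α) * t)‖ ≤ 1 := by
    have := norm_lap ε (-α) t
    rw [show ((ε : ℂ) - Complex.I * α) = ((ε : ℂ) + Complex.I * ((-α : ℝ) : ℂ)) by push_cast; ring, this]
    rw [Real.exp_le_one_iff]; nlinarith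
  have h3 : (8 / Real.sqrt (1 + |t|))^3 = g t := by
    rw [hg]; simp only [Real.norm_eq_abs]
    rw [Real.rpow_neg (by positivity), show (3/2 : ℝ) = 1/2 * (3:ℕ) by norm_num, Real.rpow_mul (by positivity), Real.rpow_natCast, ← Real.sqrt_eq_rpow, div_pow]
    norm_num; rfl
  calc _ ≤ 1 * g t := by
        rw [← h3]
        exact mul_le_mul h2 h1 (norm_nonneg _) zero_le_one
    _ = _ := one_mul _

lemma theta_im (ε α : ℝ) (hε : 0 < ε) : (ThetaEps ε α).im ≤ 0 := by
  have hne : ∀ p, ((α : ℂ) - (edisp p : ℂ) + (ε : ℂ) * Complex.I) ≠ 0 := by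
    intro p h; have := congrArg Complex.im h; simp at this; exact hε.ne' this
  have hi : Integrable (fun p => ((α : ℂ) - (edisp p : ℂ) + (ε : ℂ) * Complex.I)⁻¹) ((volume : Measure (Fin 3 → ℝ)).restrict T3) := by
    apply cont_intT3
    have := edisp_cont
    exact Continuous.inv₀ (by fun_prop) hne
  have := integral_im hi
  rw [ThetaEps]
  simp only [RCLike.im_to_complex] at this
  rw [← this]
  apply integral_nonpos
  intro p
  simp only [Complex.inv_im, Pi.zero_apply]
  apply div_nonpos_of_nonpos_of_nonneg _ (Complex.normSq_nonneg _)
  simp; exact hε.le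

lemma E_bound (s s' α β σ : ℝ) (hs : 0 < s) (hs' : 0 < s') (q : Fin 3 → ℝ) :
    ‖∫ p in T3, ((s : ℂ) + Complex.I * ((α - edisp p : ℝ) : ℂ))⁻¹ * ((s' : ℂ) + Complex.I * ((σ * (β - edisp (p + q)) : ℝ) : ℂ))⁻¹‖ₑ
      ≤ ∫⁻ ξ in Set.Ioi (0:ℝ), ∫⁻ τ in Set.Ioi (0:ℝ), ENNReal.ofReal (Real.exp (-s * ξ) * Real.exp (-s' * τ) * ∏ j, (8 / Real.sqrt (1 + Rj ξ (σ * τ) (q j)))) := by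
  set μ : Measure ℝ := volume.restrict (Set.Ioi (0:ℝ)) with hμ
  set F : (Fin 3 → ℝ) → ℝ × ℝ → ℂ := fun p z =>
    Complex.exp (-((s : ℂ) + Complex.I * ((α - edisp p : ℝ) : ℂ)) * z.1) * Complex.exp (-((s' : ℂ) + Complex.I * ((σ * (β - edisp (p + q)) : ℝ) : ℂ)) * z.2) with hF
  have h1 : ∀ p, ((s : ℂ) + Complex.I * ((α - edisp p : ℝ) : ℂ))⁻¹ * ((s' : ℂ) + Complex.I * ((σ * (β - edisp (p + q)) : ℝ) : ℂ))⁻¹ = ∫ z, F p z ∂(μ.prod μ) := by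
    intro p
    rw [← lap _ _ hs, ← lap _ _ hs']
    exact (integral_prod_mul (μ := μ) (ν := μ) (fun t : ℝ => Complex.exp (-((s : ℂ) + Complex.I * ((α - edisp p : ℝ) : ℂ)) * t)) (fun t : ℝ => Complex.exp (-((s' : ℂ) + Complex.I * ((σ * (β - edisp (p + q)) : ℝ) : ℂ)) * t))).symm
  rw [integral_congr_ae (ae_of_all _ h1), integral_integral_swap]
  · refine (enorm_integral_le_lintegral_enorm _).trans ?_
    rw [lintegral_prod]
    · apply lintegral_mono; intro ξ
      apply lintegral_mono; intro τ
      beta_reduce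
      have e : ∀ p, F p (ξ, τ) = Complex.exp (-((s : ℂ) + Complex.I * (α : ℝ)) * ξ) * Complex.exp (-((s' : ℂ) + Complex.I * ((σ * β : ℝ) : ℂ)) * τ) * Complex.exp (Complex.I * ((ξ * edisp p + (σ * τ) * edisp (p + q) : ℝ) : ℂ)) := by
        intro p
        simp only [hF]
        rw [← Complex.exp_add, ← Complex.exp_add, ← Complex.exp_add]; congr 1; push_cast; ring
      rw [integral_congr_ae (ae_of_all _ e), integral_const_mul, ← ofReal_norm, norm_mul, norm_mul, norm_lap, norm_lap]
      apply ENNReal.ofReal_le_ofReal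
      gcongr
      exact Phi_bound _ _ _
    · apply AEStronglyMeasurable.enorm
      have hc : Continuous (Function.uncurry (fun z p => F p z)) := by
        have := edisp_cont
        simp only [Function.uncurry_def, hF]
        fun_prop
      exact (hc.stronglyMeasurable.integral_prod_right' (ν := volume.restrict T3)).aestronglyMeasurable
  · have hi := ((exp_int s hs).mul_prod (exp_int s' hs')).comp_snd ((volume : Measure (Fin 3 → ℝ)).restrict T3)
    refine hi.mono' ?_ ?_
    · apply Continuous.aestronglyMeasurable
      have := edisp_cont
      simp only [Function.uncurry_def, hF]
      fun_prop
    · apply ae_of_all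
      rintro ⟨p, t⟩
      simp only [Function.uncurry, hF]
      rw [norm_mul, norm_lap, norm_lap]

/-- pointwise bound on the Fourier side -/
lemma pw_bound (δ s s' σ ξ τ : ℝ) (hδ : 0 < δ) (hδ1 : δ ≤ 1) (hs : δ ≤ s) (hs' : δ ≤ s') (hσ : |σ| = 1) (hξ : 0 < ξ) (hτ : 0 < τ)
    (q : Fin 3 → ℝ) (j0 : Fin 3) (D : ℝ) (hD : D = |Real.sin (2 * Real.pi * q j0)|) (hD0 : 0 < D) :
    Real.exp (-s * ξ) * Real.exp (-s' * τ) * ∏ j, (8 / Real.sqrt (1 + Rj ξ (σ * τ) (q j)))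
     ≤ (256 * D ^ (-(1/2) : ℝ) * δ ^ (-(1/100) : ℝ)) * ((ξ ^ (-(1/2) : ℝ) * Real.exp (-(δ * ξ))) * (1 + ‖ξ - τ‖) ^ (-(101/100) : ℝ) + (τ ^ (-(1/2) : ℝ) * Real.exp (-(δ * τ))) * (1 + ‖ξ - τ‖) ^ (-(101/100) : ℝ)) := by
  set u := ‖ξ - τ‖ with hu
  have hu0 : 0 ≤ u := norm_nonneg _
  have hdiff : ∀ j, u ≤ Rj ξ (σ * τ) (q j) := by
    intro j
    have := Rj_diff ξ (σ * τ) (q j)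
    rwa [abs_mul, hσ, one_mul, abs_of_pos hξ, abs_of_pos hτ] at this
  have hsin : D * Real.sqrt (ξ * τ) ≤ Rj ξ (σ * τ) (q j0) := by
    have := Rj_sin ξ (σ * τ) (q j0)
    rwa [abs_mul, hσ, one_mul, abs_of_pos hξ, abs_of_pos hτ, ← hD] at this
  have b1 : ∀ j, 8 / Real.sqrt (1 + Rj ξ (σ * τ) (q j)) ≤ 8 * (1 + u) ^ (-(1/2) : ℝ) := by
    intro j
    rw [Real.rpow_neg (by positivity), ← Real.sqrt_eq_rpow, ← div_eq_mul_inv]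
    have := hdiff j
    gcongr
  have b2 : 8 / Real.sqrt (1 + Rj ξ (σ * τ) (q j0)) ≤ 8 * (D ^ (-(1/2) : ℝ) * (ξ ^ (-(1/4) : ℝ) * τ ^ (-(1/4) : ℝ))) := by
    have e : D ^ (-(1/2) : ℝ) * (ξ ^ (-(1/4) : ℝ) * τ ^ (-(1/4) : ℝ)) = (Real.sqrt (D * Real.sqrt (ξ * τ)))⁻¹ := by
      rw [Real.sqrt_eq_rpow, Real.sqrt_eq_rpow, Real.mul_rpow hD0.le (by positivity), ← Real.rpow_mul (by positivity), Real.mul_rpow hξ.le hτ.le, mul_inv, mul_inv, ← Real.rpow_neg hD0.le, ← Real.rpow_neg hξ.le, ← Real.rpow_neg hτ.le]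
      norm_num
    rw [e, ← div_eq_mul_inv]
    have hp : 0 < D * Real.sqrt (ξ * τ) := by positivity
    gcongr
    linarith
  have b3 : ∏ j, (8 / Real.sqrt (1 + Rj ξ (σ * τ) (q j))) ≤ 512 * (D ^ (-(1/2) : ℝ) * (ξ ^ (-(1/4) : ℝ) * τ ^ (-(1/4) : ℝ))) * (1 + u) ^ (-1 : ℝ) := by
    rw [← Finset.mul_prod_erase _ _ (Finset.mem_univ j0)]
    have : ∏ j ∈ Finset.univ.erase j0, (8 / Real.sqrt (1 + Rj ξ (σ * τ) (q j))) ≤ ∏ j ∈ Finset.univ.erase j0, (8 * (1 + u) ^ (-(1/2) : ℝ)) := by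
      apply Finset.prod_le_prod
      · intros; positivity
      · intro j _; exact b1 j
    rw [Finset.prod_const, Finset.card_erase_of_mem (Finset.mem_univ _), Finset.card_univ, Fintype.card_fin] at this
    have e : (8 * (1 + u) ^ (-(1/2) : ℝ))^(3-1) = 64 * (1 + u) ^ (-1 : ℝ) := by
      rw [mul_pow, ← Real.rpow_natCast ((1 + u) ^ (-(1/2) : ℝ)), ← Real.rpow_mul (by positivity)]; norm_num
    rw [e] at this
    calc _ ≤ (8 * (D ^ (-(1/2) : ℝ) * (ξ ^ (-(1/4) : ℝ) * τ ^ (-(1/4) : ℝ)))) * (64 * (1 + u) ^ (-1 : ℝ)) := by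
          apply mul_le_mul b2 this _ (by positivity)
          apply Finset.prod_nonneg; intros; positivity
      _ = _ := by ring
  have b4 : Real.exp (-s * ξ) * Real.exp (-s' * τ) ≤ Real.exp (-(δ * ξ) / 2) * Real.exp (-(δ * τ) / 2) * Real.exp (-(δ * u) / 2) := by
    rw [← Real.exp_add, ← Real.exp_add, ← Real.exp_add]
    apply Real.exp_le_exp.2
    have : u ≤ ξ + τ := by
      rw [hu, Real.norm_eq_abs, abs_le]; constructor <;> linarith
    nlinarith
  have b5 : Real.exp (-(δ * u) / 2) ≤ δ ^ (-(1/100) : ℝ) * (1 + u) ^ (-(1/100) : ℝ) := by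
    rw [← Real.mul_rpow hδ.le (by positivity), Real.rpow_neg (by positivity), neg_div, Real.exp_neg]
    apply inv_anti₀ (by positivity)
    calc (δ * (1 + u)) ^ (1/100 : ℝ) ≤ (1 + δ * u) ^ (1/100 : ℝ) := by
          apply Real.rpow_le_rpow (by positivity) _ (by norm_num)
          nlinarith
      _ ≤ (1 + δ * u) ^ (1/2 : ℝ) := by
          apply Real.rpow_le_rpow_of_exponent_le _ (by norm_num)
          nlinarith [mul_nonneg hδ.le hu0]
      _ ≤ (Real.exp (δ * u)) ^ (1/2 : ℝ) := by
          apply Real.rpow_le_rpow (by positivity) _ (by norm_num)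
          linarith [Real.add_one_le_exp (δ * u)]
      _ = _ := by rw [← Real.exp_mul]; congr 1; ring
  have b6 : (ξ ^ (-(1/4) : ℝ) * τ ^ (-(1/4) : ℝ)) * (Real.exp (-(δ * ξ) / 2) * Real.exp (-(δ * τ) / 2)) ≤ 1/2 * (ξ ^ (-(1/2) : ℝ) * Real.exp (-(δ * ξ)) + τ ^ (-(1/2) : ℝ) * Real.exp (-(δ * τ))) := by
    have sqr : ∀ x : ℝ, 0 < x → x ^ (-(1/2) : ℝ) * Real.exp (-(δ * x)) = (x ^ (-(1/4) : ℝ) * Real.exp (-(δ * x) / 2))^2 := by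
      intro x hx
      rw [mul_pow, ← Real.rpow_natCast, ← Real.rpow_mul hx.le, ← Real.exp_nat_mul]
      congr 1
      · norm_num
      · congr 1; push_cast; ring
    rw [sqr ξ hξ, sqr τ hτ]
    nlinarith [sq_nonneg (ξ ^ (-(1/4) : ℝ) * Real.exp (-(δ * ξ) / 2) - τ ^ (-(1/4) : ℝ) * Real.exp (-(δ * τ) / 2))]
  have b7 : (1 + u) ^ (-(101/100) : ℝ) = (1 + u) ^ (-1 : ℝ) * (1 + u) ^ (-(1/100) : ℝ) := by
    rw [← Real.rpow_add (by positivity)]; norm_num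
  calc _ ≤ (Real.exp (-(δ * ξ) / 2) * Real.exp (-(δ * τ) / 2) * (δ ^ (-(1/100) : ℝ) * (1 + u) ^ (-(1/100) : ℝ))) * (512 * (D ^ (-(1/2) : ℝ) * (ξ ^ (-(1/4) : ℝ) * τ ^ (-(1/4) : ℝ))) * (1 + u) ^ (-1 : ℝ)) := by
        apply mul_le_mul _ b3 _ (by positivity)
        · refine b4.trans ?_
          gcongr
        · apply Finset.prod_nonneg; intros; positivity
    _ = (512 * D ^ (-(1/2) : ℝ) * δ ^ (-(1/100) : ℝ) * (1 + u) ^ (-(101/100) : ℝ)) * ((ξ ^ (-(1/4) : ℝ) * τ ^ (-(1/4) : ℝ)) * (Real.exp (-(δ * ξ) / 2) * Real.exp (-(δ * τ) / 2))) := by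
        rw [b7]; ring
    _ ≤ (512 * D ^ (-(1/2) : ℝ) * δ ^ (-(1/100) : ℝ) * (1 + u) ^ (-(101/100) : ℝ)) * (1/2 * (ξ ^ (-(1/2) : ℝ) * Real.exp (-(δ * ξ)) + τ ^ (-(1/2) : ℝ) * Real.exp (-(δ * τ)))) := by
        gcongr
    _ = _ := by ring

lemma G_lint (δ : ℝ) (hδ : 0 < δ) :
    ∫⁻ ξ in Set.Ioi (0:ℝ), ENNReal.ofReal (ξ ^ (-(1/2) : ℝ) * Real.exp (-(δ * ξ))) = ENNReal.ofReal (δ ^ (-(1/2) : ℝ) * Real.Gamma (1/2)) := by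
  have h := Real.integral_rpow_mul_exp_neg_mul_Ioi (a := 1/2) (r := δ) (by norm_num) hδ
  have e : (1/2 - 1 : ℝ) = -(1/2) := by norm_num
  rw [e] at h
  have e2 : (1 / δ) ^ (1/2 : ℝ) = δ ^ (-(1/2) : ℝ) := by
    rw [one_div, Real.inv_rpow hδ.le, Real.rpow_neg hδ.le]
  rw [e2] at h
  have hne : ∫ ξ in Set.Ioi (0:ℝ), (ξ ^ (-(1/2) : ℝ) * Real.exp (-(δ * ξ))) ≠ 0 := by
    rw [h]; have := Real.Gamma_pos_of_pos (s := 1/2) (by norm_num); positivity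
  have hi := Integrable.of_integral_ne_zero hne
  rw [← h, ofReal_integral_eq_lintegral_ofReal hi]
  filter_upwards [ae_restrict_mem measurableSet_Ioi] with t ht
  have ht : 0 < t := ht
  simp only [Pi.zero_apply]; positivity

lemma four_side : ∃ C : ℝ, 0 < C ∧ ∀ (δ s s' σ : ℝ) (hδ : 0 < δ) (hδ1 : δ ≤ 1) (hs : δ ≤ s) (hs' : δ ≤ s') (hσ : |σ| = 1)
    (q : Fin 3 → ℝ) (j0 : Fin 3) (D : ℝ) (hD : D = |Real.sin (2 * Real.pi * q j0)|) (hD0 : 0 < D),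
    ∫⁻ ξ in Set.Ioi (0:ℝ), ∫⁻ τ in Set.Ioi (0:ℝ), ENNReal.ofReal (Real.exp (-s * ξ) * Real.exp (-s' * τ) * ∏ j, (8 / Real.sqrt (1 + Rj ξ (σ * τ) (q j))))
      ≤ ENNReal.ofReal (C * (D ^ (-(1/2) : ℝ) * δ ^ (-(51/100) : ℝ))) := by
  set H : ℝ → ℝ := fun u => (1 + ‖u‖) ^ (-(101/100) : ℝ) with hH
  have hHi : Integrable H volume := by
    apply integrable_one_add_norm; simp; norm_num
  have hHp : ∀ u, 0 ≤ H u := by intro u; simp only [hH]; positivity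
  set B := ∫ u, H u with hB
  have hB0 : 0 ≤ B := integral_nonneg hHp
  have hBl : ∫⁻ u, ENNReal.ofReal (H u) = ENNReal.ofReal B := by
    rw [hB, ofReal_integral_eq_lintegral_ofReal hHi (ae_of_all _ hHp)]
  have hGa := Real.Gamma_pos_of_pos (s := 1/2) (by norm_num)
  refine ⟨512 * (Real.Gamma (1/2) * (B + 1)), by positivity, ?_⟩
  intro δ s s' σ hδ hδ1 hs hs' hσ q j0 D hD hD0
  set K := 256 * D ^ (-(1/2) : ℝ) * δ ^ (-(1/100) : ℝ) with hK
  have hK0 : 0 ≤ K := by positivity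
  set G : ℝ → ℝ := fun ξ => ξ ^ (-(1/2) : ℝ) * Real.exp (-(δ * ξ)) with hG
  have hGm : Measurable G := by rw [hG]; fun_prop
  have hHm : Measurable H := by rw [hH]; fun_prop
  set μ : Measure ℝ := volume.restrict (Set.Ioi (0:ℝ)) with hμ
  have step1 : ∫⁻ ξ, ∫⁻ τ, ENNReal.ofReal (Real.exp (-s * ξ) * Real.exp (-s' * τ) * ∏ j, (8 / Real.sqrt (1 + Rj ξ (σ * τ) (q j)))) ∂μ ∂μ
      ≤ ∫⁻ ξ, ∫⁻ τ, (ENNReal.ofReal K * (ENNReal.ofReal (G ξ) * ENNReal.ofReal (H (ξ - τ)) + ENNReal.ofReal (G τ) * ENNReal.ofReal (H (ξ - τ)))) ∂μ ∂μ := by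
    apply lintegral_mono_ae
    filter_upwards [ae_restrict_mem measurableSet_Ioi] with ξ hξ
    apply lintegral_mono_ae
    filter_upwards [ae_restrict_mem measurableSet_Ioi] with τ hτ
    have hξ : 0 < ξ := hξ
    have hτ : 0 < τ := hτ
    have h := pw_bound δ s s' σ ξ τ hδ hδ1 hs hs' hσ hξ hτ q j0 D hD hD0
    have g1 : 0 ≤ G ξ := by simp only [hG]; positivity
    have g2 : 0 ≤ G τ := by simp only [hG]; positivity
    rw [← ENNReal.ofReal_mul g1, ← ENNReal.ofReal_mul g2, ← ENNReal.ofReal_add (mul_nonneg g1 (hHp _)) (mul_nonneg g2 (hHp _)), ← ENNReal.ofReal_mul hK0]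
    exact ENNReal.ofReal_le_ofReal h
  refine step1.trans ?_
  have hsub : ∀ ξ, ∫⁻ τ, ENNReal.ofReal (H (ξ - τ)) ∂μ ≤ ENNReal.ofReal B := by
    intro ξ
    calc _ ≤ ∫⁻ τ, ENNReal.ofReal (H (ξ - τ)) := lintegral_mono' Measure.restrict_le_self le_rfl
      _ = ∫⁻ τ, ENNReal.ofReal (H τ) := lintegral_sub_left_eq_self (fun u => ENNReal.ofReal (H u)) ξ
      _ = _ := hBl
  have hsub' : ∀ τ, ∫⁻ ξ, ENNReal.ofReal (H (ξ - τ)) ∂μ ≤ ENNReal.ofReal B := by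
    intro ξ
    calc _ ≤ ∫⁻ τ, ENNReal.ofReal (H (τ - ξ)) := lintegral_mono' Measure.restrict_le_self le_rfl
      _ = ∫⁻ τ, ENNReal.ofReal (H τ) := lintegral_sub_right_eq_self (fun u => ENNReal.ofReal (H u)) ξ
      _ = _ := hBl
  have hGl : ∫⁻ ξ, ENNReal.ofReal (G ξ) ∂μ = ENNReal.ofReal (δ ^ (-(1/2) : ℝ) * Real.Gamma (1/2)) := G_lint δ hδ
  have m1 : Measurable (fun z : ℝ × ℝ => ENNReal.ofReal (G z.1) * ENNReal.ofReal (H (z.1 - z.2))) := by fun_prop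
  have m2 : Measurable (fun z : ℝ × ℝ => ENNReal.ofReal (G z.2) * ENNReal.ofReal (H (z.1 - z.2))) := by fun_prop
  have t1 : ∫⁻ ξ, ∫⁻ τ, ENNReal.ofReal (G ξ) * ENNReal.ofReal (H (ξ - τ)) ∂μ ∂μ ≤ ENNReal.ofReal (δ ^ (-(1/2) : ℝ) * Real.Gamma (1/2)) * ENNReal.ofReal B := by
    rw [← hGl, ← lintegral_mul_const _ (by fun_prop)]
    apply lintegral_mono; intro ξ
    beta_reduce
    rw [lintegral_const_mul _ (by fun_prop)]
    gcongr
    exact hsub ξ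
  have t2 : ∫⁻ ξ, ∫⁻ τ, ENNReal.ofReal (G τ) * ENNReal.ofReal (H (ξ - τ)) ∂μ ∂μ ≤ ENNReal.ofReal (δ ^ (-(1/2) : ℝ) * Real.Gamma (1/2)) * ENNReal.ofReal B := by
    rw [lintegral_lintegral_swap m2.aemeasurable, ← hGl, ← lintegral_mul_const _ (by fun_prop)]
    apply lintegral_mono; intro ξ
    beta_reduce
    rw [lintegral_const_mul _ (by fun_prop)]
    gcongr
    exact hsub' ξ
  have step2 : ∫⁻ ξ, ∫⁻ τ, (ENNReal.ofReal K * (ENNReal.ofReal (G ξ) * ENNReal.ofReal (H (ξ - τ)) + ENNReal.ofReal (G τ) * ENNReal.ofReal (H (ξ - τ)))) ∂μ ∂μ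
      = ENNReal.ofReal K * (∫⁻ ξ, ∫⁻ τ, ENNReal.ofReal (G ξ) * ENNReal.ofReal (H (ξ - τ)) ∂μ ∂μ + ∫⁻ ξ, ∫⁻ τ, ENNReal.ofReal (G τ) * ENNReal.ofReal (H (ξ - τ)) ∂μ ∂μ) := by
    rw [← lintegral_add_left m1.lintegral_prod_right', ← lintegral_const_mul']
    · apply lintegral_congr; intro ξ
      rw [lintegral_const_mul _ (by fun_prop), lintegral_add_left (by fun_prop)]
    · exact ENNReal.ofReal_ne_top
  rw [step2]
  calc _ ≤ ENNReal.ofReal K * (ENNReal.ofReal (δ ^ (-(1/2) : ℝ) * Real.Gamma (1/2)) * ENNReal.ofReal B + ENNReal.ofReal (δ ^ (-(1/2) : ℝ) * Real.Gamma (1/2)) * ENNReal.ofReal B) := by gcongr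
    _ = ENNReal.ofReal (K * (2 * (δ ^ (-(1/2) : ℝ) * Real.Gamma (1/2) * B))) := by
        rw [← ENNReal.ofReal_mul (by positivity), ← ENNReal.ofReal_add (by positivity) (by positivity), ← ENNReal.ofReal_mul hK0, two_mul]
    _ ≤ _ := by
        apply ENNReal.ofReal_le_ofReal
        have e : δ ^ (-(51/100) : ℝ) = δ ^ (-(1/100) : ℝ) * δ ^ (-(1/2) : ℝ) := by
          rw [← Real.rpow_add hδ]; norm_num
        rw [hK, e]
        have : 256 * D ^ (-(1/2) : ℝ) * δ ^ (-(1/100) : ℝ) * (2 * (δ ^ (-(1/2) : ℝ) * Real.Gamma (1/2) * B)) = (512 * D ^ (-(1/2) : ℝ) * δ ^ (-(1/100) : ℝ) * δ ^ (-(1/2) : ℝ) * Real.Gamma (1/2)) * B := by ring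
        rw [this]
        have : 512 * (Real.Gamma (1/2) * (B + 1)) * (D ^ (-(1/2) : ℝ) * (δ ^ (-(1/100) : ℝ) * δ ^ (-(1/2) : ℝ))) = (512 * D ^ (-(1/2) : ℝ) * δ ^ (-(1/100) : ℝ) * δ ^ (-(1/2) : ℝ) * Real.Gamma (1/2)) * (B + 1) := by ring
        rw [this]
        gcongr
        linarith

def Pk (s x : ℝ) : ℝ := s / (x^2 + s^2)

lemma Pk_cont (s : ℝ) (hs : 0 < s) : Continuous (Pk s) := by
  unfold Pk
  apply Continuous.div (by fun_prop) (by fun_prop)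
  intro x; positivity

lemma Pk_nonneg (s x : ℝ) (hs : 0 < s) : 0 ≤ Pk s x := by unfold Pk; positivity

lemma inv_eq_Pk (s x : ℝ) (hs : 0 < s) : ((s : ℂ) + Complex.I * (x : ℂ))⁻¹ = ((Pk s x : ℝ) : ℂ) - Complex.I * ((x / (x^2 + s^2) : ℝ) : ℂ) := by
  have h : (x^2 + s^2) ≠ 0 := by positivity
  have h' : ((x : ℂ)^2 + (s : ℂ)^2) ≠ 0 := by exact_mod_cast h
  apply inv_eq_of_mul_eq_one_right
  unfold Pk
  push_cast
  field_simp
  linear_combination (-(x:ℂ)^2) * Complex.I_sq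

lemma Pk_prod (s s' x y : ℝ) (hs : 0 < s) (hs' : 0 < s') :
    ((Pk s x * Pk s' y : ℝ) : ℂ).re = 1/2 * (((s : ℂ) + Complex.I * (x : ℂ))⁻¹ * ((s' : ℂ) + Complex.I * ((1 * y : ℝ) : ℂ))⁻¹
       + ((s : ℂ) + Complex.I * (x : ℂ))⁻¹ * ((s' : ℂ) + Complex.I * (((-1) * y : ℝ) : ℂ))⁻¹).re := by
  rw [inv_eq_Pk _ _ hs, inv_eq_Pk _ _ hs', inv_eq_Pk _ _ hs']
  have h1 : Pk s' (-1 * y) = Pk s' y := by simp [Pk]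
  have h2 : Pk s' (1 * y) = Pk s' y := by simp [Pk]
  have h3 : (-1 * y) / ((-1 * y)^2 + s'^2) = -(y / (y^2 + s'^2)) := by
    rw [show (-1 * y)^2 = y^2 by ring, neg_one_mul, neg_div]
  have h4 : (1 * y) / ((1 * y)^2 + s'^2) = y / (y^2 + s'^2) := by rw [one_mul]
  rw [h1, h2, h3, h4]
  generalize x / (x^2 + s^2) = a
  generalize y / (y^2 + s'^2) = b
  generalize Pk s x = c
  generalize Pk s' y = d
  simp only [Complex.ofReal_re, Complex.add_re, Complex.mul_re, Complex.sub_re, Complex.sub_im, Complex.ofReal_im, Complex.I_re, Complex.I_im, Complex.mul_im, Complex.ofReal_neg, Complex.neg_re, Complex.neg_im]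
  ring

lemma L_bound : ∃ C : ℝ, 0 < C ∧ ∀ (δ s s' α β : ℝ), 0 < δ → δ ≤ 1 → δ ≤ s → δ ≤ s' →
    ∀ (q : Fin 3 → ℝ) (j0 : Fin 3) (D : ℝ), D = |Real.sin (2 * Real.pi * q j0)| → 0 < D →
    ∫ p in T3, Pk s (α - edisp p) * Pk s' (β - edisp (p + q)) ≤ C * (D ^ (-(1/2) : ℝ) * δ ^ (-(51/100) : ℝ)) := by
  obtain ⟨C, hC, h⟩ := four_side
  refine ⟨C, hC, ?_⟩
  intro δ s s' α β hδ hδ1 hs hs' q j0 D hD hD0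
  have hs0 : 0 < s := by linarith
  have hs0' : 0 < s' := by linarith
  have hec := edisp_cont
  set X : ℝ := C * (D ^ (-(1/2) : ℝ) * δ ^ (-(51/100) : ℝ)) with hX
  have hX0 : 0 ≤ X := by positivity
  set F : ℝ → (Fin 3 → ℝ) → ℂ := fun σ p => ((s : ℂ) + Complex.I * ((α - edisp p : ℝ) : ℂ))⁻¹ * ((s' : ℂ) + Complex.I * ((σ * (β - edisp (p + q)) : ℝ) : ℂ))⁻¹ with hF
  have hb : ∀ σ : ℝ, |σ| = 1 → ‖∫ p in T3, F σ p‖ ≤ X := by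
    intro σ hσ
    have := (E_bound s s' α β σ hs0 hs0' q).trans (h δ s s' σ hδ hδ1 hs hs' hσ q j0 D hD hD0)
    rw [← ofReal_norm] at this
    exact (ENNReal.ofReal_le_ofReal_iff hX0).1 this
  have hne : ∀ t x : ℝ, 0 < t → ((t : ℂ) + Complex.I * (x : ℂ)) ≠ 0 := by
    intro t x ht h; have := congrArg Complex.re h; simp at this; exact ht.ne' this
  have hFc : ∀ σ, Continuous (F σ) := by
    intro σ
    simp only [hF]
    apply Continuous.mul
    · exact Continuous.inv₀ (by fun_prop) (fun p => hne _ _ hs0)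
    · exact Continuous.inv₀ (by fun_prop) (fun p => hne _ _ hs0')
  have e : ∀ p, Pk s (α - edisp p) * Pk s' (β - edisp (p + q)) = 1/2 * ((F 1 p + F (-1) p).re) := by
    intro p
    have := Pk_prod s s' (α - edisp p) (β - edisp (p + q)) hs0 hs0'
    rw [Complex.ofReal_re] at this
    exact this
  have hi : Integrable (fun p => F 1 p + F (-1) p) (volume.restrict T3) := cont_intT3 ((hFc 1).add (hFc (-1)))
  have hre := integral_re hi
  simp only [RCLike.re_to_complex] at hre
  rw [integral_congr_ae (ae_of_all _ e), integral_const_mul, hre, integral_add (cont_intT3 (hFc 1)) (cont_intT3 (hFc (-1)))]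
  have h1 := hb 1 (by simp)
  have h2 := hb (-1) (by simp)
  have h3 := Complex.re_le_norm (∫ p in T3, F 1 p)
  have h4 := Complex.re_le_norm (∫ p in T3, F (-1) p)
  rw [Complex.add_re]
  linarith

lemma kern (δ x : ℝ) (N : ℕ) (hδ : 0 < δ) (hδ1 : δ ≤ 1) (hx : |x| ≤ 18) (hN : 20 ≤ 2^N * δ) :
    1 / (|x| + δ) ≤ 100 * δ ^ (-(1/100) : ℝ) * ∑ k ∈ Finset.range N, ((1/2 : ℝ) ^ (1/100 : ℝ))^k * Pk (2^k * δ) x := by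
  set m := max |x| δ with hm
  have hm1 : 1 ≤ m / δ := by rw [le_div_iff₀ hδ, one_mul]; exact le_max_right _ _
  obtain ⟨k, hk1, hk2⟩ := exists_nat_pow_near hm1 (by norm_num : (1:ℝ) < 2)
  rw [le_div_iff₀ hδ] at hk1
  rw [div_lt_iff₀ hδ] at hk2
  set s := 2^k * δ with hs
  have hs0 : 0 < s := by positivity
  have hmx : m ≤ 18 := max_le hx (by linarith)
  have hmle : m ≤ |x| + δ := max_le (by linarith) (by linarith [abs_nonneg x])
  have hx2 : |x| ≤ 2 * s := by
    have : |x| ≤ m := le_max_left _ _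
    rw [pow_succ] at hk2; rw [hs]; nlinarith
  have hkN : k < N := by
    by_contra hcon
    push Not at hcon
    have : (2:ℝ)^N ≤ 2^k := pow_le_pow_right₀ (by norm_num) hcon
    have : (2:ℝ)^N * δ ≤ 2^k * δ := by gcongr
    linarith
  have hPk : 1 / (5 * (|x| + δ)) ≤ Pk s x := by
    have h1 : 1 / (5 * (|x| + δ)) ≤ 1 / (5 * s) := by
      apply one_div_le_one_div_of_le (by positivity); linarith
    have h2 : 1 / (5 * s) ≤ Pk s x := by
      unfold Pk
      rw [div_le_div_iff₀ (by positivity) (by positivity)]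
      have : x^2 ≤ (2*s)^2 := by rw [← sq_abs]; gcongr
      nlinarith
    exact h1.trans h2
  have hw : 1/20 ≤ δ ^ (-(1/100) : ℝ) * ((1/2 : ℝ) ^ (1/100 : ℝ))^k := by
    have e : ((1/2 : ℝ) ^ (1/100 : ℝ))^k = (2^k : ℝ) ^ (-(1/100) : ℝ) := by
      rw [← Real.rpow_natCast, ← Real.rpow_mul (by norm_num), mul_comm, Real.rpow_mul (by norm_num), Real.rpow_natCast, Real.rpow_neg (by positivity), ← Real.inv_rpow (by positivity)]
      congr 1; simp
    rw [e, ← Real.mul_rpow hδ.le (by positivity), mul_comm]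
    calc (1/20 : ℝ) = 20 ^ (-1 : ℝ) := by rw [Real.rpow_neg_one]; norm_num
      _ ≤ 20 ^ (-(1/100) : ℝ) := Real.rpow_le_rpow_of_exponent_le (by norm_num) (by norm_num)
      _ ≤ (2^k * δ) ^ (-(1/100) : ℝ) := by
          apply Real.rpow_le_rpow_of_nonpos hs0 (by linarith) (by norm_num)
  have hsum : ((1/2 : ℝ) ^ (1/100 : ℝ))^k * Pk (2^k * δ) x ≤ ∑ k ∈ Finset.range N, ((1/2 : ℝ) ^ (1/100 : ℝ))^k * Pk (2^k * δ) x := by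
    apply Finset.single_le_sum (f := fun k => ((1/2 : ℝ) ^ (1/100 : ℝ))^k * Pk (2^k * δ) x) _ (Finset.mem_range.2 hkN)
    intro i _
    have := Pk_nonneg (2^i * δ) x (by positivity)
    positivity
  calc 1 / (|x| + δ) = 100 * (1/20) * (1 / (5 * (|x| + δ))) := by
        have : 0 < |x| + δ := by positivity
        field_simp; norm_num
    _ ≤ 100 * (δ ^ (-(1/100) : ℝ) * ((1/2 : ℝ) ^ (1/100 : ℝ))^k) * Pk s x := by gcongr
    _ = 100 * δ ^ (-(1/100) : ℝ) * (((1/2 : ℝ) ^ (1/100 : ℝ))^k * Pk (2^k * δ) x) := by rw [hs]; ring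
    _ ≤ _ := by gcongr

lemma edisp_nonneg (p : Fin 3 → ℝ) : 0 ≤ edisp p := by
  unfold edisp
  apply Finset.sum_nonneg; intro j _
  linarith [Real.cos_le_one (2 * Real.pi * p j)]

lemma edisp_le (p : Fin 3 → ℝ) : edisp p ≤ 6 := by
  unfold edisp
  rw [Fin.sum_univ_three]
  linarith [Real.neg_one_le_cos (2 * Real.pi * p 0), Real.neg_one_le_cos (2 * Real.pi * p 1), Real.neg_one_le_cos (2 * Real.pi * p 2)]

lemma abs_sub_edisp (α : ℝ) (hα : |α| ≤ 12) (p : Fin 3 → ℝ) : |α - edisp p| ≤ 18 := by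
  have h1 := edisp_nonneg p
  have h2 := edisp_le p
  rw [abs_le] at *
  constructor <;> linarith

lemma I0_bound : ∃ C : ℝ, 0 < C ∧ ∀ (δ α β : ℝ), 0 < δ → δ ≤ 1 → |α| ≤ 12 → |β| ≤ 12 →
    ∀ (q : Fin 3 → ℝ) (j0 : Fin 3) (D : ℝ), D = |Real.sin (2 * Real.pi * q j0)| → 0 < D →
    ∫ p in T3, 1 / (|α - edisp p| + δ) * (1 / (|β - edisp (p + q)| + δ)) ≤ C * (D ^ (-(1/2) : ℝ) * δ ^ (-(53/100) : ℝ)) := by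
  obtain ⟨C, hC, h⟩ := L_bound
  set x0 : ℝ := (1/2 : ℝ) ^ (1/100 : ℝ) with hx0
  have hx00 : 0 < x0 := by positivity
  have hx01 : x0 < 1 := Real.rpow_lt_one (by norm_num) (by norm_num) (by norm_num)
  have hg0 : 0 < (1 - x0)⁻¹ := inv_pos.2 (by linarith)
  have hgeo : ∀ N : ℕ, ∑ k ∈ Finset.range N, x0^k ≤ (1 - x0)⁻¹ := by
    intro N
    rw [← tsum_geometric_of_lt_one hx00.le hx01]
    exact (summable_geometric_of_lt_one hx00.le hx01).sum_le_tsum _ (fun i _ => by positivity)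
  refine ⟨100^2 * ((1 - x0)⁻¹)^2 * C, by positivity, ?_⟩
  intro δ α β hδ hδ1 hα hβ q j0 D hD hD0
  have hec := edisp_cont
  obtain ⟨N, hN⟩ := pow_unbounded_of_one_lt (20 / δ) (by norm_num : (1:ℝ) < 2)
  have hN : 20 ≤ 2^N * δ := by rw [div_lt_iff₀ hδ] at hN; exact hN.le
  have hsc : ∀ k : ℕ, δ ≤ 2^k * δ := by
    intro k
    have : (1:ℝ) ≤ 2^k := one_le_pow₀ (by norm_num)
    nlinarith
  have hc1 : Continuous (fun p => 1 / (|α - edisp p| + δ) * (1 / (|β - edisp (p + q)| + δ))) := by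
    apply Continuous.mul
    · exact Continuous.div (by fun_prop) (by fun_prop) (fun p => by positivity)
    · exact Continuous.div (by fun_prop) (by fun_prop) (fun p => by positivity)
  have hcP : ∀ k l : ℕ, Continuous (fun p => Pk (2^k * δ) (α - edisp p) * Pk (2^l * δ) (β - edisp (p + q))) := by
    intro k l
    apply Continuous.mul
    · exact (Pk_cont _ (by positivity)).comp (by fun_prop)
    · exact (Pk_cont _ (by positivity)).comp (by fun_prop)
  set W : ℝ := 100^2 * (δ ^ (-(1/100) : ℝ))^2 with hW
  have hW0 : 0 ≤ W := by positivity
  have hpt : ∀ p, 1 / (|α - edisp p| + δ) * (1 / (|β - edisp (p + q)| + δ)) ≤ W * ∑ k ∈ Finset.range N, ∑ l ∈ Finset.range N, x0^k * x0^l * (Pk (2^k * δ) (α - edisp p) * Pk (2^l * δ) (β - edisp (p + q))) := by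
    intro p
    have k1 := kern δ (α - edisp p) N hδ hδ1 (abs_sub_edisp α hα p) hN
    have k2 := kern δ (β - edisp (p+q)) N hδ hδ1 (abs_sub_edisp β hβ (p+q)) hN
    refine (mul_le_mul k1 k2 (by positivity) (le_trans (by positivity) k1)).trans (le_of_eq ?_)
    rw [mul_mul_mul_comm, Finset.sum_mul_sum, hW]
    congr 1
    · ring
    · apply Finset.sum_congr rfl; intro k _
      apply Finset.sum_congr rfl; intro l _
      ring
  have hi : ∀ k l : ℕ, Integrable (fun p => x0^k * x0^l * (Pk (2^k * δ) (α - edisp p) * Pk (2^l * δ) (β - edisp (p + q)))) (volume.restrict T3) :=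
    fun k l => (cont_intT3 (hcP k l)).const_mul _
  have hIntg : ∫ p in T3, 1 / (|α - edisp p| + δ) * (1 / (|β - edisp (p + q)| + δ)) ≤ ∫ p in T3, W * ∑ k ∈ Finset.range N, ∑ l ∈ Finset.range N, x0^k * x0^l * (Pk (2^k * δ) (α - edisp p) * Pk (2^l * δ) (β - edisp (p + q))) := by
    apply integral_mono (cont_intT3 hc1) _ hpt
    apply Integrable.const_mul
    exact integrable_finsetSum _ (fun k _ => integrable_finsetSum _ (fun l _ => hi k l))
  refine hIntg.trans ?_
  rw [integral_const_mul, integral_finsetSum _ (fun k _ => integrable_finsetSum _ (fun l _ => hi k l))]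
  set X := C * (D ^ (-(1/2) : ℝ) * δ ^ (-(51/100) : ℝ)) with hX
  have hX0 : 0 ≤ X := by positivity
  have hb : ∑ k ∈ Finset.range N, ∫ p in T3, ∑ l ∈ Finset.range N, x0^k * x0^l * (Pk (2^k * δ) (α - edisp p) * Pk (2^l * δ) (β - edisp (p + q))) ≤ ∑ k ∈ Finset.range N, ∑ l ∈ Finset.range N, x0^k * x0^l * X := by
    apply Finset.sum_le_sum; intro k _
    rw [integral_finsetSum _ (fun l _ => hi k l)]
    apply Finset.sum_le_sum; intro l _
    rw [integral_const_mul]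
    have := h δ (2^k * δ) (2^l * δ) α β hδ hδ1 (hsc k) (hsc l) q j0 D hD hD0
    gcongr
  have hb2 : ∑ k ∈ Finset.range N, ∑ l ∈ Finset.range N, x0^k * x0^l * X ≤ ((1 - x0)⁻¹)^2 * X := by
    simp_rw [← Finset.sum_mul, ← Finset.sum_mul_sum]
    rw [sq]
    have := hgeo N
    gcongr
  calc _ ≤ W * (((1 - x0)⁻¹)^2 * X) := by
        gcongr
        exact hb.trans hb2
    _ = _ := by
        have e : δ ^ (-(53/100) : ℝ) = (δ ^ (-(1/100) : ℝ))^2 * δ ^ (-(51/100) : ℝ) := by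
          rw [← Real.rpow_natCast, ← Real.rpow_mul hδ.le, ← Real.rpow_add hδ]; norm_num
        rw [e, hW, hX]; ring

lemma sin_two_abs_lb (x : ℝ) (hx : |x| ≤ 1/2) : 2 * |x| ≤ |Real.sin (Real.pi * x)| := by
  have h := Real.mul_abs_le_abs_sin (x := Real.pi * x) (by rw [abs_mul, abs_of_pos Real.pi_pos]; nlinarith [Real.pi_pos])
  rw [abs_mul, abs_of_pos Real.pi_pos] at h
  have : 2 / Real.pi * (Real.pi * |x|) = 2 * |x| := by field_simp
  linarith

lemma S0i (a b : ℝ) : IntervalIntegrable (fun x : ℝ => x ^ (-(99/100):ℝ)) volume a b :=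
  intervalIntegral.intervalIntegrable_rpow' (by norm_num)

lemma S0 : IntervalIntegrable (fun x : ℝ => |x| ^ (-(99/100):ℝ)) volume (-(1/2)) (1/2) ∧ ∫ x in (-(1/2):ℝ)..(1/2), |x| ^ (-(99/100):ℝ) ≤ 200 := by
  have hi1 : IntervalIntegrable (fun x : ℝ => |x| ^ (-(99/100):ℝ)) volume 0 (1/2) := by
    apply (S0i 0 (1/2)).congr
    intro x hx
    rw [Set.uIoc_of_le (by norm_num)] at hx
    simp only [abs_of_pos hx.1]
  have hi2 : IntervalIntegrable (fun x : ℝ => |x| ^ (-(99/100):ℝ)) volume (-(1/2)) 0 := by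
    have := (hi1.comp_mul_left (c := -1)).symm
    simpa [div_neg] using this
  have v1 : ∫ x in (0:ℝ)..(1/2), |x| ^ (-(99/100):ℝ) ≤ 100 := by
    have : ∫ x in (0:ℝ)..(1/2), |x| ^ (-(99/100):ℝ) = ∫ x in (0:ℝ)..(1/2), x ^ (-(99/100):ℝ) := by
      apply intervalIntegral.integral_congr
      intro x hx
      rw [Set.uIcc_of_le (by norm_num)] at hx
      simp only [abs_of_nonneg hx.1]
    rw [this, integral_rpow (Or.inl (by norm_num))]
    rw [Real.zero_rpow (by norm_num)]
    have : ((1:ℝ)/2) ^ ((-(99/100):ℝ)+1) ≤ 1 := Real.rpow_le_one (by norm_num) (by norm_num) (by norm_num)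
    rw [div_le_iff₀ (by norm_num)]
    linarith
  have v2 : ∫ x in (-(1/2):ℝ)..0, |x| ^ (-(99/100):ℝ) = ∫ x in (0:ℝ)..(1/2), |x| ^ (-(99/100):ℝ) := by
    have := intervalIntegral.integral_comp_neg (a := 0) (b := 1/2) (fun x : ℝ => |x| ^ (-(99/100):ℝ))
    simp only [abs_neg, neg_zero] at this
    exact this.symm
  refine ⟨hi2.trans hi1, ?_⟩
  rw [← intervalIntegral.integral_add_adjacent_intervals hi2 hi1, v2]
  linarith

lemma Gcont (η c : ℝ) (hη : 0 < η) (m : ℝ) : Continuous (fun x : ℝ => (|Real.sin (m * x - c)| + η) ^ (-(99/100):ℝ)) := by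
  apply Continuous.rpow_const (by fun_prop)
  intro x; left; positivity

lemma S1a (η t c : ℝ) (hη : 0 < η) : ∫ x in t..(t+1), (|Real.sin (Real.pi * x - c)| + η) ^ (-(99/100):ℝ) ≤ 200 := by
  have hper : Function.Periodic (fun x => (|Real.sin (Real.pi * x)| + η) ^ (-(99/100):ℝ)) 1 := by
    intro x
    simp only [mul_add, mul_one, Real.sin_add_pi, abs_neg]
  have e1 : ∫ x in t..(t+1), (|Real.sin (Real.pi * x - c)| + η) ^ (-(99/100):ℝ)
      = ∫ x in (t - c / Real.pi)..(t - c/Real.pi + 1), (|Real.sin (Real.pi * x)| + η) ^ (-(99/100):ℝ) := by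
    have := intervalIntegral.integral_comp_sub_right (a := t) (b := t+1) (fun x => (|Real.sin (Real.pi * x)| + η) ^ (-(99/100):ℝ)) (c / Real.pi)
    rw [show t - c / Real.pi + 1 = t + 1 - c/Real.pi by ring, ← this]
    have : ∀ x, Real.pi * (x - c / Real.pi) = Real.pi * x - c := by intro x; field_simp
    simp only [this]
  rw [e1, hper.intervalIntegral_add_eq _ (-(1/2)), show (-(1/2):ℝ)+1 = 1/2 by norm_num]
  refine le_trans ?_ S0.2
  have hc : Continuous (fun x : ℝ => (|Real.sin (Real.pi * x)| + η) ^ (-(99/100):ℝ)) := by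
    simpa using Gcont η 0 hη Real.pi
  apply intervalIntegral.integral_mono_ae_restrict (by norm_num) (hc.intervalIntegrable _ _) S0.1
  have h1 : ∀ᵐ x ∂(volume.restrict (Set.Icc (-(1/2):ℝ) (1/2))), x ≠ 0 := ae_restrict_of_ae (Measure.ae_ne volume 0)
  filter_upwards [h1, ae_restrict_mem measurableSet_Icc] with x h0 hx
  apply Real.rpow_le_rpow_of_nonpos (abs_pos.2 h0) _ (by norm_num)
  have := sin_two_abs_lb x (abs_le.2 ⟨hx.1, hx.2⟩)
  linarith [abs_nonneg x]

lemma S1 (η c : ℝ) (hη : 0 < η) : ∫ x in Set.Icc (-(1/2):ℝ) (1/2), (|Real.sin (Real.pi * x - c)| + η) ^ (-(99/100):ℝ) ≤ 200 := by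
  rw [integral_Icc_eq_integral_Ioc, ← intervalIntegral.integral_of_le (by norm_num)]
  have := S1a η (-(1/2)) c hη
  norm_num at this ⊢
  exact this

lemma S2 (η c : ℝ) (hη : 0 < η) : ∫ x in Set.Icc (-(1/2):ℝ) (1/2), (|Real.sin (2 * Real.pi * (x - c))| + η) ^ (-(99/100):ℝ) ≤ 200 := by
  rw [integral_Icc_eq_integral_Ioc, ← intervalIntegral.integral_of_le (by norm_num)]
  have e := intervalIntegral.integral_comp_mul_left (a := -(1/2)) (b := 1/2) (fun x => (|Real.sin (Real.pi * x - 2 * Real.pi * c)| + η) ^ (-(99/100):ℝ)) (c := 2) (by norm_num)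
  have e2 : ∀ x, Real.pi * (2 * x) - 2 * Real.pi * c = 2 * Real.pi * (x - c) := by intro x; ring
  simp only [e2] at e
  rw [e]
  have h1 := S1a η (-1) (2 * Real.pi * c) hη
  have h2 := S1a η 0 (2 * Real.pi * c) hη
  have hc := Gcont η (2 * Real.pi * c) hη Real.pi
  rw [show (-1:ℝ)+1 = 0 by norm_num] at h1
  rw [show (0:ℝ)+1 = 1 by norm_num] at h2
  rw [show (2:ℝ) * -(1/2) = -1 by norm_num, show (2:ℝ) * (1/2) = 1 by norm_num,
    ← intervalIntegral.integral_add_adjacent_intervals (hc.intervalIntegrable (-1) 0) (hc.intervalIntegrable 0 1), smul_eq_mul]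
  linarith

lemma cos_fac (a : ℝ) : ∃ c : ℝ, ∀ x : ℝ, 2 * (|Real.sin (Real.pi * x - c)| * |Real.sin (Real.pi * x - (-c))|) ≤ |a - (1 - Real.cos (2 * Real.pi * x))| := by
  obtain ⟨t, ht⟩ : ∃ t : ℝ, ∀ y : ℝ, -1 ≤ y → y ≤ 1 → |y - Real.cos t| ≤ |a - (1 - y)| := by
    rcases le_total (1 - a) (-1) with h | h
    · refine ⟨Real.pi, fun y h1 h2 => ?_⟩
      rw [Real.cos_pi, abs_of_nonneg (by linarith), abs_of_nonneg (by linarith)]; linarith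
    · rcases le_total 1 (1 - a) with h' | h'
      · refine ⟨0, fun y h1 h2 => ?_⟩
        rw [Real.cos_zero, abs_of_nonpos (by linarith), abs_of_nonpos (by linarith)]; linarith
      · refine ⟨Real.arccos (1 - a), fun y h1 h2 => ?_⟩
        rw [Real.cos_arccos h h']
        apply le_of_eq; congr 1; ring
  refine ⟨t/2, fun x => ?_⟩
  refine le_trans (le_of_eq ?_) (ht _ (Real.neg_one_le_cos _) (Real.cos_le_one _))
  rw [Real.cos_sub_cos, abs_mul, abs_mul, show (2 * Real.pi * x + t)/2 = Real.pi * x - (-(t/2)) by ring, show (2 * Real.pi * x - t)/2 = Real.pi * x - t/2 by ring]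
  simp only [abs_neg, abs_two]
  ring

lemma inv_le_rp (δ y s : ℝ) (hδ : 0 < δ) (hy : 0 ≤ y) (hs1 : s ≤ 1) : 1 / (y + δ) ≤ δ ^ (-(1 - s)) * (y + δ) ^ (-s) := by
  have h0 : 0 < y + δ := by linarith
  have : 1 / (y + δ) = (y + δ) ^ (-(1-s)) * (y + δ) ^ (-s) := by
    rw [← Real.rpow_add h0, show -(1-s) + -s = -1 by ring, Real.rpow_neg_one, one_div]
  rw [this]
  apply mul_le_mul_of_nonneg_right _ (by positivity)
  exact Real.rpow_le_rpow_of_nonpos hδ (by linarith) (by linarith)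

lemma cI {f : ℝ → ℝ} (hf : Continuous f) : Integrable f (volume.restrict (Set.Icc (-(1/2):ℝ) (1/2))) :=
  hf.integrableOn_Icc

lemma A1 (δ a : ℝ) (hδ : 0 < δ) (hδ1 : δ ≤ 1) :
    ∫ x in Set.Icc (-(1/2):ℝ) (1/2), |Real.sin (2 * Real.pi * x)| / (|a - (1 - Real.cos (2 * Real.pi * x))| + δ) ≤ 400 * δ ^ (-(1/100) : ℝ) := by
  obtain ⟨c, hc⟩ := cos_fac a
  have hp : ∀ x : ℝ, |Real.sin (2 * Real.pi * x)| / (|a - (1 - Real.cos (2 * Real.pi * x))| + δ) ≤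
      δ ^ (-(1/100) : ℝ) * ((|Real.sin (Real.pi * x - c)| + δ) ^ (-(99/100):ℝ) + (|Real.sin (Real.pi * x - (-c))| + δ) ^ (-(99/100):ℝ)) := by
    intro x
    have h := hc x
    have hs : |Real.sin (2 * Real.pi * x)| ≤ |Real.sin (Real.pi * x - c)| + |Real.sin (Real.pi * x - (-c))| := by
      rw [show 2 * Real.pi * x = (Real.pi * x - c) + (Real.pi * x - (-c)) by ring, Real.sin_add]
      refine (abs_add_le _ _).trans ?_
      rw [abs_mul, abs_mul]
      have := Real.abs_cos_le_one (Real.pi * x - c)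
      have := Real.abs_cos_le_one (Real.pi * x - (-c))
      nlinarith [abs_nonneg (Real.sin (Real.pi * x - c)), abs_nonneg (Real.sin (Real.pi * x - (-c)))]
    have hu1 := Real.abs_sin_le_one (Real.pi * x - c)
    have hv1 := Real.abs_sin_le_one (Real.pi * x - (-c))
    have hu0 := abs_nonneg (Real.sin (Real.pi * x - c))
    have hv0 := abs_nonneg (Real.sin (Real.pi * x - (-c)))
    set u := |Real.sin (Real.pi * x - c)|
    set v := |Real.sin (Real.pi * x - (-c))|
    have k : ∀ w z : ℝ, 0 ≤ w → w ≤ 1 → 0 ≤ z → w / (2 * (w * z) + δ) ≤ δ ^ (-(1/100) : ℝ) * (z + δ) ^ (-(99/100):ℝ) := by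
      intro w z hw hw1 hz
      have := inv_le_rp δ z (99/100) hδ hz (by norm_num)
      rw [show -(1 - (99/100:ℝ)) = -(1/100) by norm_num] at this
      refine le_trans ?_ this
      rw [div_le_div_iff₀ (by positivity) (by positivity)]
      nlinarith [mul_nonneg hw hz]
    calc _ ≤ (u + v) / (2 * (u * v) + δ) := by
          apply div_le_div₀ (by positivity) hs (by positivity) (by linarith)
      _ = u / (2 * (u * v) + δ) + v / (2 * (v * u) + δ) := by rw [add_div, mul_comm u v]
      _ ≤ _ := by
          have := k u v hu0 hu1 hv0
          have := k v u hv0 hv1 hu0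
          linarith
  have c1 := Gcont δ c hδ Real.pi
  have c2 := Gcont δ (-c) hδ Real.pi
  calc _ ≤ ∫ x in Set.Icc (-(1/2):ℝ) (1/2), δ ^ (-(1/100) : ℝ) * ((|Real.sin (Real.pi * x - c)| + δ) ^ (-(99/100):ℝ) + (|Real.sin (Real.pi * x - (-c))| + δ) ^ (-(99/100):ℝ)) := by
        apply integral_mono_of_nonneg (ae_of_all _ fun x => by positivity) (cI ((c1.add c2).const_mul _)) (ae_of_all _ hp)
    _ ≤ _ := by
        rw [integral_const_mul, integral_add (cI c1) (cI c2), mul_comm]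
        apply mul_le_mul_of_nonneg_right _ (by positivity)
        linarith [S1 δ c hδ, S1 δ (-c) hδ]

lemma B1 (δ a : ℝ) (hδ : 0 < δ) (hδ1 : δ ≤ 1) :
    ∫ x in Set.Icc (-(1/2):ℝ) (1/2), 1 / (|a - (1 - Real.cos (2 * Real.pi * x))| + δ) ≤ 1200 * δ ^ (-(101/200) : ℝ) := by
  obtain ⟨c, hc⟩ := cos_fac a
  have hp : ∀ x : ℝ, 1 / (|a - (1 - Real.cos (2 * Real.pi * x))| + δ) ≤
      (3 * δ ^ (-(101/200) : ℝ)) * ((|Real.sin (Real.pi * x - c)| + δ) ^ (-(99/100):ℝ) + (|Real.sin (Real.pi * x - (-c))| + δ) ^ (-(99/100):ℝ)) := by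
    intro x
    have h := hc x
    have hu1 := Real.abs_sin_le_one (Real.pi * x - c)
    have hv1 := Real.abs_sin_le_one (Real.pi * x - (-c))
    have hu0 := abs_nonneg (Real.sin (Real.pi * x - c))
    have hv0 := abs_nonneg (Real.sin (Real.pi * x - (-c)))
    set u := |Real.sin (Real.pi * x - c)|
    set v := |Real.sin (Real.pi * x - (-c))|
    set y := |a - (1 - Real.cos (2 * Real.pi * x))|
    have hy : 0 ≤ y := abs_nonneg _
    have hz : (u + δ) * (v + δ) / 3 ≤ y + δ := by nlinarith [mul_nonneg hu0 hv0]
    have h1 := inv_le_rp δ y (99/200) hδ hy (by norm_num)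
    rw [show -(1 - (99/200:ℝ)) = -(101/200) by norm_num] at h1
    have h2 : (y + δ) ^ (-(99/200) : ℝ) ≤ ((u + δ) * (v + δ) / 3) ^ (-(99/200) : ℝ) :=
      Real.rpow_le_rpow_of_nonpos (by positivity) hz (by norm_num)
    have h3 : ((u + δ) * (v + δ) / 3) ^ (-(99/200) : ℝ) = (u+δ) ^ (-(99/200) : ℝ) * (v+δ) ^ (-(99/200) : ℝ) * 3 ^ (99/200 : ℝ) := by
      rw [Real.div_rpow (by positivity) (by norm_num), Real.mul_rpow (by positivity) (by positivity), Real.rpow_neg (x := 3) (by norm_num), div_inv_eq_mul]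
    have h4 : (3:ℝ) ^ (99/200 : ℝ) ≤ 3 := by
      have := Real.rpow_le_rpow_of_exponent_le (x := 3) (by norm_num) (show (99/200:ℝ) ≤ 1 by norm_num)
      simpa using this
    have sq : ∀ w : ℝ, 0 < w → w ^ (-(99/100):ℝ) = (w ^ (-(99/200) : ℝ)) ^ 2 := by
      intro w hw
      rw [← Real.rpow_natCast, ← Real.rpow_mul hw.le]; norm_num
    rw [sq (u+δ) (by positivity), sq (v+δ) (by positivity)]
    have p1 : 0 ≤ (u+δ) ^ (-(99/200) : ℝ) := by positivity
    have p2 : 0 ≤ (v+δ) ^ (-(99/200) : ℝ) := by positivity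
    have p3 : 0 ≤ δ ^ (-(101/200) : ℝ) := by positivity
    set U := (u+δ) ^ (-(99/200) : ℝ)
    set V := (v+δ) ^ (-(99/200) : ℝ)
    have h5 : U * V * 3 ^ (99/200 : ℝ) ≤ 3 * (U^2 + V^2) := by
      have : U * V ≤ U^2+V^2 := by nlinarith [sq_nonneg (U - V), sq_nonneg (U+V)]
      calc _ ≤ U * V * 3 := mul_le_mul_of_nonneg_left h4 (by positivity)
        _ ≤ _ := by linarith
    calc _ ≤ _ := h1
      _ ≤ δ ^ (-(101/200) : ℝ) * (3 * (U^2+V^2)) := mul_le_mul_of_nonneg_left (by linarith) p3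
      _ = _ := by ring
  have c1 := Gcont δ c hδ Real.pi
  have c2 := Gcont δ (-c) hδ Real.pi
  calc _ ≤ ∫ x in Set.Icc (-(1/2):ℝ) (1/2), (3 * δ ^ (-(101/200) : ℝ)) * ((|Real.sin (Real.pi * x - c)| + δ) ^ (-(99/100):ℝ) + (|Real.sin (Real.pi * x - (-c))| + δ) ^ (-(99/100):ℝ)) := by
        apply integral_mono_of_nonneg (ae_of_all _ fun x => by positivity) (cI ((c1.add c2).const_mul _)) (ae_of_all _ hp)
    _ ≤ _ := by
        rw [integral_const_mul, integral_add (cI c1) (cI c2)]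
        have h0 : 0 ≤ δ ^ (-(101/200) : ℝ) := by positivity
        nlinarith [S1 δ c hδ, S1 δ (-c) hδ]

/-- shifted versions -/
lemma shiftI {f : ℝ → ℝ} (hf : Function.Periodic f 1) (s : ℝ) :
    ∫ x in Set.Icc (-(1/2):ℝ) (1/2), f (x + s) = ∫ x in Set.Icc (-(1/2):ℝ) (1/2), f x := by
  rw [integral_Icc_eq_integral_Ioc, integral_Icc_eq_integral_Ioc, ← intervalIntegral.integral_of_le (by norm_num), ← intervalIntegral.integral_of_le (by norm_num)]
  rw [intervalIntegral.integral_comp_add_right]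
  have := hf.intervalIntegral_add_eq (-(1/2)+s) (-(1/2))
  rw [show -(1/2)+s+1 = 1/2 + s by ring, show -(1/2)+1 = (1/2:ℝ) by norm_num] at this
  exact this

lemma A1s (δ a s : ℝ) (hδ : 0 < δ) (hδ1 : δ ≤ 1) :
    ∫ x in Set.Icc (-(1/2):ℝ) (1/2), |Real.sin (2 * Real.pi * (x + s))| / (|a - (1 - Real.cos (2 * Real.pi * (x + s)))| + δ) ≤ 400 * δ ^ (-(1/100) : ℝ) := by
  have hp : Function.Periodic (fun x : ℝ => |Real.sin (2 * Real.pi * x)| / (|a - (1 - Real.cos (2 * Real.pi * x))| + δ)) 1 := by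
    intro x
    simp only [mul_add, mul_one, Real.sin_add_two_pi, Real.cos_add_two_pi]
  have := shiftI hp s
  rw [this]
  exact A1 δ a hδ hδ1

lemma fub (j : Fin 3) (u : (Fin 3 → ℝ) → ℝ) (hu : Continuous u) (v : Fin 2 → ℝ → ℝ) (hv : ∀ k, Continuous (v k))
    (hv0 : ∀ k x, 0 ≤ v k x) (A : ℝ) (B : Fin 2 → ℝ) (hA0 : 0 ≤ A)
    (hA : ∀ y : Fin 2 → ℝ, ∫ x in Set.Icc (-(1/2):ℝ) (1/2), u (j.insertNth x y) ≤ A)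
    (hB : ∀ k, ∫ x in Set.Icc (-(1/2):ℝ) (1/2), v k x ≤ B k) :
    ∫ p in T3, u p * ∏ k, v k (p (j.succAbove k)) ≤ A * ∏ k, B k := by
  set μ : Measure ℝ := volume.restrict (Set.Icc (-(1/2):ℝ) (1/2)) with hμ
  have hF : Continuous (fun p : Fin 3 → ℝ => u p * ∏ k, v k (p (j.succAbove k))) := by
    apply hu.mul
    apply continuous_finsetProd
    intro k _
    exact (hv k).comp (continuous_apply _)
  have hIntg := cont_intT3 hF
  have mp := measurePreserving_piFinSuccAbove (α := fun _ : Fin 3 => ℝ) (fun _ => μ) j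
  have e := mp.symm.integral_comp (MeasurableEquiv.measurableEmbedding _) (fun p : Fin 3 → ℝ => u p * ∏ k, v k (p (j.succAbove k)))
  have hIntg2 := (mp.symm.integrable_comp_emb (MeasurableEquiv.measurableEmbedding _) (g := fun p : Fin 3 → ℝ => u p * ∏ k, v k (p (j.succAbove k)))).2 (by rw [T3_eq] at hIntg; exact hIntg)
  rw [T3_eq, ← e]
  refine (integral_prod_symm _ hIntg2).le.trans ?_
  have e2 : ∀ (x : ℝ) (y : Fin 2 → ℝ), (fun p : Fin 3 → ℝ => u p * ∏ k, v k (p (j.succAbove k))) ((MeasurableEquiv.piFinSuccAbove (fun _ : Fin 3 => ℝ) j).symm (x, y)) = u (j.insertNth x y) * ∏ k, v k (y k) := by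
    intro x y
    have h : (MeasurableEquiv.piFinSuccAbove (fun _ : Fin 3 => ℝ) j).symm (x, y) = j.insertNth x y := rfl
    simp only [h, Fin.insertNth_apply_succAbove]
  have e3 : ∀ y : Fin 2 → ℝ, ∫ x, (fun p : Fin 3 → ℝ => u p * ∏ k, v k (p (j.succAbove k))) ((MeasurableEquiv.piFinSuccAbove (fun _ : Fin 3 => ℝ) j).symm (x, y)) ∂μ = (∫ x, u (j.insertNth x y) ∂μ) * ∏ k, v k (y k) := by
    intro y
    rw [← integral_mul_const]
    exact integral_congr_ae (ae_of_all _ fun x => e2 x y)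
  have hi3 := hIntg2.integral_prod_right
  have hvi : Integrable (fun y : Fin 2 → ℝ => ∏ k, v k (y k)) (Measure.pi fun _ : Fin 2 => μ) := by
    apply Integrable.fintype_prod
    intro k; exact cI (hv k)
  calc _ ≤ ∫ y : Fin 2 → ℝ, A * ∏ k, v k (y k) ∂(Measure.pi fun _ : Fin 2 => μ) := by
        apply integral_mono hi3 (hvi.const_mul _)
        intro y
        simp only [Function.comp_apply, e3]
        exact mul_le_mul_of_nonneg_right (hA y) (Finset.prod_nonneg fun k _ => hv0 k _)
    _ ≤ _ := by
        rw [integral_const_mul, integral_fintype_prod_eq_prod]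
        apply mul_le_mul_of_nonneg_left _ hA0
        apply Finset.prod_le_prod
        · intro k _; exact integral_nonneg (hv0 k)
        · intro k _; exact hB k

lemma edisp_insert (j : Fin 3) (x : ℝ) (y : Fin 2 → ℝ) (s : Fin 3 → ℝ) :
    edisp ((j.insertNth x y : Fin 3 → ℝ) + s) = (1 - Real.cos (2 * Real.pi * (x + s j))) + ∑ k, (1 - Real.cos (2 * Real.pi * (y k + s (j.succAbove k)))) := by
  unfold edisp
  rw [Fin.sum_univ_succAbove _ j]
  simp only [Pi.add_apply, Fin.insertNth_apply_same, Fin.insertNth_apply_succAbove]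

def Wt (η : ℝ) (r : Fin 3 → ℝ) (j : Fin 3) (p : Fin 3 → ℝ) : ℝ :=
  ∏ k : Fin 2, (|Real.sin (2 * Real.pi * (p (j.succAbove k) - r (j.succAbove k)))| + η) ^ (-(99/100):ℝ)

lemma Wt_cont (η : ℝ) (hη : 0 < η) (r : Fin 3 → ℝ) (j : Fin 3) : Continuous (Wt η r j) := by
  unfold Wt
  apply continuous_finsetProd
  intro k _
  apply Continuous.rpow_const (by fun_prop)
  intro x; left; positivity

lemma Wt_nonneg (η : ℝ) (hη : 0 < η) (r : Fin 3 → ℝ) (j : Fin 3) (p : Fin 3 → ℝ) : 0 ≤ Wt η r j p := by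
  unfold Wt
  exact Finset.prod_nonneg fun k _ => by positivity

lemma inv_cont (δ a : ℝ) (hδ : 0 < δ) (s : Fin 3 → ℝ) : Continuous (fun p : Fin 3 → ℝ => 1 / (|a - edisp (p + s)| + δ)) := by
  have := edisp_cont
  apply Continuous.div (by fun_prop) (by fun_prop)
  intro p; positivity

lemma K1 (δ a : ℝ) (hδ : 0 < δ) (hδ1 : δ ≤ 1) :
    ∫ p in T3, 1 / (|a - edisp p| + δ) ≤ 1200 * δ ^ (-(101/200) : ℝ) := by
  have h := fub 0 (fun p => 1 / (|a - edisp (p + 0)| + δ)) (inv_cont δ a hδ 0) (fun _ _ => 1) (fun _ => continuous_const)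
    (fun _ _ => zero_le_one) (1200 * δ ^ (-(101/200) : ℝ)) (fun _ => 1) (by positivity) ?_ ?_
  · simpa using h
  · intro y
    simp only [edisp_insert]
    refine le_trans (le_of_eq ?_) (B1 δ (a - ∑ k, (1 - Real.cos (2 * Real.pi * y k))) hδ hδ1)
    congr 1
    funext x
    congr 3
    simp
    ring
  · intro k
    simp
    norm_num

lemma K2 (δ η a : ℝ) (hδ : 0 < δ) (hδ1 : δ ≤ 1) (hη : 0 < η) (r : Fin 3 → ℝ) (j : Fin 3) :
    ∫ p in T3, 1 / (|a - edisp p| + δ) * Wt η r j p ≤ 1200 * δ ^ (-(101/200) : ℝ) * 200 ^ 2 := by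
  have h := fub j (fun p => 1 / (|a - edisp (p + 0)| + δ)) (inv_cont δ a hδ 0)
    (fun k x => (|Real.sin (2 * Real.pi * (x - r (j.succAbove k)))| + η) ^ (-(99/100):ℝ)) ?_
    (fun _ _ => by positivity) (1200 * δ ^ (-(101/200) : ℝ)) (fun _ => 200) (by positivity) ?_ ?_
  · simpa [Wt] using h
  · intro k
    apply Continuous.rpow_const (by fun_prop)
    intro x; left; positivity
  · intro y
    simp only [edisp_insert]
    refine le_trans (le_of_eq ?_) (B1 δ (a - ∑ k, (1 - Real.cos (2 * Real.pi * y k))) hδ hδ1)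
    congr 1
    funext x
    congr 3
    simp
    ring
  · intro k
    exact S2 η _ hη

lemma K3 (δ η a : ℝ) (hδ : 0 < δ) (hδ1 : δ ≤ 1) (hη : 0 < η) (r s : Fin 3 → ℝ) (j : Fin 3) :
    ∫ p in T3, |Real.sin (2 * Real.pi * (p j + s j))| * (1 / (|a - edisp (p + s)| + δ)) * Wt η r j p ≤ 400 * δ ^ (-(1/100) : ℝ) * 200 ^ 2 := by
  have h := fub j (fun p => |Real.sin (2 * Real.pi * (p j + s j))| * (1 / (|a - edisp (p + s)| + δ))) (Continuous.mul (by fun_prop) (inv_cont δ a hδ s))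
    (fun k x => (|Real.sin (2 * Real.pi * (x - r (j.succAbove k)))| + η) ^ (-(99/100):ℝ)) ?_
    (fun _ _ => by positivity) (400 * δ ^ (-(1/100) : ℝ)) (fun _ => 200) (by positivity) ?_ ?_
  · simpa [Wt] using h
  · intro k
    apply Continuous.rpow_const (by fun_prop)
    intro x; left; positivity
  · intro y
    simp only [edisp_insert]
    refine le_trans (le_of_eq ?_) (A1s δ (a - ∑ k, (1 - Real.cos (2 * Real.pi * (y k + s (j.succAbove k))))) (s j) hδ hδ1)
    congr 1
    funext x
    rw [Fin.insertNth_apply_same, mul_one_div]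
    congr 3
    ring
  · intro k
    exact S2 η _ hη

lemma sin_sub_tri (a b : ℝ) : |Real.sin (a + b)| ≤ |Real.sin a| + |Real.sin b| := by
  rw [Real.sin_add]
  refine (abs_add_le _ _).trans ?_
  rw [abs_mul, abs_mul]
  have := Real.abs_cos_le_one a
  have := Real.abs_cos_le_one b
  nlinarith [abs_nonneg (Real.sin a), abs_nonneg (Real.sin b)]

lemma T_dich (η ρ T : ℝ) (hη : 0 < η) (hρ : 0 < ρ) (hT : 0 < T) (r p : Fin 3 → ℝ)
    (h : ∀ j, η + |Real.sin (2 * Real.pi * (p j - r j))| ≤ 7 * T) :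
    1 / T ≤ 7 * ρ⁻¹ ∨ ((∀ j, |Real.sin (2 * Real.pi * (p j - r j))| ≤ ρ) ∧ ∀ j, 1 / T ≤ 7 * (ρ ^ (98/100 : ℝ) * Wt η r j p)) := by
  rcases le_total ρ (7 * T) with h1 | h1
  · left
    rw [div_le_iff₀ hT, mul_assoc, mul_comm, mul_assoc, inv_mul_eq_div, le_div_iff₀ hρ]
    linarith
  · right
    refine ⟨fun j => by linarith [h j], fun j => ?_⟩
    have hw : (7 * T) ^ (-(99/50) : ℝ) ≤ Wt η r j p := by
      unfold Wt
      rw [Fin.prod_univ_two, show (-(99/50):ℝ) = -(99/100) + -(99/100) by norm_num, Real.rpow_add (by positivity)]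
      have k : ∀ i, (7 * T) ^ (-(99/100) : ℝ) ≤ (|Real.sin (2 * Real.pi * (p i - r i))| + η) ^ (-(99/100) : ℝ) := by
        intro i
        apply Real.rpow_le_rpow_of_nonpos (by positivity) (by linarith [h i]) (by norm_num)
      exact mul_le_mul (k _) (k _) (by positivity) (by positivity)
    have h2 : (1 / (7 * T)) ≤ ρ ^ (98/100 : ℝ) * (7 * T) ^ (-(99/50) : ℝ) := by
      have : 1 / (7 * T) = (7*T) ^ (98/100 : ℝ) * (7 * T) ^ (-(99/50) : ℝ) := by
        rw [← Real.rpow_add (by positivity), one_div, ← Real.rpow_neg_one]; norm_num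
      rw [this]
      apply mul_le_mul_of_nonneg_right _ (by positivity)
      exact Real.rpow_le_rpow (by positivity) h1 (by norm_num)
    have h3 : 1 / T = 7 * (1 / (7 * T)) := by field_simp
    rw [h3]
    have := mul_le_mul_of_nonneg_left hw (show 0 ≤ ρ ^ (98/100 : ℝ) by positivity)
    linarith

lemma inv_le_inv_d (δ y : ℝ) (hδ : 0 < δ) (hy : 0 ≤ y) : 1 / (y + δ) ≤ δ⁻¹ := by
  rw [← one_div]; exact one_div_le_one_div_of_le hδ (by linarith)

lemma rmono (δ a b : ℝ) (hδ : 0 < δ) (hδ1 : δ ≤ 1) (h : b ≤ a) : δ ^ a ≤ δ ^ b :=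
  Real.rpow_le_rpow_of_exponent_ge hδ hδ1 h

lemma Outside : ∃ C : ℝ, 0 < C ∧ ∀ δ η α β, 0 < δ → δ ≤ 1 → 0 < η → η ≤ δ → |α| ≤ 12 → |β| ≤ 12 → ∀ (q : Fin 3 → ℝ) (j : Fin 3) (D : ℝ),
    D = |Real.sin (2 * Real.pi * q j)| →
    δ ^ (-(1/3) : ℝ) * (∫ p in T3, 1 / (|α - edisp p| + δ) * (1 / (|β - edisp (p + q)| + δ))) ≤ C * δ ^ (-(7/8) : ℝ) / (η + D) := by
  obtain ⟨C0, hC0, h0⟩ := I0_bound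
  refine ⟨2400 + 2 * C0, by positivity, ?_⟩
  intro δ η α β hδ hδ1 hη hηδ hα hβ q j D hD
  have hDn : 0 ≤ D := hD ▸ abs_nonneg _
  have hD1 : D ≤ 1 := hD ▸ Real.abs_sin_le_one _
  have cA : Continuous (fun p : Fin 3 → ℝ => 1 / (|α - edisp p| + δ)) := by simpa using inv_cont δ α hδ 0
  have p1 : 0 < δ ^ (-(1/3) : ℝ) := by positivity
  rcases le_total D δ with h | h
  · have hi : ∫ p in T3, 1 / (|α - edisp p| + δ) * (1 / (|β - edisp (p + q)| + δ)) ≤ (1200 * δ ^ (-(101/200) : ℝ)) * δ⁻¹ := by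
      refine le_trans ?_ (mul_le_mul_of_nonneg_right (K1 δ α hδ hδ1) (by positivity))
      rw [← integral_mul_const]
      apply integral_mono_of_nonneg (ae_of_all _ fun p => by positivity) (cont_intT3 (cA.mul_const _)) (ae_of_all _ fun p => ?_)
      exact mul_le_mul_of_nonneg_left (inv_le_inv_d δ _ hδ (abs_nonneg _)) (by positivity)
    rw [le_div_iff₀ (by linarith)]
    have e : δ ^ (-(1/3) : ℝ) * ((1200 * δ ^ (-(101/200) : ℝ)) * δ⁻¹) * (2 * δ) = 2400 * δ ^ (-(1/3) + -(101/200) : ℝ) := by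
      rw [Real.rpow_add hδ]; field_simp; norm_num
    have m := rmono δ (-(1/3) + -(101/200)) (-(7/8)) hδ hδ1 (by norm_num)
    have p2 : 0 < δ ^ (-(7/8) : ℝ) := by positivity
    calc _ ≤ δ ^ (-(1/3) : ℝ) * ((1200 * δ ^ (-(101/200) : ℝ)) * δ⁻¹) * (2 * δ) := by
          apply mul_le_mul (mul_le_mul_of_nonneg_left hi p1.le) (by linarith) (by linarith) (by positivity)
      _ ≤ _ := by rw [e]; nlinarith
  · have hD0 : 0 < D := by linarith
    have hi := h0 δ α β hδ hδ1 hα hβ q j D hD hD0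
    rw [le_div_iff₀ (by linarith)]
    have e : δ ^ (-(1/3) : ℝ) * (C0 * (D ^ (-(1/2):ℝ) * δ ^ (-(53/100) : ℝ))) * (2 * D) = 2 * C0 * (δ ^ (-(1/3) + -(53/100) : ℝ) * D ^ (-(1/2) + 1 : ℝ)) := by
      rw [Real.rpow_add hδ, Real.rpow_add hD0, Real.rpow_one]; ring
    have m := rmono δ (-(1/3) + -(53/100)) (-(7/8)) hδ hδ1 (by norm_num)
    have m2 : D ^ (-(1/2) + 1 : ℝ) ≤ 1 := Real.rpow_le_one hDn hD1 (by norm_num)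
    have p2 : 0 < δ ^ (-(7/8) : ℝ) := by positivity
    calc _ ≤ δ ^ (-(1/3) : ℝ) * (C0 * (D ^ (-(1/2):ℝ) * δ ^ (-(53/100) : ℝ))) * (2 * D) := by
          apply mul_le_mul (mul_le_mul_of_nonneg_left hi p1.le) (by linarith) (by linarith) (by positivity)
      _ ≤ 2 * C0 * (δ ^ (-(7/8) : ℝ) * 1) := by
          rw [e]
          apply mul_le_mul_of_nonneg_left _ (by positivity)
          exact mul_le_mul m m2 (by positivity) (by positivity)
      _ ≤ _ := by nlinarith

/-- Existence of an integrable inside majorant. -/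
lemma Inside (δ η α β : ℝ) (hδ : 0 < δ) (hδ1 : δ ≤ 1) (hη : 0 < η) (hηδ : η ≤ δ) (q r : Fin 3 → ℝ) (j : Fin 3) (D : ℝ)
    (hD : D = |Real.sin (2 * Real.pi * q j)|) :
    ∃ g : (Fin 3 → ℝ) → ℝ, Continuous g ∧ (∀ p, 0 ≤ g p) ∧
      (∀ p, (∀ i, |Real.sin (2 * Real.pi * (p i - r i))| ≤ δ ^ (1/3 : ℝ)) →
        1 / (|α - edisp p| + δ) * (1 / (|β - edisp (p + q)| + δ)) * ((δ ^ (1/3 : ℝ)) ^ (98/100 : ℝ) * Wt η r j p) ≤ g p) ∧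
      ∫ p in T3, g p ≤ 10 ^ 9 * δ ^ (-(7/8) : ℝ) / (η + D) := by
  set ρ := δ ^ (1/3 : ℝ) with hρ
  have hρ0 : 0 < ρ := by positivity
  have hδρ : δ ≤ ρ := by
    have := rmono δ 1 (1/3) hδ hδ1 (by norm_num)
    rwa [Real.rpow_one] at this
  have hρp : ρ ^ (98/100 : ℝ) = δ ^ (49/150 : ℝ) := by
    rw [hρ, ← Real.rpow_mul hδ.le]; norm_num
  rw [hρp]
  have hDn : 0 ≤ D := hD ▸ abs_nonneg _
  have cA : Continuous (fun p : Fin 3 → ℝ => 1 / (|α - edisp p| + δ)) := by simpa using inv_cont δ α hδ 0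
  have cB := inv_cont δ β hδ q
  have cW := Wt_cont η hη r j
  have hW := Wt_nonneg η hη r j
  have pX : 0 < δ ^ (49/150 : ℝ) := by positivity
  have hdi : 0 < δ⁻¹ := by positivity
  have p2 : 0 < δ ^ (-(7/8) : ℝ) := by positivity
  rcases le_total D (4 * ρ) with h | h
  · refine ⟨fun p => δ ^ (49/150 : ℝ) * δ⁻¹ * (1 / (|α - edisp p| + δ) * Wt η r j p), ?_, ?_, ?_, ?_⟩
    · exact (cA.mul cW).const_mul _
    · intro p; have := hW p; positivity
    · intro p _
      have := inv_le_inv_d δ (|β - edisp (p + q)|) hδ (abs_nonneg _)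
      have h1 : 0 ≤ 1 / (|α - edisp p| + δ) := by positivity
      calc _ ≤ 1 / (|α - edisp p| + δ) * δ⁻¹ * (δ ^ (49/150 : ℝ) * Wt η r j p) := by
            apply mul_le_mul_of_nonneg_right (mul_le_mul_of_nonneg_left this h1)
            have := hW p; positivity
        _ = _ := by ring
    · rw [integral_const_mul]
      rw [le_div_iff₀ (by linarith)]
      have k := K2 δ η α hδ hδ1 hη r j
      have e : δ ^ (49/150 : ℝ) * δ⁻¹ * (1200 * δ ^ (-(101/200) : ℝ) * 200 ^ 2) * (5 * ρ) = (5 * 1200 * 200 ^ 2) * δ ^ (49/150 + -1 + -(101/200) + 1/3 : ℝ) := by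
        rw [Real.rpow_add hδ, Real.rpow_add hδ, Real.rpow_add hδ, Real.rpow_neg_one]; ring
      have m := rmono δ (49/150 + -1 + -(101/200) + 1/3 : ℝ) (-(7/8)) hδ hδ1 (by norm_num)
      calc _ ≤ δ ^ (49/150 : ℝ) * δ⁻¹ * (1200 * δ ^ (-(101/200) : ℝ) * 200 ^ 2) * (5 * ρ) := by
            apply mul_le_mul (mul_le_mul_of_nonneg_left k (by positivity)) (by linarith) (by linarith) (by positivity)
        _ ≤ _ := by rw [e]; nlinarith
  · have hD0 : 0 < D := by linarith
    have fin : ∀ I : ℝ, I ≤ 400 * δ ^ (-(1/100) : ℝ) * 200 ^ 2 → (4 / D * δ ^ (49/150 : ℝ) * δ⁻¹) * I ≤ 10 ^ 9 * δ ^ (-(7/8) : ℝ) / (η + D) := by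
      intro I hI
      rw [le_div_iff₀ (by linarith)]
      have e : (4 / D * δ ^ (49/150 : ℝ) * δ⁻¹) * (400 * δ ^ (-(1/100) : ℝ) * 200 ^ 2) * (2 * D) = (8 * 400 * 200 ^ 2) * δ ^ (49/150 + -1 + -(1/100) : ℝ) := by
        rw [Real.rpow_add hδ, Real.rpow_add hδ, Real.rpow_neg_one]; field_simp; norm_num
      have m := rmono δ (49/150 + -1 + -(1/100) : ℝ) (-(7/8)) hδ hδ1 (by norm_num)
      calc _ ≤ (4 / D * δ ^ (49/150 : ℝ) * δ⁻¹) * (400 * δ ^ (-(1/100) : ℝ) * 200 ^ 2) * (2 * D) := by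
            apply mul_le_mul (mul_le_mul_of_nonneg_left hI (by positivity)) (by linarith) (by linarith) (by positivity)
        _ ≤ _ := by rw [e]; nlinarith
    have split : D / 2 ≤ |Real.sin (2 * Real.pi * r j)| ∨ D / 2 ≤ |Real.sin (2 * Real.pi * (r j + q j))| := by
      by_contra hc
      push Not at hc
      have := sin_sub_tri (2 * Real.pi * (r j + q j)) (-(2 * Real.pi * r j))
      rw [show 2 * Real.pi * (r j + q j) + (-(2 * Real.pi * r j)) = 2 * Real.pi * q j by ring, ← hD, Real.sin_neg, abs_neg] at this
      linarith [hc.1, hc.2]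
    rcases split with hs | hs
    · refine ⟨fun p => (4 / D * δ ^ (49/150 : ℝ) * δ⁻¹) * (|Real.sin (2 * Real.pi * (p j + (0 : Fin 3 → ℝ) j))| * (1 / (|α - edisp (p + 0)| + δ)) * Wt η r j p), ?_, ?_, ?_, ?_⟩
      · apply Continuous.const_mul
        exact Continuous.mul (Continuous.mul (by fun_prop) (inv_cont δ α hδ 0)) cW
      · intro p; have := hW p; positivity
      · intro p hp
        simp only [Pi.zero_apply, add_zero]
        have t := sin_sub_tri (2 * Real.pi * p j) (-(2 * Real.pi * (p j - r j)))
        rw [show 2 * Real.pi * p j + -(2 * Real.pi * (p j - r j)) = 2 * Real.pi * r j by ring, Real.sin_neg, abs_neg] at t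
        have hpj := hp j
        have one : 1 ≤ 4 / D * |Real.sin (2 * Real.pi * p j)| := by
          rw [div_mul_eq_mul_div, le_div_iff₀ hD0]; linarith
        have := inv_le_inv_d δ (|β - edisp (p + q)|) hδ (abs_nonneg _)
        have h1 : 0 ≤ 1 / (|α - edisp p| + δ) := by positivity
        have hWp := hW p
        calc _ ≤ 1 / (|α - edisp p| + δ) * δ⁻¹ * (δ ^ (49/150 : ℝ) * Wt η r j p) := by
              apply mul_le_mul_of_nonneg_right (mul_le_mul_of_nonneg_left this h1) (by positivity)
          _ ≤ (4 / D * |Real.sin (2 * Real.pi * p j)|) * (1 / (|α - edisp p| + δ) * δ⁻¹ * (δ ^ (49/150 : ℝ) * Wt η r j p)) := le_mul_of_one_le_left (by positivity) one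
          _ = _ := by ring
      · rw [integral_const_mul]
        exact fin _ (K3 δ η α hδ hδ1 hη r 0 j)
    · refine ⟨fun p => (4 / D * δ ^ (49/150 : ℝ) * δ⁻¹) * (|Real.sin (2 * Real.pi * (p j + q j))| * (1 / (|β - edisp (p + q)| + δ)) * Wt η r j p), ?_, ?_, ?_, ?_⟩
      · apply Continuous.const_mul
        exact Continuous.mul (Continuous.mul (by fun_prop) cB) cW
      · intro p; have := hW p; positivity
      · intro p hp
        have t := sin_sub_tri (2 * Real.pi * (p j + q j)) (-(2 * Real.pi * (p j - r j)))
        rw [show 2 * Real.pi * (p j + q j) + -(2 * Real.pi * (p j - r j)) = 2 * Real.pi * (r j + q j) by ring, Real.sin_neg, abs_neg] at t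
        have hpj := hp j
        have one : 1 ≤ 4 / D * |Real.sin (2 * Real.pi * (p j + q j))| := by
          rw [div_mul_eq_mul_div, le_div_iff₀ hD0]; linarith
        have := inv_le_inv_d δ (|α - edisp p|) hδ (abs_nonneg _)
        have h1 : 0 ≤ 1 / (|β - edisp (p + q)| + δ) := by positivity
        have hWp := hW p
        calc _ ≤ δ⁻¹ * (1 / (|β - edisp (p + q)| + δ)) * (δ ^ (49/150 : ℝ) * Wt η r j p) := by
              apply mul_le_mul_of_nonneg_right (mul_le_mul_of_nonneg_right this h1) (by positivity)
          _ ≤ (4 / D * |Real.sin (2 * Real.pi * (p j + q j))|) * (δ⁻¹ * (1 / (|β - edisp (p + q)| + δ)) * (δ ^ (49/150 : ℝ) * Wt η r j p)) := le_mul_of_one_le_left (by positivity) one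
          _ = _ := by ring
      · rw [integral_const_mul]
        exact fin _ (K3 δ η β hδ hδ1 hη r q j)

lemma Comb : ∃ C : ℝ, 0 < C ∧ ∀ δ η α β, 0 < δ → δ ≤ 1 → 0 < η → η ≤ δ → |α| ≤ 12 → |β| ≤ 12 → ∀ (q r : Fin 3 → ℝ) (j : Fin 3) (D : ℝ),
    D = |Real.sin (2 * Real.pi * q j)| → ∃ G : (Fin 3 → ℝ) → ℝ, Continuous G ∧
    (∀ p T, 0 < T → (∀ i, η + |Real.sin (2 * Real.pi * (p i - r i))| ≤ 7 * T) →
      1 / (|α - edisp p| + δ) * (1 / (|β - edisp (p + q)| + δ)) * (1 / T) ≤ G p) ∧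
    ∫ p in T3, G p ≤ C * δ ^ (-(7/8) : ℝ) / (η + D) := by
  obtain ⟨C, hC, h⟩ := Outside
  refine ⟨7 * (C + 10 ^ 9), by positivity, ?_⟩
  intro δ η α β hδ hδ1 hη hηδ hα hβ q r j D hD
  have ho := h δ η α β hδ hδ1 hη hηδ hα hβ q j D hD
  obtain ⟨g, gc, g0, gb, gi⟩ := Inside δ η α β hδ hδ1 hη hηδ q r j D hD
  have cA : Continuous (fun p : Fin 3 → ℝ => 1 / (|α - edisp p| + δ)) := by simpa using inv_cont δ α hδ 0
  have cB := inv_cont δ β hδ q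
  refine ⟨fun p => 7 * δ ^ (-(1/3) : ℝ) * (1 / (|α - edisp p| + δ) * (1 / (|β - edisp (p + q)| + δ))) + 7 * g p, ?_, ?_, ?_⟩
  · exact ((cA.mul cB).const_mul _).add (gc.const_mul _)
  · intro p T hT hs
    have hX : 0 ≤ 1 / (|α - edisp p| + δ) * (1 / (|β - edisp (p + q)| + δ)) := by positivity
    have hgp := g0 p
    rcases T_dich η (δ ^ (1/3 : ℝ)) T hη (by positivity) hT r p hs with h1 | ⟨h1, h2⟩
    · rw [← Real.rpow_neg hδ.le] at h1
      have := mul_le_mul_of_nonneg_left h1 hX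
      linarith
    · have := mul_le_mul_of_nonneg_left (h2 j) hX
      have := gb p h1
      have : 0 ≤ 7 * δ ^ (-(1/3) : ℝ) * (1 / (|α - edisp p| + δ) * (1 / (|β - edisp (p + q)| + δ))) := by positivity
      linarith
  · have i1 : Integrable (fun p => 7 * δ ^ (-(1/3) : ℝ) * (1 / (|α - edisp p| + δ) * (1 / (|β - edisp (p + q)| + δ)))) (volume.restrict T3) :=
      cont_intT3 ((cA.mul cB).const_mul _)
    have i2 : Integrable (fun p => 7 * g p) (volume.restrict T3) := cont_intT3 (gc.const_mul _)
    rw [integral_add i1 i2, integral_const_mul, integral_const_mul]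
    have : 7 * (C + 10 ^ 9) * δ ^ (-(7/8) : ℝ) / (η + D) = 7 * (C * δ ^ (-(7/8) : ℝ) / (η + D)) + 7 * (10 ^ 9 * δ ^ (-(7/8) : ℝ) / (η + D)) := by ring
    rw [this]
    linarith

lemma sin_le_int (x y : ℝ) (n : ℤ) (h : |Real.sin (2 * Real.pi * x)| = |Real.sin (2 * Real.pi * y)|) : |Real.sin (2 * Real.pi * x)| ≤ 7 * |y - n| := by
  have e : Real.sin (2 * Real.pi * y) = Real.sin (2 * Real.pi * (y - n)) := by
    rw [show 2 * Real.pi * (y - n) = 2 * Real.pi * y - n * (2 * Real.pi) by ring, Real.sin_sub_int_mul_two_pi]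
  rw [h, e]
  refine (Real.abs_sin_le_abs).trans ?_
  rw [abs_mul, abs_of_pos (by positivity)]
  nlinarith [Real.pi_lt_d2, abs_nonneg (y - n)]

lemma sin_half (x : ℝ) : |Real.sin (2 * Real.pi * (x - 1/2))| = |Real.sin (2 * Real.pi * x)| := by
  rw [show 2 * Real.pi * (x - 1/2) = 2 * Real.pi * x - Real.pi by ring, Real.sin_sub_pi, abs_neg]

lemma sin_le_m (x : ℝ) : |Real.sin (2 * Real.pi * x)| ≤ 7 * min (cdist x 0) (cdist x (1/2)) := by
  unfold cdist
  rcases min_choice (|x - 0 - (round (x - 0) : ℝ)|) (|x - 1/2 - (round (x - 1/2) : ℝ)|) with h | h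
  · rw [h]; exact sin_le_int x (x - 0) _ (by rw [sub_zero])
  · rw [h]; exact sin_le_int x (x - 1/2) _ (sin_half x).symm

lemma cdist_le (x y : ℝ) (n : ℤ) : cdist x y ≤ |x - y - n| := round_le _ _

lemma m_le_sin (x : ℝ) : 4 * min (cdist x 0) (cdist x (1/2)) ≤ |Real.sin (2 * Real.pi * x)| := by
  have key : ∀ (y : ℝ) (n : ℤ), |y - n| ≤ 1/4 → 4 * |y - n| ≤ |Real.sin (2 * Real.pi * y)| := by
    intro y n h
    have := sin_two_abs_lb (2 * (y - n)) (by rw [abs_mul, abs_two]; linarith)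
    rw [abs_mul, abs_two] at this
    rw [show Real.pi * (2 * (y - n)) = 2 * Real.pi * y - n * (2 * Real.pi) by ring, Real.sin_sub_int_mul_two_pi] at this
    linarith
  have hy := abs_sub_round x
  set n := round x
  by_cases h1 : |x - n| ≤ 1/4
  · have h2 := key x n h1
    have h3 := cdist_le x 0 n
    rw [sub_zero] at h3
    have := min_le_left (cdist x 0) (cdist x (1/2))
    linarith
  · have hex : ∃ m : ℤ, |(x - 1/2) - m| ≤ 1/4 := by
      rw [abs_le] at hy
      rw [not_le, lt_abs] at h1
      rcases h1 with h1 | h1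
      · refine ⟨n, ?_⟩
        rw [abs_le]; constructor <;> linarith
      · refine ⟨n - 1, ?_⟩
        push_cast
        rw [abs_le]; constructor <;> linarith
    obtain ⟨m, hm⟩ := hex
    have h2 := key (x - 1/2) m hm
    rw [sin_half] at h2
    have h3 := cdist_le x (1/2) m
    have := min_le_right (cdist x 0) (cdist x (1/2))
    linarith

lemma cdist_nonneg (x y : ℝ) : 0 ≤ cdist x y := abs_nonneg _

lemma tnorm_lb (η : ℝ) (hη : 0 < η) (p : Fin 3 → ℝ) (j : Fin 3) : η + |Real.sin (2 * Real.pi * p j)| ≤ 7 * tnorm η p := by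
  unfold tnorm
  have h1 := sin_le_m (p j)
  have h2 : min (cdist (p j) 0) (cdist (p j) (1/2)) ≤ Real.sqrt (∑ j, (min (cdist (p j) 0) (cdist (p j) (1/2))) ^ 2) := by
    apply Real.le_sqrt_of_sq_le
    exact Finset.single_le_sum (f := fun j => (min (cdist (p j) 0) (cdist (p j) (1/2))) ^ 2) (fun i _ => sq_nonneg _) (Finset.mem_univ j)
  linarith

lemma tnorm_ub (η : ℝ) (q : Fin 3 → ℝ) (D : ℝ) (hD0 : 0 ≤ D) (hD : ∀ j, |Real.sin (2 * Real.pi * q j)| ≤ D) : tnorm η q ≤ η + D := by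
  unfold tnorm
  have : Real.sqrt (∑ j, (min (cdist (q j) 0) (cdist (q j) (1/2))) ^ 2) ≤ D := by
    apply Real.sqrt_le_iff.2 ⟨hD0, ?_⟩
    have k : ∀ j, (min (cdist (q j) 0) (cdist (q j) (1/2))) ^ 2 ≤ D^2/16 := by
      intro j
      have h1 := m_le_sin (q j)
      have h2 := hD j
      have h0 : 0 ≤ min (cdist (q j) 0) (cdist (q j) (1/2)) := le_min (cdist_nonneg _ _) (cdist_nonneg _ _)
      nlinarith
    rw [Fin.sum_univ_three]
    nlinarith [k 0, k 1, k 2]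
  linarith

lemma denom (M δ η x : ℝ) (z : ℂ) (hη : 0 < η) (hηδ : η ≤ δ) (hM : 0 ≤ M) (h1 : η ≤ |z.im|) (h2 : |x - z.re| ≤ δ * M) :
    1 / ‖z‖ ≤ (2 + M) * (δ / η) * (1 / (|x| + δ)) := by
  have hδ : 0 < δ := by linarith
  have hz1 : η ≤ ‖z‖ := h1.trans (Complex.abs_im_le_norm z)
  have hz2 : |x| ≤ ‖z‖ + δ * M := by
    have := Complex.abs_re_le_norm z
    have h3 := abs_add_le (x - z.re) z.re
    rw [sub_add_cancel] at h3
    linarith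
  have hz : 0 < ‖z‖ := by linarith
  rw [mul_one_div, div_le_div_iff₀ hz (by positivity), one_mul]
  have e1 : ‖z‖ ≤ δ / η * ‖z‖ := le_mul_of_one_le_left hz.le ((one_le_div hη).2 hηδ)
  have e2 : δ ≤ δ / η * ‖z‖ := by
    rw [div_mul_eq_mul_div, le_div_iff₀ hη]; nlinarith
  nlinarith

/-- Two Denominator Lemma, with point singularity: For `κ > 0` there are
`C > 0` and `λ₀ ∈ (0,1)` such that for `0 < λ ≤ λ₀`, with `η = λ^{2+κ}`, and any `q`:
`sup_{|α|,|β| ≤ 12} sup_r ∫ dp / (|α - ω̄(p) - iη| |β - ω(p+q) + iη| |||p - r|||)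
  ≤ C η^{-7/8-κ} / |||q|||`. -/
theorem statement9 (κ : ℝ) (hκ : 0 < κ) :
    ∃ C lam0 : ℝ, 0 < C ∧ lam0 ∈ Set.Ioo (0 : ℝ) 1 ∧
      ∀ Θ : ℝ → ℂ, IsThetaLimit Θ →
        ∀ lam : ℝ, 0 < lam → lam ≤ lam0 →
          ∀ η : ℝ, η = lam ^ (2 + κ) →
            ∀ q : Fin 3 → ℝ, ∀ α β : ℝ, |α| ≤ 12 → |β| ≤ 12 → ∀ r : Fin 3 → ℝ,
              (∫ p in T3,
                  1 /
                    (‖(α : ℂ) - (starRingEnd ℂ) (omegaR Θ lam p) - (η : ℂ) * Complex.I‖ *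
                      ‖(β : ℂ) - omegaR Θ lam (p + q) + (η : ℂ) * Complex.I‖ *
                      tnorm η (p - r))) ≤
                C * η ^ (-(7/8) - κ) / tnorm η q := by
  obtain ⟨M, hM1, hM⟩ := theta_bd
  obtain ⟨C, hC, hCb⟩ := Comb
  refine ⟨(2 + M) ^ 2 * C, 1/2, by positivity, ⟨by norm_num, by norm_num⟩, ?_⟩
  intro Θ hΘ lam hl hl2 η hη q α β hα hβ r
  have hl1 : lam ≤ 1 := by linarith
  have hη0 : 0 < η := by rw [hη]; positivity
  set δ : ℝ := lam ^ (2:ℝ) with hδ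
  have hδ0 : 0 < δ := by positivity
  have hδ1 : δ ≤ 1 := Real.rpow_le_one hl.le hl1 (by norm_num)
  have hηδ : η ≤ δ := by rw [hη, hδ]; exact rmono lam _ _ hl hl1 (by linarith)
  have hl2δ : lam ^ 2 = δ := by rw [hδ]; exact (Real.rpow_two lam).symm
  have evp : ∀ᶠ ε : ℝ in 𝓝[>] 0, 0 < ε := eventually_mem_nhdsWithin
  have hΘn : ∀ a, ‖Θ a‖ ≤ M := fun a =>
    le_of_tendsto (hΘ a).norm (evp.mono fun ε hε => hM ε a hε)
  have hΘi : ∀ a, (Θ a).im ≤ 0 := fun a =>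
    le_of_tendsto ((Complex.continuous_im.tendsto _).comp (hΘ a)) (evp.mono fun ε hε => theta_im ε a hε)
  obtain ⟨j, -, hj⟩ := Finset.exists_max_image (Finset.univ : Finset (Fin 3)) (fun j => |Real.sin (2 * Real.pi * q j)|) ⟨0, Finset.mem_univ 0⟩
  obtain ⟨G, Gc, Gb, Gi⟩ := hCb δ η α β hδ0 hδ1 hη0 hηδ hα hβ q r j _ rfl
  set D := |Real.sin (2 * Real.pi * q j)| with hD
  have hD0 : 0 ≤ D := abs_nonneg _
  have hT := tnorm_ub η q D hD0 (fun i => hj i (Finset.mem_univ i))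
  have hTpos : ∀ p, 0 < tnorm η p := fun p => by unfold tnorm; positivity
  set K := (2 + M) * (δ / η) with hK
  have hK0 : 0 < K := by positivity
  have hre : ∀ a, |(δ * (Θ a).re)| ≤ δ * M := fun a => by
    rw [abs_mul, abs_of_pos hδ0]
    exact mul_le_mul_of_nonneg_left ((Complex.abs_re_le_norm _).trans (hΘn a)) hδ0.le
  have hωre : ∀ p, (omegaR Θ lam p).re = edisp p + δ * (Θ (edisp p)).re := by
    intro p
    rw [← hl2δ]
    simp [omegaR, ← Complex.ofReal_pow]
  have hωim : ∀ p, (omegaR Θ lam p).im = δ * (Θ (edisp p)).im := by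
    intro p
    rw [← hl2δ]
    simp [omegaR, ← Complex.ofReal_pow]
  have hpt : ∀ p, 1 / (‖(α : ℂ) - (starRingEnd ℂ) (omegaR Θ lam p) - (η : ℂ) * Complex.I‖ *
                      ‖(β : ℂ) - omegaR Θ lam (p + q) + (η : ℂ) * Complex.I‖ *
                      tnorm η (p - r)) ≤ K ^ 2 * G p := by
    intro p
    have d1 := denom M δ η (α - edisp p) ((α : ℂ) - (starRingEnd ℂ) (omegaR Θ lam p) - (η : ℂ) * Complex.I) hη0 hηδ (by linarith)
      (by
        simp only [Complex.sub_im, Complex.ofReal_im, Complex.conj_im, hωim, Complex.mul_im, Complex.ofReal_re, Complex.I_im, Complex.I_re]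
        have := mul_nonneg hδ0.le (neg_nonneg.2 (hΘi (edisp p)))
        rw [le_abs]; right; linarith)
      (by
        simp only [Complex.sub_re, Complex.ofReal_re, Complex.conj_re, hωre, Complex.mul_re, Complex.ofReal_im, Complex.I_im, Complex.I_re]
        rw [show α - edisp p - (α - (edisp p + δ * (Θ (edisp p)).re) - (η * 0 - 0 * 1)) = δ * (Θ (edisp p)).re by ring]
        exact hre _)
    have d2 := denom M δ η (β - edisp (p + q)) ((β : ℂ) - omegaR Θ lam (p + q) + (η : ℂ) * Complex.I) hη0 hηδ (by linarith)
      (by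
        simp only [Complex.sub_im, Complex.add_im, Complex.ofReal_im, hωim, Complex.mul_im, Complex.ofReal_re, Complex.I_im, Complex.I_re]
        have := mul_nonneg hδ0.le (neg_nonneg.2 (hΘi (edisp (p + q))))
        rw [le_abs]; left; linarith)
      (by
        simp only [Complex.sub_re, Complex.add_re, Complex.ofReal_re, hωre, Complex.mul_re, Complex.ofReal_im, Complex.I_im, Complex.I_re]
        rw [show β - edisp (p + q) - (β - (edisp (p + q) + δ * (Θ (edisp (p + q))).re) + (η * 0 - 0 * 1)) = δ * (Θ (edisp (p + q))).re by ring]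
        exact hre _)
    have hg := Gb p (tnorm η (p - r)) (hTpos _) (fun i => tnorm_lb η hη0 (p - r) i)
    have hT0 := hTpos (p - r)
    rw [one_div, mul_inv, mul_inv, ← one_div, ← one_div, ← one_div]
    calc _ ≤ (K * (1 / (|α - edisp p| + δ))) * (K * (1 / (|β - edisp (p + q)| + δ))) * (1 / tnorm η (p - r)) := by
          apply mul_le_mul_of_nonneg_right _ (by positivity)
          exact mul_le_mul d1 d2 (by positivity) (by positivity)
      _ = K ^ 2 * (1 / (|α - edisp p| + δ) * (1 / (|β - edisp (p + q)| + δ)) * (1 / tnorm η (p - r))) := by ring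
      _ ≤ _ := mul_le_mul_of_nonneg_left hg (by positivity)
  have hfin : (δ / η) ^ 2 * δ ^ (-(7/8) : ℝ) ≤ η ^ (-(7/8) - κ) := by
    have e1 : δ / η = lam ^ (-κ) := by
      rw [hδ, hη, ← Real.rpow_sub hl]; congr 1; ring
    rw [e1, hδ, hη, ← Real.rpow_natCast, ← Real.rpow_mul hl.le, ← Real.rpow_mul hl.le, ← Real.rpow_mul hl.le, ← Real.rpow_add hl]
    apply rmono lam _ _ hl hl1
    push_cast
    nlinarith
  calc _ ≤ ∫ p in T3, K ^ 2 * G p := by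
        apply integral_mono_of_nonneg (ae_of_all _ fun p => ?_) (cont_intT3 (Gc.const_mul _)) (ae_of_all _ hpt)
        have := hTpos (p - r)
        positivity
    _ ≤ K ^ 2 * (C * δ ^ (-(7/8) : ℝ) / (η + D)) := by
        rw [integral_const_mul]
        exact mul_le_mul_of_nonneg_left Gi (by positivity)
    _ = (2 + M) ^ 2 * C * ((δ / η) ^ 2 * δ ^ (-(7/8) : ℝ)) / (η + D) := by rw [hK]; ring
    _ ≤ (2 + M) ^ 2 * C * η ^ (-(7/8) - κ) / (η + D) := by gcongr
    _ ≤ _ := by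
        apply div_le_div_of_nonneg_left (by positivity) (hTpos q) hT

end
end

section
/- (Two Denominator Lemma, without point singularity.) Let κ > 0. There exist C > 0 and λ₀ ∈ (0,1) (depending only on κ) such that for all 0 < λ ≤ λ₀, with η := λ^{2+κ}, and for every q ∈ 𝕋³: (i) sup_{|α| ≤ 12, |β| ≤ 12} ∫_{𝕋³} dp / ( |α − ω̄(p) − iη| · |β − ω(p+q) + iη| ) ≤ C η^{−3/4−κ} / |||q|||; and (ii) ∫_{−12}^{12} dα ∫_{𝕋³} dp / ( |α − ω̄(p) − iη| · |α − ω(p+q) + iη| ) ≤ C η^{−1/2−κ} / |||q|||. -/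
open MeasureTheory Filter Topology

noncomputable section

lemma osc_parts (r h : ℝ) (hr : r ≠ 0) (hh : 0 < h) (hh2 : h ≤ Real.pi / 2) :
    ‖∫ θ in h..(Real.pi/2), Complex.exp (Complex.I * (r * Real.cos θ : ℝ))‖
      ≤ 2 / (|r| * Real.sin h) := by
  have hpi := Real.pi_pos
  have hsin : ∀ θ ∈ Set.uIcc h (Real.pi/2), 0 < Real.sin θ := by
    intro θ hθ
    rw [Set.uIcc_of_le hh2] at hθ
    exact Real.sin_pos_of_pos_of_lt_pi (by linarith [hθ.1]) (by linarith [hθ.2])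
  have hu : ∀ θ ∈ Set.uIcc h (Real.pi/2), HasDerivAt (fun θ : ℝ => (((Real.sin θ)⁻¹ : ℝ) : ℂ))
      (((- Real.cos θ / (Real.sin θ)^2 : ℝ)) : ℂ) θ := by
    intro θ hθ
    exact ((Real.hasDerivAt_sin θ).inv (hsin θ hθ).ne').ofReal_comp
  have hv : ∀ θ ∈ Set.uIcc h (Real.pi/2),
      HasDerivAt (fun θ : ℝ => Complex.exp (Complex.I * (r * Real.cos θ : ℝ)))
      (Complex.exp (Complex.I * (r * Real.cos θ : ℝ)) * (Complex.I * (r * (-Real.sin θ) : ℝ))) θ := by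
    intro θ hθ
    exact ((((Real.hasDerivAt_cos θ).const_mul r).ofReal_comp).const_mul Complex.I).cexp
  have hcu : ContinuousOn (fun θ : ℝ => (- Real.cos θ / (Real.sin θ)^2 : ℝ)) (Set.uIcc h (Real.pi/2)) := by
    apply ContinuousOn.div (by fun_prop) (by fun_prop)
    intro θ hθ; exact pow_ne_zero _ (hsin θ hθ).ne'
  have key := intervalIntegral.integral_mul_deriv_eq_deriv_mul hu hv
    ((Complex.continuous_ofReal.comp_continuousOn hcu).intervalIntegrable)
    ((by fun_prop : Continuous fun θ : ℝ => (Complex.exp (Complex.I * (r * Real.cos θ : ℝ)) * (Complex.I * (r * (-Real.sin θ) : ℝ)))).intervalIntegrable _ _)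
  have e1 : ∫ θ in h..(Real.pi/2), (((Real.sin θ)⁻¹ : ℝ) : ℂ) * (Complex.exp (Complex.I * (r * Real.cos θ : ℝ)) * (Complex.I * (r * (-Real.sin θ) : ℝ)))
      = (-(Complex.I * r)) * ∫ θ in h..(Real.pi/2), Complex.exp (Complex.I * (r * Real.cos θ : ℝ)) := by
    rw [← intervalIntegral.integral_const_mul]
    apply intervalIntegral.integral_congr
    intro θ hθ
    have := (hsin θ hθ).ne'
    have h2 : (Real.sin θ : ℂ) ≠ 0 := by exact_mod_cast this
    simp only [Complex.ofReal_inv, Complex.ofReal_mul, Complex.ofReal_neg]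
    field_simp
  have nexp : ∀ θ : ℝ, ‖Complex.exp (Complex.I * (r * Real.cos θ : ℝ))‖ = 1 := by
    intro θ; rw [mul_comm]; exact Complex.norm_exp_ofReal_mul_I _
  have e2 : ‖∫ θ in h..(Real.pi/2), (((- Real.cos θ / (Real.sin θ)^2 : ℝ)) : ℂ) * Complex.exp (Complex.I * (r * Real.cos θ : ℝ))‖ ≤ (Real.sin h)⁻¹ - 1 := by
    have hd : ∀ θ ∈ Set.uIcc h (Real.pi/2), HasDerivAt (fun θ : ℝ => -(Real.sin θ)⁻¹)
      (-(- Real.cos θ / (Real.sin θ)^2)) θ := by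
      intro θ hθ
      exact ((Real.hasDerivAt_sin θ).inv (hsin θ hθ).ne').neg
    have := intervalIntegral.integral_eq_sub_of_hasDerivAt hd (hcu.neg.intervalIntegrable)
    calc _ ≤ ∫ θ in h..(Real.pi/2), -(- Real.cos θ / (Real.sin θ)^2) := by
            apply intervalIntegral.norm_integral_le_of_norm_le hh2 _ hcu.neg.intervalIntegrable
            refine Filter.Eventually.of_forall fun θ hθ => ?_
            rw [norm_mul, nexp, mul_one, Complex.norm_real, Real.norm_eq_abs, abs_of_nonpos]
            · exact le_rfl
            have : 0 ≤ Real.cos θ := Real.cos_nonneg_of_neg_pi_div_two_le_of_le (by linarith [hθ.1]) hθ.2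
            rw [neg_div]
            have : 0 ≤ Real.cos θ / Real.sin θ ^2 := by positivity
            linarith
      _ = _ := by rw [this]; simp; ring
  have hs := hsin h (by simp)
  rw [e1] at key
  have hn := congrArg norm key
  rw [norm_mul] at hn
  simp only [norm_neg, norm_mul, Complex.norm_I, one_mul, Complex.norm_real, Real.norm_eq_abs] at hn
  rw [le_div_iff₀ (by positivity)]
  have e3 : |r| * ‖∫ θ in h..(Real.pi/2), Complex.exp (Complex.I * (r * Real.cos θ : ℝ))‖ ≤ 2 * (Real.sin h)⁻¹ := by
    rw [hn]
    refine (norm_sub_le _ _).trans ?_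
    refine (add_le_add (norm_sub_le _ _) e2).trans ?_
    rw [norm_mul, norm_mul, nexp, nexp]
    rw [Complex.norm_real, Complex.norm_real, Real.sin_pi_div_two, Real.norm_of_nonneg (inv_pos.mpr hs).le]
    simp only [inv_one, norm_one, mul_one]
    linarith
  calc _ = (|r| * ‖∫ θ in h..(Real.pi/2), Complex.exp (Complex.I * (r * Real.cos θ : ℝ))‖) * Real.sin h := by ring
    _ ≤ 2 * (Real.sin h)⁻¹ * Real.sin h := by gcongr
    _ = 2 := by field_simp

lemma osc_quarter (r : ℝ) :
    ‖∫ θ in (0:ℝ)..(Real.pi/2), Complex.exp (Complex.I * (r * Real.cos θ : ℝ))‖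
      ≤ 10 * (√(1 + |r|))⁻¹ := by
  have hpi := Real.pi_pos
  have hpi3 := Real.pi_gt_three
  have hpi4 := Real.pi_lt_four
  have nexp : ∀ θ : ℝ, ‖Complex.exp (Complex.I * (r * Real.cos θ : ℝ))‖ = 1 := by
    intro θ; rw [mul_comm]; exact Complex.norm_exp_ofReal_mul_I _
  have ii : ∀ a b : ℝ, IntervalIntegrable (fun θ : ℝ => Complex.exp (Complex.I * (r * Real.cos θ : ℝ))) volume a b :=
    fun a b => (by fun_prop : Continuous fun θ : ℝ => Complex.exp (Complex.I * (r * Real.cos θ : ℝ))).intervalIntegrable _ _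
  have triv : ∀ a b : ℝ, ‖∫ θ in a..b, Complex.exp (Complex.I * (r * Real.cos θ : ℝ))‖ ≤ |b - a| := by
    intro a b
    have := intervalIntegral.norm_integral_le_of_norm_le_const (a := a) (b := b) (C := 1)
      (f := fun θ : ℝ => Complex.exp (Complex.I * (r * Real.cos θ : ℝ))) (fun θ _ => (nexp θ).le)
    simpa using this
  have hsq : 0 < √(1 + |r|) := by positivity
  rcases le_total |r| 1 with h | h
  · have := triv 0 (Real.pi/2)
    have h2 : √(1 + |r|) ≤ 2 := by
      rw [Real.sqrt_le_left (by norm_num)]; linarith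
    rw [abs_of_pos (by linarith)] at this
    have : (1/2:ℝ) ≤ (√(1 + |r|))⁻¹ := by
      rw [le_inv_comm₀ (by norm_num) hsq]; linarith
    linarith
  · set g := √|r| with hg
    have hg1 : 1 ≤ g := by rw [hg]; exact Real.one_le_sqrt.mpr h
    have hgg : g * g = |r| := Real.mul_self_sqrt (abs_nonneg r)
    have hh0 : 0 < g⁻¹ := by positivity
    have hh1 : g⁻¹ ≤ 1 := inv_le_one_of_one_le₀ hg1
    have hr : r ≠ 0 := by intro h0; rw [h0] at h; norm_num at h
    have h1 := triv 0 g⁻¹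
    have h2 := osc_parts r g⁻¹ hr hh0 (by linarith)
    have hs : 2 / Real.pi * g⁻¹ ≤ Real.sin g⁻¹ := Real.mul_le_sin hh0.le (by linarith)
    have h3 : 2 / (|r| * Real.sin g⁻¹) ≤ 4 * g⁻¹ := by
      have : |r| * (2 / Real.pi * g⁻¹) ≤ |r| * Real.sin g⁻¹ := by gcongr
      have h5 : |r| * (2 / Real.pi * g⁻¹) = 2 * g / Real.pi := by
        rw [← hgg]; field_simp
      rw [h5] at this
      have h6 : 0 < 2 * g / Real.pi := by positivity
      calc 2 / (|r| * Real.sin g⁻¹) ≤ 2 / (2 * g / Real.pi) := by gcongr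
        _ = Real.pi * g⁻¹ := by field_simp
        _ ≤ _ := by gcongr
    rw [← intervalIntegral.integral_add_adjacent_intervals (ii 0 g⁻¹) (ii g⁻¹ (Real.pi/2))]
    have h4 : √(1 + |r|) ≤ 2 * g := by
      rw [Real.sqrt_le_left (by positivity)]; nlinarith
    have h5 : g⁻¹ ≤ 2 * (√(1 + |r|))⁻¹ := by
      rw [← div_eq_mul_inv, le_div_iff₀ hsq, inv_mul_le_iff₀ (by positivity)]; linarith
    rw [sub_zero, abs_of_pos hh0] at h1
    refine (norm_add_le _ _).trans ?_
    linarith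

lemma osc_full (r : ℝ) :
    ‖∫ θ in (0:ℝ)..(2*Real.pi), Complex.exp (Complex.I * (r * Real.cos θ : ℝ))‖
      ≤ 40 * (√(1 + |r|))⁻¹ := by
  have ii : ∀ a b : ℝ, IntervalIntegrable (fun θ : ℝ => Complex.exp (Complex.I * (r * Real.cos θ : ℝ))) volume a b :=
    fun a b => (by fun_prop : Continuous fun θ : ℝ => Complex.exp (Complex.I * (r * Real.cos θ : ℝ))).intervalIntegrable _ _
  have q1 := osc_quarter r
  have q2 := osc_quarter (-r)
  rw [abs_neg] at q2
  have a1 : ∫ θ in (Real.pi/2)..Real.pi, Complex.exp (Complex.I * (r * Real.cos θ : ℝ)) =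
      ∫ θ in (0:ℝ)..(Real.pi/2), Complex.exp (Complex.I * ((-r) * Real.cos θ : ℝ)) := by
    have := intervalIntegral.integral_comp_sub_left (a := 0) (b := Real.pi/2) (fun θ : ℝ => Complex.exp (Complex.I * (r * Real.cos θ : ℝ))) Real.pi
    simp only [Real.cos_pi_sub] at this
    rw [show Real.pi - Real.pi/2 = Real.pi/2 by ring, sub_zero] at this
    rw [← this]; simp
  have a2 : ∫ θ in Real.pi..(2*Real.pi), Complex.exp (Complex.I * (r * Real.cos θ : ℝ)) =
      ∫ θ in (0:ℝ)..Real.pi, Complex.exp (Complex.I * (r * Real.cos θ : ℝ)) := by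
    have := intervalIntegral.integral_comp_sub_left (a := 0) (b := Real.pi) (fun θ : ℝ => Complex.exp (Complex.I * (r * Real.cos θ : ℝ))) (2*Real.pi)
    simp only [Real.cos_two_pi_sub] at this
    rw [show 2 * Real.pi - Real.pi = Real.pi by ring, sub_zero] at this
    exact this.symm
  rw [← intervalIntegral.integral_add_adjacent_intervals (ii 0 Real.pi) (ii Real.pi (2*Real.pi)), a2,
    ← intervalIntegral.integral_add_adjacent_intervals (ii 0 (Real.pi/2)) (ii (Real.pi/2) Real.pi), a1]
  refine (norm_add_le _ _).trans ?_
  have := norm_add_le (∫ θ in (0:ℝ)..(Real.pi/2), Complex.exp (Complex.I * (r * Real.cos θ : ℝ))) (∫ θ in (0:ℝ)..(Real.pi/2), Complex.exp (Complex.I * ((-r) * Real.cos θ : ℝ)))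
  linarith

/-- one-dimensional oscillatory factor -/
def Kf (t s q : ℝ) : ℂ := ∫ x in Set.Icc (-(1/2) : ℝ) (1/2),
  Complex.exp (Complex.I * (t * Real.cos (2 * Real.pi * x) + s * Real.cos (2 * Real.pi * (x + q)) : ℝ))

lemma Kf_bound (t s q ρ : ℝ) (hρ : 0 ≤ ρ)
    (h : ρ ^ 2 ≤ (t + s * Real.cos (2 * Real.pi * q)) ^ 2 + (s * Real.sin (2 * Real.pi * q)) ^ 2) :
    ‖Kf t s q‖ ≤ 7 * (√(1 + ρ))⁻¹ := by
  set y := 2 * Real.pi * q with hy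
  set z : ℂ := ⟨t + s * Real.cos y, s * Real.sin y⟩ with hz
  set r := ‖z‖ with hr
  set φ := Complex.arg z with hφ
  have hrρ : ρ ≤ r := by
    refine (sq_le_sq₀ hρ (norm_nonneg z)).mp ?_
    rw [Complex.sq_norm, Complex.normSq_apply]
    simp only [hz]
    linarith
  have hc : r * Real.cos φ = t + s * Real.cos y := by
    rw [hr, hφ]; exact Complex.norm_mul_cos_arg z
  have hsn : r * Real.sin φ = s * Real.sin y := by
    rw [hr, hφ]; exact Complex.norm_mul_sin_arg z
  have hper : Function.Periodic (fun θ : ℝ => Complex.exp (Complex.I * (r * Real.cos θ : ℝ))) (2*Real.pi) := by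
    intro θ; simp [Real.cos_add_two_pi]
  have e : Kf t s q = (2 * Real.pi : ℝ)⁻¹ • ∫ θ in (0:ℝ)..(2*Real.pi), Complex.exp (Complex.I * (r * Real.cos θ : ℝ)) := by
    unfold Kf
    rw [integral_Icc_eq_integral_Ioc, ← intervalIntegral.integral_of_le (by norm_num)]
    have h1 := intervalIntegral.integral_comp_mul_add (a := -(1/2)) (b := 1/2) (fun θ : ℝ => Complex.exp (Complex.I * (r * Real.cos θ : ℝ))) (by positivity : 2 * Real.pi ≠ 0) φ
    have h2 := hper.intervalIntegral_add_eq (2 * Real.pi * (-(1/2)) + φ) 0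
    rw [show 2 * Real.pi * (-(1/2)) + φ + 2 * Real.pi = 2 * Real.pi * (1/2) + φ by ring, zero_add] at h2
    rw [h2] at h1
    rw [← h1]
    congr 1
    funext x
    congr 3
    rw [Real.cos_add, mul_add (2 * Real.pi) x q, ← hy, Real.cos_add]
    linear_combination (- Real.cos (2 * Real.pi * x)) * hc + Real.sin (2 * Real.pi * x) * hsn
  rw [e, norm_smul, Real.norm_of_nonneg (by positivity)]
  have h0 := osc_full r
  rw [abs_of_nonneg (norm_nonneg z : 0 ≤ r)] at h0
  have hpi3 := Real.pi_gt_three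
  have hm : (√(1 + r))⁻¹ ≤ (√(1 + ρ))⁻¹ := by
    have : 0 < √(1+ρ) := by positivity
    gcongr
  have hi : (2 * Real.pi)⁻¹ ≤ 1/6 := by
    rw [inv_le_comm₀ (by positivity) (by norm_num)]; linarith
  calc _ ≤ (1/6) * (40 * (√(1 + r))⁻¹) := by gcongr
    _ ≤ 7 * (√(1 + r))⁻¹ := by
      have : 0 ≤ (√(1 + r))⁻¹ := by positivity
      linarith
    _ ≤ _ := by gcongr

lemma T3_prod (f : Fin 3 → ℝ → ℂ) :
    ∫ p in T3, ∏ j, f j (p j) = ∏ j, ∫ x in Set.Icc (-(1/2) : ℝ) (1/2), f j x := by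
  unfold T3
  rw [volume_pi, Measure.restrict_pi_pi]
  exact integral_fintype_prod_eq_prod (𝕜 := ℂ) f

lemma T3_finite : IsFiniteMeasure (volume.restrict T3) := by
  constructor
  rw [Measure.restrict_apply_univ]
  exact (isCompact_univ_pi fun _ => isCompact_Icc).measure_lt_top

lemma edisp_eq (a : ℝ) (p : Fin 3 → ℝ) : a - edisp p = (a - 3) + ∑ j, Real.cos (2 * Real.pi * p j) := by
  unfold edisp; simp [Fin.sum_univ_three]; ring

lemma integrable_exp_abs {ε : ℝ} (hε : 0 < ε) : Integrable (fun t : ℝ => Real.exp (-(ε * |t|))) := by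
  have h1 : IntegrableOn (fun t : ℝ => Real.exp (-(ε * |t|))) (Set.Ioi 0) := by
    refine (integrableOn_exp_mul_Ioi (neg_lt_zero.mpr hε) 0).congr_fun ?_ measurableSet_Ioi
    intro t ht; simp only [abs_of_pos (Set.mem_Ioi.mp ht), neg_mul]
  have h2 : IntegrableOn (fun t : ℝ => Real.exp (-(ε * |t|))) (Set.Iic 0) := by
    refine (integrableOn_exp_mul_Iic hε 0).congr_fun ?_ measurableSet_Iic
    intro t ht; simp only [abs_of_nonpos (Set.mem_Iic.mp ht), mul_neg, neg_neg]
  have := h2.union h1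
  rwa [Set.Iic_union_Ioi, integrableOn_univ] at this

lemma integral_exp_abs {ε : ℝ} (hε : 0 < ε) : ∫ t : ℝ, Real.exp (-(ε * |t|)) = 2 / ε := by
  rw [integral_comp_abs (f := fun t => Real.exp (-(ε * t)))]
  have := integral_exp_mul_Ioi (neg_lt_zero.mpr hε) 0
  simp only [neg_mul, mul_zero, Real.exp_zero] at this
  rw [this]; field_simp

lemma lorentz {ε : ℝ} (hε : 0 < ε) (x : ℝ) :
    ∫ t : ℝ, ((Real.exp (-(ε * |t|)) : ℝ) : ℂ) * Complex.exp (Complex.I * (t * x : ℝ))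
      = ((2 * ε / (ε ^ 2 + x ^ 2) : ℝ) : ℂ) := by
  have hintg : Integrable (fun t : ℝ => ((Real.exp (-(ε * |t|)) : ℝ) : ℂ) * Complex.exp (Complex.I * (t * x : ℝ))) := by
    refine (integrable_exp_abs hε).mono' (by fun_prop) (Eventually.of_forall fun t => ?_)
    rw [norm_mul, mul_comm Complex.I, Complex.norm_exp_ofReal_mul_I, mul_one, Complex.norm_real,
      Real.norm_of_nonneg (Real.exp_pos _).le]
  rw [← intervalIntegral.integral_Iic_add_Ioi (b := 0) hintg.integrableOn hintg.integrableOn]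
  have h1 : ∫ t : ℝ in Set.Ioi 0, ((Real.exp (-(ε * |t|)) : ℝ) : ℂ) * Complex.exp (Complex.I * (t * x : ℝ))
      = ∫ t : ℝ in Set.Ioi 0, Complex.exp ((-ε + Complex.I * x) * t) := by
    refine setIntegral_congr_fun measurableSet_Ioi fun t ht => ?_
    simp only [abs_of_pos (Set.mem_Ioi.mp ht)]
    push_cast
    rw [← Complex.exp_add]; congr 1; ring
  have h2 : ∫ t : ℝ in Set.Iic 0, ((Real.exp (-(ε * |t|)) : ℝ) : ℂ) * Complex.exp (Complex.I * (t * x : ℝ))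
      = ∫ t : ℝ in Set.Iic 0, Complex.exp ((ε + Complex.I * x) * t) := by
    refine setIntegral_congr_fun measurableSet_Iic fun t ht => ?_
    simp only [abs_of_nonpos (Set.mem_Iic.mp ht)]
    push_cast
    rw [← Complex.exp_add]; congr 1; ring
  rw [h1, h2, integral_exp_mul_complex_Ioi (by simpa using hε), integral_exp_mul_complex_Iic (by simpa using hε)]
  have n1 : (ε : ℂ) + Complex.I * x ≠ 0 := by
    intro h; have := congrArg Complex.re h; simp at this; linarith
  have n2 : -(ε : ℂ) + Complex.I * x ≠ 0 := by
    intro h; have := congrArg Complex.re h; simp at this; linarith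
  have n3 : (ε : ℂ)^2 + (x:ℂ)^2 ≠ 0 := by
    have : (ε^2 + x^2 : ℝ) ≠ 0 := by positivity
    exact_mod_cast this
  simp only [Complex.ofReal_zero, mul_zero, Complex.exp_zero]
  push_cast
  field_simp
  ring_nf
  simp only [Complex.I_sq]
  ring

lemma theta_bound : ∃ M : ℝ, 0 < M ∧ ∀ Θ : ℝ → ℂ, IsThetaLimit Θ → ∀ a : ℝ, ‖Θ a‖ ≤ M ∧ (Θ a).im ≤ 0 := by
  have hfin := T3_finite
  set M0 := ∫ t : ℝ, 343 * (1 + ‖t‖) ^ (-(3/2) : ℝ) with hM0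
  have hMi : Integrable (fun t : ℝ => 343 * (1 + ‖t‖) ^ (-(3/2) : ℝ)) :=
    (integrable_one_add_norm (by simp; norm_num)).const_mul _
  have hM0n : 0 ≤ M0 := integral_nonneg fun t => by positivity
  have hε : ∀ ε > 0, ∀ a : ℝ, ‖ThetaEps ε a‖ ≤ M0 := by
    intro ε hε a
    have e1 : ThetaEps ε a = ∫ p in T3, ∫ t : ℝ in Set.Ioi 0, (-Complex.I) * Complex.exp ((-ε + Complex.I * (a - edisp p : ℝ)) * t) := by
      unfold ThetaEps
      congr 1; funext p
      rw [integral_const_mul, integral_exp_mul_complex_Ioi (by simpa using hε)]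
      have n1 : (a : ℂ) - edisp p + ε * Complex.I ≠ 0 := by
        intro h; have := congrArg Complex.im h; simp at this; linarith
      have n2 : -(ε : ℂ) + Complex.I * (a - edisp p : ℝ) ≠ 0 := by
        intro h; have := congrArg Complex.re h; simp at this; linarith
      simp only [Complex.ofReal_zero, mul_zero, Complex.exp_zero]
      have n3 : -(ε : ℂ) + Complex.I * (a - edisp p : ℝ) = Complex.I * ((a : ℂ) - edisp p + ε * Complex.I) := by
        push_cast
        linear_combination (-(ε : ℂ)) * Complex.I_sq
      rw [n3]
      field_simp
    have e2 : ∀ t : ℝ, ∫ p in T3, (-Complex.I) * Complex.exp ((-ε + Complex.I * (a - edisp p : ℝ)) * t) =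
        ((-Complex.I) * Complex.exp ((-ε + Complex.I * (a - 3 : ℝ)) * t)) * ∏ j : Fin 3, Kf t 0 0 := by
      intro t
      unfold Kf
      rw [← T3_prod, ← integral_const_mul]
      congr 1; funext p
      rw [← Complex.exp_sum, mul_assoc, ← Complex.exp_add]
      congr 2
      rw [edisp_eq]
      simp only [Fin.sum_univ_three]
      push_cast
      ring
    rw [e1, integral_integral_swap]
    · simp only [e2]
      calc _ ≤ ∫ t : ℝ in Set.Ioi 0, 343 * (1 + ‖t‖) ^ (-(3/2) : ℝ) := by
            apply norm_integral_le_of_norm_le hMi.integrableOn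
            refine (ae_restrict_mem measurableSet_Ioi).mono fun t ht => ?_
            have ht0 : 0 < t := ht
            have hk := Kf_bound t 0 0 t ht0.le (by simp)
            rw [norm_mul, norm_mul, norm_neg, Complex.norm_I, one_mul, Complex.norm_exp]
            have h1 : Real.exp ((-ε + Complex.I * (a - 3 : ℝ)) * t : ℂ).re ≤ 1 := by
              rw [Real.exp_le_one_iff]; simp; positivity
            have h2 : ‖∏ j : Fin 3, Kf t 0 0‖ ≤ 343 * (1 + ‖t‖) ^ (-(3/2) : ℝ) := by
              simp only [Finset.prod_const, Finset.card_univ, Fintype.card_fin, norm_pow]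
              calc _ ≤ (7 * (√(1 + t))⁻¹)^3 := by gcongr
                _ = _ := by
                  rw [Real.norm_of_nonneg ht0.le, mul_pow, Real.sqrt_eq_rpow, ← Real.rpow_neg (by positivity),
                    ← Real.rpow_natCast ((1 + t) ^ (-(1/2) : ℝ)), ← Real.rpow_mul (by positivity)]
                  norm_num
            calc _ ≤ 1 * (343 * (1 + ‖t‖) ^ (-(3/2) : ℝ)) := by gcongr
              _ = _ := one_mul _
        _ ≤ M0 := setIntegral_le_integral hMi (Eventually.of_forall fun t => by positivity)
    · have hc : Continuous (Function.uncurry fun (p : Fin 3 → ℝ) (t : ℝ) => (-Complex.I) * Complex.exp ((-ε + Complex.I * (a - edisp p : ℝ)) * t)) := by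
        have := edisp_cont
        unfold Function.uncurry
        fun_prop
      have hi := (integrable_const (μ := volume.restrict T3) (1:ℝ)).mul_prod (integrableOn_exp_mul_Ioi (neg_lt_zero.mpr hε) 0)
      refine hi.mono' hc.aestronglyMeasurable (Eventually.of_forall fun z => ?_)
      simp [Function.uncurry, Complex.norm_exp]
  refine ⟨M0 + 1, by linarith, fun Θ hΘ a => ⟨?_, ?_⟩⟩
  · have := le_of_tendsto (hΘ a).norm (eventually_nhdsWithin_of_forall fun ε he => hε ε he a)
    linarith
  · refine le_of_tendsto ((Complex.continuous_im.tendsto _).comp (hΘ a)) (eventually_nhdsWithin_of_forall fun ε he => ?_)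
    have he' : 0 < ε := he
    simp only [Function.comp, ThetaEps]
    have hc : Continuous fun p : Fin 3 → ℝ => ((a : ℂ) - (edisp p : ℂ) + (ε : ℂ) * Complex.I)⁻¹ := by
      have := edisp_cont
      apply Continuous.inv₀ (by fun_prop)
      intro p h; have := congrArg Complex.im h; simp at this; linarith
    have hi : IntegrableOn (fun p : Fin 3 → ℝ => ((a : ℂ) - (edisp p : ℂ) + (ε : ℂ) * Complex.I)⁻¹) T3 :=
      hc.continuousOn.integrableOn_compact (isCompact_univ_pi fun _ => isCompact_Icc)
    have := integral_im hi
    simp only [RCLike.im_eq_complex_im] at this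
    rw [← this]
    refine integral_nonpos fun p => ?_
    simp only [Complex.inv_im, Pi.zero_apply]
    apply div_nonpos_of_nonpos_of_nonneg _ (Complex.normSq_nonneg _)
    simp; exact he'.le

lemma J_fourier {ε₁ ε₂ : ℝ} (h1 : 0 < ε₁) (h2 : 0 < ε₂) (a b : ℝ) (q : Fin 3 → ℝ) :
    ∫ p in T3, (2 * ε₁ / (ε₁ ^ 2 + (a - edisp p) ^ 2)) * (2 * ε₂ / (ε₂ ^ 2 + (b - edisp (p + q)) ^ 2)) ≤
      ∫ z : ℝ × ℝ, (Real.exp (-(ε₁ * |z.1|)) * Real.exp (-(ε₂ * |z.2|))) * ∏ j, ‖Kf z.1 z.2 (q j)‖ := by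
  have hfin := T3_finite
  have hec := edisp_cont
  set F : (Fin 3 → ℝ) → ℝ × ℝ → ℂ := fun p z =>
    (((Real.exp (-(ε₁ * |z.1|)) : ℝ) : ℂ) * Complex.exp (Complex.I * (z.1 * (a - edisp p) : ℝ))) *
    (((Real.exp (-(ε₂ * |z.2|)) : ℝ) : ℂ) * Complex.exp (Complex.I * (z.2 * (b - edisp (p + q)) : ℝ))) with hF
  have e1 : ((∫ p in T3, (2 * ε₁ / (ε₁ ^ 2 + (a - edisp p) ^ 2)) * (2 * ε₂ / (ε₂ ^ 2 + (b - edisp (p + q)) ^ 2)) : ℝ) : ℂ)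
      = ∫ p in T3, ∫ z, F p z := by
    rw [← integral_complex_ofReal]
    congr 1; funext p
    rw [hF]
    simp only
    rw [Measure.volume_eq_prod, integral_prod_mul (f := fun t : ℝ => ((Real.exp (-(ε₁ * |t|)) : ℝ) : ℂ) * Complex.exp (Complex.I * (t * (a - edisp p) : ℝ)))
      (g := fun t : ℝ => ((Real.exp (-(ε₂ * |t|)) : ℝ) : ℂ) * Complex.exp (Complex.I * (t * (b - edisp (p+q)) : ℝ))),
      lorentz h1, lorentz h2, Complex.ofReal_mul]
  have e2 : ∀ z : ℝ × ℝ, ∫ p in T3, F p z =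
      (((Real.exp (-(ε₁ * |z.1|)) * Real.exp (-(ε₂ * |z.2|)) : ℝ) : ℂ) * Complex.exp (Complex.I * (z.1 * (a - 3) + z.2 * (b-3) : ℝ))) *
        ∏ j, Kf z.1 z.2 (q j) := by
    intro z
    unfold Kf
    rw [← T3_prod (fun j x => Complex.exp (Complex.I * (z.1 * Real.cos (2 * Real.pi * x) + z.2 * Real.cos (2 * Real.pi * (x + q j)) : ℝ))), ← integral_const_mul]
    congr 1; funext p
    rw [← Complex.exp_sum, mul_assoc, ← Complex.exp_add, hF]
    simp only
    rw [mul_mul_mul_comm, ← Complex.exp_add, ← Complex.ofReal_mul]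
    congr 2
    rw [edisp_eq, edisp_eq]
    simp only [Fin.sum_univ_three, Pi.add_apply]
    push_cast
    ring
  have hn : ∀ x : ℝ, ‖Complex.exp (Complex.I * (x : ℝ))‖ = 1 := by
    intro x; rw [mul_comm]; exact Complex.norm_exp_ofReal_mul_I _
  have hsw : Integrable (Function.uncurry F) ((volume.restrict T3).prod volume) := by
    have hc : Continuous (Function.uncurry F) := by
      simp only [hF]
      unfold Function.uncurry
      fun_prop
    have hi := (integrable_const (μ := volume.restrict T3) (1:ℝ)).mul_prod
      ((integrable_exp_abs h1).mul_prod (integrable_exp_abs h2))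
    refine hi.mono' hc.aestronglyMeasurable (Eventually.of_forall fun z => ?_)
    simp only [Function.uncurry, hF, norm_mul, hn, mul_one, one_mul, Complex.norm_real, Real.norm_eq_abs, Real.abs_exp]
    exact le_rfl
  rw [integral_integral_swap hsw] at e1
  simp only [e2] at e1
  have e3 := congrArg norm e1
  rw [Complex.norm_real] at e3
  refine (le_abs_self _).trans ?_
  rw [← Real.norm_eq_abs, e3]
  refine (norm_integral_le_integral_norm _).trans (le_of_eq ?_)
  congr 1; funext z
  rw [norm_mul, norm_mul, hn, mul_one, norm_prod, Complex.norm_real, Real.norm_of_nonneg (by positivity)]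

lemma inner_bound (σ : ℝ) (hσ : 0 < σ) : ∃ B : ℝ, 0 < B ∧ ∀ δ : ℝ, 0 < δ → δ ≤ 1 → ∀ c : ℝ,
    ∫ s : ℝ, Real.exp (-(δ * |s|)) * (1 + |s + c|)⁻¹ ≤ B * δ ^ (-σ) := by
  have hi : Integrable (fun t : ℝ => (1 + ‖t‖) ^ (-(1 + σ) : ℝ)) :=
    integrable_one_add_norm (by simp [hσ])
  set C0 := ∫ t : ℝ, (1 + ‖t‖) ^ (-(1 + σ) : ℝ) with hC0
  have hC0n : 0 ≤ C0 := integral_nonneg fun t => by positivity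
  refine ⟨C0 + 2, by linarith, fun δ hδ hδ1 c => ?_⟩
  have hone : 1 ≤ δ ^ (-σ) := Real.one_le_rpow_of_pos_of_le_one_of_nonpos hδ hδ1 (by linarith)
  have hi1 : Integrable (fun s : ℝ => δ ^ (-σ) * (1 + ‖s + c‖) ^ (-(1 + σ) : ℝ)) := (hi.comp_add_right c).const_mul _
  have hi2 : Integrable (fun s : ℝ => δ * Real.exp (-(δ * |s|))) := (integrable_exp_abs hδ).const_mul _
  calc _ ≤ ∫ s : ℝ, (δ ^ (-σ) * (1 + ‖s + c‖) ^ (-(1 + σ) : ℝ) + δ * Real.exp (-(δ * |s|))) := by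
        refine integral_mono_of_nonneg (Eventually.of_forall fun s => by positivity) (hi1.add hi2) (Eventually.of_forall fun s => ?_)
        simp only [Real.norm_eq_abs]
        set u := 1 + |s + c| with hu
        have hu0 : 0 < u := by positivity
        have he : Real.exp (-(δ * |s|)) ≤ 1 := by
          rw [Real.exp_le_one_iff]; have : 0 ≤ δ * |s| := by positivity
          linarith
        rcases le_total u δ⁻¹ with h | h
        · have h1 : u⁻¹ ≤ δ ^ (-σ) * u ^ (-(1 + σ)) := by
            have h2 : u ^ σ ≤ δ ^ (-σ) := by
              rw [Real.rpow_neg hδ.le, ← Real.inv_rpow hδ.le]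
              exact Real.rpow_le_rpow hu0.le h hσ.le
            calc u⁻¹ = u ^ σ * u ^ (-(1 + σ)) := by
                  rw [← Real.rpow_add hu0, ← Real.rpow_neg_one]; congr 1; ring
              _ ≤ _ := by gcongr
          have h3 : Real.exp (-(δ * |s|)) * u⁻¹ ≤ 1 * u⁻¹ := by gcongr
          have h4 : 0 ≤ δ * Real.exp (-(δ * |s|)) := by positivity
          linarith
        · have h1 : u⁻¹ ≤ δ := by rw [inv_le_comm₀ hu0 hδ]; exact h
          have h3 : Real.exp (-(δ * |s|)) * u⁻¹ ≤ Real.exp (-(δ * |s|)) * δ := by gcongr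
          have h4 : 0 ≤ δ ^ (-σ) * u ^ (-(1 + σ)) := by positivity
          linarith
    _ = δ ^ (-σ) * C0 + 2 := by
        rw [integral_add hi1 hi2, integral_const_mul, integral_const_mul, integral_exp_abs hδ,
          integral_add_right_eq_self (fun s : ℝ => (1 + ‖s‖) ^ (-(1 + σ) : ℝ)) c, ← hC0,
          mul_div_cancel₀ _ hδ.ne']
    _ ≤ _ := by nlinarith

lemma t_bound (δ D : ℝ) (hδ : 0 < δ) (hD : 0 ≤ D) :
    ∫ t : ℝ, Real.exp (-(δ * |t|)) * (√(1 + D * |t|))⁻¹ ≤ 6 * (√δ)⁻¹ * (√(δ / 2 + D))⁻¹ := by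
  rw [integral_comp_abs (f := fun t => Real.exp (-(δ * t)) * (√(1 + D * t))⁻¹)]
  have g := Real.integral_rpow_mul_exp_neg_mul_Ioi (a := 1/2) (r := δ/2) (by norm_num) (by positivity)
  have hX : 0 < δ / 2 + D := by positivity
  have hgi : IntegrableOn (fun t : ℝ => t ^ ((1/2 : ℝ) - 1) * Real.exp (-(δ / 2 * t))) (Set.Ioi 0) := by
    by_contra hcon
    rw [integral_undef hcon, Real.Gamma_one_half_eq] at g
    have : 0 < (1 / (δ / 2)) ^ (1 / 2 : ℝ) * √Real.pi := by
      have := Real.pi_pos; positivity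
    linarith
  have hle : ∫ t in Set.Ioi (0:ℝ), Real.exp (-(δ * t)) * (√(1 + D * t))⁻¹ ≤
      ∫ t in Set.Ioi (0:ℝ), (√(δ / 2 + D))⁻¹ * (t ^ ((1/2 : ℝ) - 1) * Real.exp (-(δ / 2 * t))) := by
    refine integral_mono_of_nonneg (Eventually.of_forall fun t => by positivity) (hgi.const_mul _) ?_
    refine (ae_restrict_mem measurableSet_Ioi).mono fun t ht => ?_
    have ht0 : 0 < t := ht
    have hD1 : 0 < 1 + D * t := by positivity
    simp only
    have h1 : √(δ / 2 + D) * √t ≤ Real.exp (δ / 2 * t) * √(1 + D * t) := by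
      rw [← Real.sqrt_mul hX.le, Real.sqrt_le_left (by positivity), mul_pow, Real.sq_sqrt hD1.le]
      have h2 : 1 + δ / 2 * t ≤ Real.exp (δ / 2 * t) := by
        have := Real.add_one_le_exp (δ / 2 * t); linarith
      have h3 : 0 ≤ δ / 2 * t := by positivity
      have h4 : 1 + δ / 2 * t ≤ Real.exp (δ / 2 * t) ^ 2 := by nlinarith
      calc (δ / 2 + D) * t ≤ (1 + δ / 2 * t) * (1 + D * t) := by
            have : 0 ≤ δ / 2 * t * (D * t) := by positivity
            nlinarith
        _ ≤ _ := by gcongr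
    rw [show (1/2 : ℝ) - 1 = -(1/2) by norm_num, Real.rpow_neg ht0.le, ← Real.sqrt_eq_rpow]
    have h5 : Real.exp (-(δ * t)) = Real.exp (-(δ / 2 * t)) * (Real.exp (δ / 2 * t))⁻¹ := by
      rw [← Real.exp_neg, ← Real.exp_add]; congr 1; ring
    rw [h5]
    have h6 : 0 < √(δ / 2 + D) * √t := by positivity
    have h7 := inv_anti₀ h6 h1
    rw [mul_inv, mul_inv] at h7
    have h8 := Real.exp_pos (-(δ / 2 * t))
    nlinarith
  rw [integral_const_mul, g, Real.Gamma_one_half_eq, ← Real.sqrt_eq_rpow] at hle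
  have h9 : √(1 / (δ / 2)) * √Real.pi ≤ 3 * (√δ)⁻¹ := by
    rw [← Real.sqrt_mul (by positivity), Real.sqrt_le_left (by positivity), mul_pow, inv_pow, Real.sq_sqrt hδ.le]
    have := Real.pi_lt_four
    have : 1 / (δ / 2) * Real.pi = (2 * Real.pi) * δ⁻¹ := by field_simp
    rw [this]
    have : 0 < δ⁻¹ := by positivity
    nlinarith
  have h10 : 0 < (√(δ / 2 + D))⁻¹ := by positivity
  nlinarith

lemma sin_low (x : ℝ) : min (cdist x 0) (cdist x (1/2)) ≤ |Real.sin (2 * Real.pi * x)| / 4 := by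
  have hpi := Real.pi_pos
  set n := round (2 * x) with hn
  have hr : |2 * x - n| ≤ 1/2 := abs_sub_round _
  have hs : 2 / Real.pi * |Real.pi * (2 * x - n)| ≤ |Real.sin (Real.pi * (2 * x - n))| := by
    apply Real.mul_abs_le_abs_sin
    rw [abs_mul, abs_of_pos hpi]; nlinarith
  have hs2 : |Real.sin (Real.pi * (2 * x - n))| = |Real.sin (2 * Real.pi * x)| := by
    rw [show Real.pi * (2 * x - n) = 2 * Real.pi * x - n * Real.pi by ring, Real.sin_sub_int_mul_pi, abs_mul]
    simp
  rw [hs2, abs_mul, abs_of_pos hpi] at hs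
  have hs3 : 2 * |2 * x - n| ≤ |Real.sin (2 * Real.pi * x)| := by
    refine le_trans (le_of_eq ?_) hs
    field_simp
  have hs4 : |x - n / 2| ≤ |Real.sin (2 * Real.pi * x)| / 4 := by
    have : 2 * x - n = 2 * (x - n/2) := by ring
    rw [this, abs_mul] at hs3
    norm_num at hs3
    linarith
  rcases Int.even_or_odd' n with ⟨k, hk | hk⟩
  · refine (min_le_left _ _).trans (le_trans ?_ hs4)
    unfold cdist
    have := round_le (x - 0) k
    refine this.trans (le_of_eq ?_)
    rw [hk]; push_cast; congr 1; ring
  · refine (min_le_right _ _).trans (le_trans ?_ hs4)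
    unfold cdist
    have := round_le (x - 1/2) k
    refine this.trans (le_of_eq ?_)
    rw [hk]; push_cast; congr 1; ring

lemma tnorm_le (η : ℝ) (q : Fin 3 → ℝ) : ∃ j, tnorm η q ≤ η + |Real.sin (2 * Real.pi * q j)| := by
  obtain ⟨j, hj⟩ := Finite.exists_max (fun j => |Real.sin (2 * Real.pi * q j)|)
  refine ⟨j, ?_⟩
  unfold tnorm
  gcongr
  rw [Real.sqrt_le_left (abs_nonneg _)]
  have h : ∀ i, (min (cdist (q i) 0) (cdist (q i) (1/2))) ^ 2 ≤ (|Real.sin (2 * Real.pi * q j)| / 4) ^ 2 := by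
    intro i
    have h0 : 0 ≤ min (cdist (q i) 0) (cdist (q i) (1/2)) := le_min (abs_nonneg _) (abs_nonneg _)
    have := sin_low (q i)
    have := hj i
    gcongr
    linarith
  calc _ ≤ ∑ i : Fin 3, (|Real.sin (2 * Real.pi * q j)| / 4) ^ 2 := Finset.sum_le_sum fun i _ => h i
    _ ≤ _ := by
      simp only [Finset.sum_const, Finset.card_univ, Fintype.card_fin, nsmul_eq_mul]
      push_cast
      nlinarith [sq_nonneg (|Real.sin (2 * Real.pi * q j)|)]

lemma Kprod_bound (t s : ℝ) (q : Fin 3 → ℝ) (i : Fin 3) :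
    ∏ j, ‖Kf t s (q j)‖ ≤ 343 * ((√(1 + |Real.sin (2 * Real.pi * q i)| * |t|))⁻¹ *
      ∑ j, (1 + |s + t * Real.cos (2 * Real.pi * q j)|)⁻¹) := by
  have id1 : ∀ y : ℝ, (t + s * Real.cos y)^2 + (s * Real.sin y)^2 = (s + t * Real.cos y)^2 + (t * Real.sin y)^2 := by
    intro y
    have := Real.sin_sq_add_cos_sq y
    linear_combination (s^2 - t^2) * this
  have k1 : ‖Kf t s (q i)‖ ≤ 7 * (√(1 + |Real.sin (2 * Real.pi * q i)| * |t|))⁻¹ := by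
    apply Kf_bound _ _ _ _ (by positivity)
    rw [id1, mul_pow, sq_abs, sq_abs]
    nlinarith [sq_nonneg (s + t * Real.cos (2 * Real.pi * q i))]
  have k2 : ∀ j, ‖Kf t s (q j)‖ ≤ 7 * (√(1 + |s + t * Real.cos (2 * Real.pi * q j)|))⁻¹ := by
    intro j
    apply Kf_bound _ _ _ _ (by positivity)
    rw [id1, sq_abs]
    nlinarith [sq_nonneg (t * Real.sin (2 * Real.pi * q j))]
  have k3 : ∀ j, ((√(1 + |s + t * Real.cos (2 * Real.pi * q j)|))⁻¹)^2 = (1 + |s + t * Real.cos (2 * Real.pi * q j)|)⁻¹ := by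
    intro j
    rw [inv_pow, Real.sq_sqrt (by positivity)]
  simp only [← k3]
  set g : Fin 3 → ℝ := fun j => (√(1 + |s + t * Real.cos (2 * Real.pi * q j)|))⁻¹ with hg
  have hgn : ∀ j, 0 ≤ g j := fun j => by positivity
  have k2' : ∀ j, ‖Kf t s (q j)‖ ≤ 7 * g j := k2
  set w := (√(1 + |Real.sin (2 * Real.pi * q i)| * |t|))⁻¹ with hw
  have hw0 : 0 ≤ w := by positivity
  have key : ∀ a b c : Fin 3, ‖Kf t s (q a)‖ ≤ 7 * w → ‖Kf t s (q a)‖ * ‖Kf t s (q b)‖ * ‖Kf t s (q c)‖ ≤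
      343 * (w * (g a ^2 + g b ^ 2 + g c ^ 2)) := by
    intro a b c ha
    calc _ ≤ (7 * w) * (7 * g b) * (7 * g c) := by
          have := k2' b; have := k2' c; have := hgn b; have := hgn c
          gcongr
      _ = 343 * (w * (g b * g c)) := by ring
      _ ≤ _ := by
        gcongr
        nlinarith [sq_nonneg (g b - g c), sq_nonneg (g a), sq_nonneg (g b), sq_nonneg (g c)]
  rw [Fin.prod_univ_three, Fin.sum_univ_three]
  show _ ≤ 343 * (w * (g 0 ^2 + g 1 ^ 2 + g 2 ^ 2))
  have k1' : ∀ a, a = i → ‖Kf t s (q a)‖ ≤ 7 * w := by rintro a rfl; exact k1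
  fin_cases i
  · exact key 0 1 2 (k1' 0 rfl)
  · have := key 1 0 2 (k1' 1 rfl); linarith
  · have := key 2 0 1 (k1' 2 rfl); linarith

lemma J_bound (σ : ℝ) (hσ : 0 < σ) : ∃ B : ℝ, 0 < B ∧ ∀ δ : ℝ, 0 < δ → δ ≤ 1 → ∀ ε₁ ε₂ : ℝ, δ ≤ ε₁ → δ ≤ ε₂ →
    ∀ (a b : ℝ) (q : Fin 3 → ℝ) (i : Fin 3),
    ∫ p in T3, (2 * ε₁ / (ε₁ ^ 2 + (a - edisp p) ^ 2)) * (2 * ε₂ / (ε₂ ^ 2 + (b - edisp (p + q)) ^ 2)) ≤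
      B * δ ^ (-σ) * ((√δ)⁻¹ * (√(δ / 2 + |Real.sin (2 * Real.pi * q i)|))⁻¹) := by
  obtain ⟨B, hB, hin⟩ := inner_bound σ hσ
  refine ⟨343 * 3 * 6 * B, by positivity, fun δ hδ hδ1 ε₁ ε₂ h1 h2 a b q i => ?_⟩
  set D := |Real.sin (2 * Real.pi * q i)| with hD
  have hD0 : 0 ≤ D := abs_nonneg _
  refine (J_fourier (hδ.trans_le h1) (hδ.trans_le h2) a b q).trans ?_
  set H : Fin 3 → ℝ × ℝ → ℝ := fun j z => (Real.exp (-(δ * |z.1|)) * (√(1 + D * |z.1|))⁻¹) *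
    (Real.exp (-(δ * |z.2|)) * (1 + |z.2 + z.1 * Real.cos (2 * Real.pi * q j)|)⁻¹) with hH
  have hbase := (integrable_exp_abs hδ).mul_prod (integrable_exp_abs hδ)
  have hw1 : ∀ t : ℝ, (√(1 + D * |t|))⁻¹ ≤ 1 := fun t =>
    inv_le_one_of_one_le₀ (Real.one_le_sqrt.mpr (by have : 0 ≤ D * |t| := by positivity
                                                    linarith))
  have hHi : ∀ j, Integrable (H j) := by
    intro j
    rw [Measure.volume_eq_prod]
    refine hbase.mono' ?_ (Eventually.of_forall fun z => ?_)
    · apply Measurable.aestronglyMeasurable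
      simp only [hH]
      fun_prop
    · have hw2 : (1 + |z.2 + z.1 * Real.cos (2 * Real.pi * q j)|)⁻¹ ≤ 1 :=
        inv_le_one_of_one_le₀ (by have := abs_nonneg (z.2 + z.1 * Real.cos (2 * Real.pi * q j)); linarith)
      simp only [hH]
      rw [Real.norm_of_nonneg (by positivity)]
      calc _ ≤ (Real.exp (-(δ * |z.1|)) * 1) * (Real.exp (-(δ * |z.2|)) * 1) := by
            have := hw1 z.1
            gcongr
        _ = _ := by ring
  have hwi : Integrable (fun t : ℝ => Real.exp (-(δ * |t|)) * (√(1 + D * |t|))⁻¹) := by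
    refine (integrable_exp_abs hδ).mono' ?_ (Eventually.of_forall fun t => ?_)
    · apply Measurable.aestronglyMeasurable; fun_prop
    · rw [Real.norm_of_nonneg (by positivity)]
      calc _ ≤ Real.exp (-(δ * |t|)) * 1 := by have := hw1 t; gcongr
        _ = _ := mul_one _
  have hHint : ∀ j, ∫ z, H j z ≤ B * δ ^ (-σ) * (6 * (√δ)⁻¹ * (√(δ / 2 + D))⁻¹) := by
    intro j
    have hh := hHi j
    rw [Measure.volume_eq_prod] at hh ⊢
    rw [integral_prod _ hh]
    calc _ ≤ ∫ t : ℝ, (B * δ ^ (-σ)) * (Real.exp (-(δ * |t|)) * (√(1 + D * |t|))⁻¹) := by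
          refine integral_mono_of_nonneg (Eventually.of_forall fun t => integral_nonneg fun s => ?_) (hwi.const_mul _) (Eventually.of_forall fun t => ?_)
          · simp only [hH]; positivity
          · simp only [hH]
            rw [integral_const_mul, mul_comm]
            have := hin δ hδ hδ1 (t * Real.cos (2 * Real.pi * q j))
            gcongr
      _ ≤ _ := by
          rw [integral_const_mul]
          have := t_bound δ D hδ hD0
          gcongr
  calc _ ≤ ∫ z : ℝ × ℝ, 343 * ∑ j, H j z := by
        refine integral_mono_of_nonneg (Eventually.of_forall fun z => by positivity) ((integrable_finsetSum _ fun j _ => hHi j).const_mul _) (Eventually.of_forall fun z => ?_)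
        simp only
        have hk := Kprod_bound z.1 z.2 q i
        calc _ ≤ (Real.exp (-(δ * |z.1|)) * Real.exp (-(δ * |z.2|))) * (343 * ((√(1 + D * |z.1|))⁻¹ *
              ∑ j, (1 + |z.2 + z.1 * Real.cos (2 * Real.pi * q j)|)⁻¹)) := by
              gcongr
          _ = _ := by
            simp only [hH, Finset.mul_sum]
            refine Finset.sum_congr rfl fun j _ => ?_
            ring
    _ = 343 * ∑ j, ∫ z, H j z := by
        rw [integral_const_mul, integral_finsetSum _ fun j _ => hHi j]
    _ ≤ 343 * ∑ j : Fin 3, B * δ ^ (-σ) * (6 * (√δ)⁻¹ * (√(δ / 2 + D))⁻¹) := by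
        gcongr with j _
        exact hHint j
    _ = _ := by
        simp only [Finset.sum_const, Finset.card_univ, Fintype.card_fin, nsmul_eq_mul]
        push_cast
        ring

lemma N_exists (σ : ℝ) (hσ : 0 < σ) : ∃ C : ℝ, 0 < C ∧ ∀ δ : ℝ, 0 < δ → δ ≤ 1 →
    ∃ N : ℕ, 18 ≤ δ * 2 ^ N ∧ ((N + 1 : ℕ) : ℝ) ≤ C * δ ^ (-σ) := by
  have hl2 : 0 < Real.log 2 := Real.log_pos (by norm_num)
  refine ⟨18 ^ σ / σ / Real.log 2 + 2, by positivity, fun δ hδ hδ1 => ?_⟩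
  have hone : 1 ≤ δ ^ (-σ) := Real.one_le_rpow_of_pos_of_le_one_of_nonpos hδ hδ1 (by linarith)
  have hx : 1 ≤ 18 / δ := by rw [le_div_iff₀ hδ]; linarith
  obtain ⟨n, hn1, hn2⟩ := exists_nat_pow_near hx (by norm_num : (1:ℝ) < 2)
  refine ⟨n + 1, ?_, ?_⟩
  · rw [div_lt_iff₀ hδ] at hn2; linarith
  · have h1 : n * Real.log 2 ≤ Real.log (18 / δ) := by
      rw [← Real.log_pow]; exact Real.log_le_log (by positivity) hn1
    have h2 := Real.log_le_rpow_div (by positivity : 0 ≤ 18 / δ) hσ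
    have h3 : (18 / δ) ^ σ = 18 ^ σ * δ ^ (-σ) := by
      rw [Real.div_rpow (by norm_num) hδ.le, Real.rpow_neg hδ.le]; rfl
    rw [h3] at h2
    have h4 : (n : ℝ) ≤ 18 ^ σ / σ / Real.log 2 * δ ^ (-σ) := by
      calc (n:ℝ) = n * Real.log 2 / Real.log 2 := by field_simp
        _ ≤ (18 ^ σ * δ ^ (-σ) / σ) / Real.log 2 := by gcongr; linarith
        _ = _ := by ring
    push_cast
    linarith

lemma dyadic (δ x : ℝ) (hδ : 0 < δ) (N : ℕ) (hx : |x| ≤ δ * 2 ^ N) :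
    1 / (|x| + δ) ≤ 2 * ∑ k ∈ Finset.range (N + 1), 2 * (δ * 2 ^ k) / ((δ * 2 ^ k) ^ 2 + x ^ 2) := by
  classical
  have hex : ∃ k : ℕ, |x| ≤ δ * 2 ^ k := ⟨N, hx⟩
  set k := Nat.find hex with hk
  have hk1 : |x| ≤ δ * 2 ^ k := Nat.find_spec hex
  have hkN : k ≤ N := Nat.find_min' hex hx
  have hk2 : δ * 2 ^ k ≤ 2 * (|x| + δ) := by
    rcases Nat.eq_zero_or_pos k with h0 | h0
    · rw [h0]; have := abs_nonneg x; simp; linarith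
    · have := Nat.find_min hex (m := k - 1) (by omega)
      rw [not_le] at this
      obtain ⟨m, hm⟩ : ∃ m, k = m + 1 := ⟨k - 1, by omega⟩
      rw [hm, Nat.add_sub_cancel] at this
      rw [hm, pow_succ]
      linarith
  have hsingle : 2 * (δ * 2 ^ k) / ((δ * 2 ^ k) ^ 2 + x ^ 2) ≤
      ∑ k ∈ Finset.range (N + 1), 2 * (δ * 2 ^ k) / ((δ * 2 ^ k) ^ 2 + x ^ 2) :=
    Finset.single_le_sum (f := fun k : ℕ => 2 * (δ * 2 ^ k) / ((δ * 2 ^ k) ^ 2 + x ^ 2)) (fun i _ => by positivity) (Finset.mem_range.mpr (by omega))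
  set e := δ * 2 ^ k with he
  have he0 : 0 < e := by positivity
  have h1 : 1 / (|x| + δ) ≤ 2 * (2 * e / (e ^ 2 + x ^ 2)) := by
    have hs : x ^ 2 ≤ e ^ 2 := by rw [← sq_abs x]; gcongr
    rw [← mul_div_assoc, div_le_div_iff₀ (by positivity) (by positivity)]
    nlinarith
  linarith

lemma edisp_range (p : Fin 3 → ℝ) : 0 ≤ edisp p ∧ edisp p ≤ 6 := by
  unfold edisp
  rw [Fin.sum_univ_three]
  have h := fun j => Real.cos_le_one (2 * Real.pi * p j)
  have h' := fun j => Real.neg_one_le_cos (2 * Real.pi * p j)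
  constructor <;> linarith [h 0, h 1, h 2, h' 0, h' 1, h' 2]

lemma main_J (σ : ℝ) (hσ : 0 < σ) : ∃ B : ℝ, 0 < B ∧ ∀ δ : ℝ, 0 < δ → δ ≤ 1 →
    ∀ (a b : ℝ) (q : Fin 3 → ℝ) (i : Fin 3), |a| ≤ 12 → |b| ≤ 12 →
    ∫ p in T3, (1 / (|a - edisp p| + δ)) * (1 / (|b - edisp (p + q)| + δ)) ≤
      B * δ ^ (-(3 * σ)) * ((√δ)⁻¹ * (√(δ / 2 + |Real.sin (2 * Real.pi * q i)|))⁻¹) := by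
  obtain ⟨B, hB, hJ⟩ := J_bound σ hσ
  obtain ⟨C, hC, hN⟩ := N_exists σ hσ
  refine ⟨4 * C ^ 2 * B, by positivity, fun δ hδ hδ1 a b q i ha hb => ?_⟩
  obtain ⟨N, hN1, hN2⟩ := hN δ hδ hδ1
  have hec := edisp_cont
  set R := (√δ)⁻¹ * (√(δ / 2 + |Real.sin (2 * Real.pi * q i)|))⁻¹ with hR
  have hR0 : 0 ≤ R := by positivity
  set L : ℕ → ℝ → ℝ := fun k x => 2 * (δ * 2 ^ k) / ((δ * 2 ^ k) ^ 2 + x ^ 2) with hL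
  have hLc : ∀ k, Continuous (L k) := by
    intro k
    apply Continuous.div (by fun_prop) (by fun_prop)
    intro x; positivity
  have hbd : ∀ (c : ℝ) (p : Fin 3 → ℝ), |c| ≤ 12 → |c - edisp p| ≤ δ * 2 ^ N := by
    intro c p hc
    have := edisp_range p
    rw [abs_le] at hc
    refine le_trans ?_ hN1
    rw [abs_le]; constructor <;> linarith [hc.1, hc.2, this.1, this.2]
  have hintg : ∀ k l : ℕ, IntegrableOn (fun p => L k (a - edisp p) * L l (b - edisp (p + q))) T3 := by
    intro k l
    have h1 := hLc k
    have h2 := hLc l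
    exact (by fun_prop : Continuous (fun p => L k (a - edisp p) * L l (b - edisp (p + q)))).continuousOn.integrableOn_compact (isCompact_univ_pi fun _ => isCompact_Icc)
  calc _ ≤ ∫ p in T3, 4 * ∑ k ∈ Finset.range (N + 1), ∑ l ∈ Finset.range (N + 1), L k (a - edisp p) * L l (b - edisp (p + q)) := by
        refine integral_mono_of_nonneg (Eventually.of_forall fun p => by positivity)
          ((integrable_finsetSum _ fun k _ => integrable_finsetSum _ fun l _ => hintg k l).const_mul _) (Eventually.of_forall fun p => ?_)
        simp only
        rw [← Finset.sum_mul_sum]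
        have h1 := dyadic δ (a - edisp p) hδ N (hbd a p ha)
        have h2 := dyadic δ (b - edisp (p + q)) hδ N (hbd b (p + q) hb)
        calc _ ≤ (2 * ∑ k ∈ Finset.range (N + 1), L k (a - edisp p)) * (2 * ∑ k ∈ Finset.range (N + 1), L k (b - edisp (p + q))) :=
              mul_le_mul h1 h2 (by positivity) (le_trans (by positivity) h1)
          _ = _ := by ring
    _ = 4 * ∑ k ∈ Finset.range (N + 1), ∑ l ∈ Finset.range (N + 1), ∫ p in T3, L k (a - edisp p) * L l (b - edisp (p + q)) := by
        rw [integral_const_mul, integral_finsetSum _ fun k _ => integrable_finsetSum _ fun l _ => hintg k l]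
        congr 2; funext k
        rw [integral_finsetSum _ fun l _ => hintg k l]
    _ ≤ 4 * ∑ k ∈ Finset.range (N + 1), ∑ l ∈ Finset.range (N + 1), B * δ ^ (-σ) * R := by
        gcongr with k _ l _
        have hge : ∀ k : ℕ, δ ≤ δ * 2 ^ k := fun k => le_mul_of_one_le_right hδ.le (one_le_pow₀ (by norm_num))
        exact hJ δ hδ hδ1 _ _ (hge k) (hge l) a b q i
    _ = 4 * (((N + 1 : ℕ) : ℝ) ^ 2 * (B * δ ^ (-σ) * R)) := by
        simp only [Finset.sum_const, Finset.card_range, nsmul_eq_mul]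
        ring
    _ ≤ 4 * ((C * δ ^ (-σ)) ^ 2 * (B * δ ^ (-σ) * R)) := by gcongr
    _ = 4 * C ^ 2 * B * (δ ^ (-σ) * δ ^ (-σ) * δ ^ (-σ)) * R := by ring
    _ = _ := by
        rw [← Real.rpow_add hδ, ← Real.rpow_add hδ]
        congr 3; ring

lemma den_bound {M lam κ η : ℝ} (hκ : 0 < κ) (hl : 0 < lam) (hl1 : lam ≤ 1) (hη : η = lam ^ (2 + κ)) (hM : 0 < M)
    (x : ℝ) (w : ℂ) (r : ℝ) (hr : |r| ≤ M) (hw1 : w.re = x - lam ^ 2 * r) (hw2 : η ≤ |w.im|) :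
    1 / ‖w‖ ≤ (M + 2) * lam ^ (-κ) * (1 / (|x| + lam ^ 2)) := by
  have hη0 : 0 < η := by rw [hη]; positivity
  have h1 : η ≤ ‖w‖ := hw2.trans (Complex.abs_im_le_norm w)
  have h2 : |x| ≤ ‖w‖ + lam ^ 2 * M := by
    have h3 := Complex.abs_re_le_norm w
    rw [hw1] at h3
    have h4 : |x| ≤ |x - lam ^ 2 * r| + |lam ^ 2 * r| := by
      have := abs_add_le (x - lam^2 * r) (lam^2 * r); simpa using this
    have h5 : |lam ^ 2 * r| ≤ lam ^ 2 * M := by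
      rw [abs_mul, abs_of_pos (by positivity : 0 < lam ^ 2)]; gcongr
    linarith
  have hone : 1 ≤ lam ^ (-κ) := Real.one_le_rpow_of_pos_of_le_one_of_nonpos hl hl1 (by linarith)
  have hle : lam ^ (-κ) * η = lam ^ 2 := by
    rw [hη, ← Real.rpow_add hl, ← Real.rpow_natCast]; congr 1; push_cast; ring
  have hw0 : 0 < ‖w‖ := hη0.trans_le h1
  rw [mul_one_div, div_le_div_iff₀ hw0 (by positivity)]
  have h6 : lam ^ 2 ≤ lam ^ (-κ) * ‖w‖ := by rw [← hle]; gcongr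
  have h7 : ‖w‖ ≤ lam ^ (-κ) * ‖w‖ := le_mul_of_one_le_left hw0.le hone
  nlinarith

lemma combined (κ : ℝ) (hκ : 0 < κ) : ∃ C : ℝ, 0 < C ∧ ∀ Θ : ℝ → ℂ, IsThetaLimit Θ →
    ∀ lam : ℝ, 0 < lam → lam ≤ 1 / 2 → ∀ η : ℝ, η = lam ^ (2 + κ) → ∀ q : Fin 3 → ℝ, ∀ α β : ℝ, |α| ≤ 12 → |β| ≤ 12 →
      (∫ p in T3, 1 / (‖(α : ℂ) - (starRingEnd ℂ) (omegaR Θ lam p) - (η : ℂ) * Complex.I‖ *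
                        ‖(β : ℂ) - omegaR Θ lam (p + q) + (η : ℂ) * Complex.I‖)) ≤
                  C * η ^ (-(1/2) - κ) / tnorm η q := by
  obtain ⟨M, hM, hΘb⟩ := theta_bound
  obtain ⟨B, hB, hJ⟩ := main_J (κ / 12) (by positivity)
  refine ⟨(M + 2) ^ 2 * B * 4, by positivity, fun Θ hΘ lam hl hl2 η hη q α β hα hβ => ?_⟩
  have hec := edisp_cont
  have hη0 : 0 < η := by rw [hη]; positivity
  have hl1 : lam ≤ 1 := by linarith
  have hδ1 : lam ^ 2 ≤ 1 := pow_le_one₀ hl.le hl1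
  obtain ⟨i, hi⟩ := tnorm_le η q
  have hJ' := hJ (lam ^ 2) (by positivity) hδ1 α β q i hα hβ
  set D := |Real.sin (2 * Real.pi * q i)| with hD
  have hD0 : 0 ≤ D := abs_nonneg _
  have hD1 : D ≤ 1 := Real.abs_sin_le_one _
  have ht0 : 0 < tnorm η q := by unfold tnorm; positivity
  have hηl : η ≤ lam ^ 2 := by
    rw [hη, ← Real.rpow_natCast]
    exact Real.rpow_le_rpow_of_exponent_ge hl hl1 (by push_cast; linarith)
  have hX0 : 0 < lam ^ 2 / 2 + D := by positivity
  have hX : (√(lam ^ 2 / 2 + D))⁻¹ ≤ 4 * (tnorm η q)⁻¹ := by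
    have h1 : tnorm η q ≤ 2 * (lam ^ 2 / 2 + D) := by linarith
    have h2 : lam ^ 2 / 2 + D ≤ 2 * √(lam ^ 2 / 2 + D) := by
      have h3 : √(lam ^ 2 / 2 + D) ≤ 2 := by rw [Real.sqrt_le_left (by norm_num)]; linarith
      have h4 := Real.mul_self_sqrt hX0.le
      nlinarith [Real.sqrt_nonneg (lam ^ 2 / 2 + D)]
    rw [← div_eq_mul_inv, le_div_iff₀ ht0, inv_mul_le_iff₀ (by positivity)]
    linarith
  have hpow : lam ^ (-κ) * lam ^ (-κ) * ((lam ^ 2) ^ (-(3 * (κ / 12))) * (√(lam ^ 2))⁻¹) ≤ η ^ (-(1/2) - κ) := by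
    rw [Real.sqrt_sq hl.le, hη, ← Real.rpow_mul hl.le, ← Real.rpow_natCast lam 2, ← Real.rpow_mul hl.le,
      ← Real.rpow_neg_one, ← Real.rpow_add hl, ← Real.rpow_add hl, ← Real.rpow_add hl]
    apply Real.rpow_le_rpow_of_exponent_ge hl hl1
    push_cast
    nlinarith [sq_nonneg κ]
  have hc : IntegrableOn (fun p => (1 / (|α - edisp p| + lam ^ 2)) * (1 / (|β - edisp (p + q)| + lam ^ 2))) T3 := by
    have h : Continuous (fun p => (1 / (|α - edisp p| + lam ^ 2)) * (1 / (|β - edisp (p + q)| + lam ^ 2))) := by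
      apply Continuous.mul
      · apply Continuous.div (by fun_prop) (by fun_prop); intro p; positivity
      · apply Continuous.div (by fun_prop) (by fun_prop); intro p; positivity
    exact h.continuousOn.integrableOn_compact (isCompact_univ_pi fun _ => isCompact_Icc)
  have hΘM : ∀ a, |(Θ a).re| ≤ M := fun a => (Complex.abs_re_le_norm _).trans (hΘb Θ hΘ a).1
  calc _ ≤ ∫ p in T3, ((M + 2) * lam ^ (-κ)) ^ 2 * ((1 / (|α - edisp p| + lam ^ 2)) * (1 / (|β - edisp (p + q)| + lam ^ 2))) := by
        refine integral_mono_of_nonneg (Eventually.of_forall fun p => by positivity) (hc.const_mul _) (Eventually.of_forall fun p => ?_)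
        simp only
        have hl2' : 0 < lam ^ 2 := by positivity
        have d1 : 1 / ‖(α : ℂ) - (starRingEnd ℂ) (omegaR Θ lam p) - (η : ℂ) * Complex.I‖ ≤ _ :=
          den_bound hκ hl hl1 hη hM (α - edisp p) _ (Θ (edisp p)).re (hΘM _)
          (by simp [omegaR, ← Complex.ofReal_pow]; ring) (by
            have him := (hΘb Θ hΘ (edisp p)).2
            have h1 : ((α : ℂ) - (starRingEnd ℂ) (omegaR Θ lam p) - (η : ℂ) * Complex.I).im = lam ^ 2 * (Θ (edisp p)).im - η := by
              simp [omegaR, ← Complex.ofReal_pow]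
            rw [h1, abs_of_nonpos (by nlinarith)]
            nlinarith)
        have d2 : 1 / ‖(β : ℂ) - omegaR Θ lam (p + q) + (η : ℂ) * Complex.I‖ ≤ _ :=
          den_bound hκ hl hl1 hη hM (β - edisp (p + q)) _ (Θ (edisp (p + q))).re (hΘM _)
          (by simp [omegaR, ← Complex.ofReal_pow]; ring) (by
            have him := (hΘb Θ hΘ (edisp (p + q))).2
            have h1 : ((β : ℂ) - omegaR Θ lam (p + q) + (η : ℂ) * Complex.I).im = -(lam ^ 2 * (Θ (edisp (p + q))).im) + η := by
              simp [omegaR, ← Complex.ofReal_pow]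
            rw [h1, abs_of_nonneg (by nlinarith)]
            nlinarith)
        rw [← one_div_mul_one_div]
        calc _ ≤ ((M + 2) * lam ^ (-κ) * (1 / (|α - edisp p| + lam ^ 2))) * ((M + 2) * lam ^ (-κ) * (1 / (|β - edisp (p + q)| + lam ^ 2))) :=
              mul_le_mul d1 d2 (by positivity) (by positivity)
          _ = _ := by ring
    _ = ((M + 2) * lam ^ (-κ)) ^ 2 * ∫ p in T3, ((1 / (|α - edisp p| + lam ^ 2)) * (1 / (|β - edisp (p + q)| + lam ^ 2))) :=
        integral_const_mul _ _
    _ ≤ ((M + 2) * lam ^ (-κ)) ^ 2 * (B * (lam ^ 2) ^ (-(3 * (κ / 12))) * ((√(lam ^ 2))⁻¹ * (√(lam ^ 2 / 2 + D))⁻¹)) := by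
        gcongr
    _ ≤ ((M + 2) * lam ^ (-κ)) ^ 2 * (B * (lam ^ 2) ^ (-(3 * (κ / 12))) * ((√(lam ^ 2))⁻¹ * (4 * (tnorm η q)⁻¹))) := by
        gcongr
    _ = (M + 2) ^ 2 * B * 4 * (lam ^ (-κ) * lam ^ (-κ) * ((lam ^ 2) ^ (-(3 * (κ / 12))) * (√(lam ^ 2))⁻¹)) * (tnorm η q)⁻¹ := by ring
    _ ≤ (M + 2) ^ 2 * B * 4 * η ^ (-(1/2) - κ) * (tnorm η q)⁻¹ := by gcongr
    _ = _ := (div_eq_mul_inv _ _).symm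

/-- Two Denominator Lemma, without point singularity: For `κ > 0` there
are `C > 0` and `λ₀ ∈ (0,1)` such that for `0 < λ ≤ λ₀`, with `η = λ^{2+κ}`, and any `q`:
(i) `sup_{|α|,|β| ≤ 12} ∫ dp / (|α - ω̄(p) - iη| |β - ω(p+q) + iη|) ≤ C η^{-3/4-κ} / |||q|||`;
(ii) `∫_{-12}^{12} dα ∫ dp / (|α - ω̄(p) - iη| |α - ω(p+q) + iη|) ≤ C η^{-1/2-κ} / |||q|||`. -/
theorem statement10 (κ : ℝ) (hκ : 0 < κ) :
    ∃ C lam0 : ℝ, 0 < C ∧ lam0 ∈ Set.Ioo (0 : ℝ) 1 ∧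
      ∀ Θ : ℝ → ℂ, IsThetaLimit Θ →
        ∀ lam : ℝ, 0 < lam → lam ≤ lam0 →
          ∀ η : ℝ, η = lam ^ (2 + κ) →
            ∀ q : Fin 3 → ℝ,
              (∀ α β : ℝ, |α| ≤ 12 → |β| ≤ 12 →
                (∫ p in T3,
                    1 /
                      (‖(α : ℂ) - (starRingEnd ℂ) (omegaR Θ lam p) - (η : ℂ) * Complex.I‖ *
                        ‖(β : ℂ) - omegaR Θ lam (p + q) + (η : ℂ) * Complex.I‖)) ≤
                  C * η ^ (-(3/4) - κ) / tnorm η q) ∧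
              ((∫ α in Set.Icc (-12 : ℝ) 12, ∫ p in T3,
                    1 /
                      (‖(α : ℂ) - (starRingEnd ℂ) (omegaR Θ lam p) - (η : ℂ) * Complex.I‖ *
                        ‖(α : ℂ) - omegaR Θ lam (p + q) + (η : ℂ) * Complex.I‖)) ≤
                  C * η ^ (-(1/2) - κ) / tnorm η q) := by
  obtain ⟨C, hC, h⟩ := combined κ hκ
  refine ⟨24 * C, 1/2, by positivity, ⟨by norm_num, by norm_num⟩, fun Θ hΘ lam hl hl2 η hη q => ?_⟩
  have hη0 : 0 < η := by rw [hη]; positivity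
  have hη1 : η ≤ 1 := by rw [hη]; exact Real.rpow_le_one hl.le (by linarith) (by linarith)
  have ht0 : 0 < tnorm η q := by unfold tnorm; positivity
  have hc := h Θ hΘ lam hl hl2 η hη q
  have hpos : 0 ≤ C * η ^ (-(1/2) - κ) / tnorm η q := by positivity
  constructor
  · intro α β hα hβ
    refine (hc α β hα hβ).trans ?_
    have : η ^ (-(1/2) - κ) ≤ η ^ (-(3/4) - κ) :=
      Real.rpow_le_rpow_of_exponent_ge hη0 hη1 (by linarith)
    gcongr
    linarith
  · have hb := norm_setIntegral_le_of_norm_le_const (μ := volume) (s := Set.Icc (-12 : ℝ) 12) (C := C * η ^ (-(1/2) - κ) / tnorm η q)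
      (f := fun α : ℝ => ∫ p in T3,
                    1 /
                      (‖(α : ℂ) - (starRingEnd ℂ) (omegaR Θ lam p) - (η : ℂ) * Complex.I‖ *
                        ‖(α : ℂ) - omegaR Θ lam (p + q) + (η : ℂ) * Complex.I‖))
      (by simp) (by
        intro α hα
        have hα' : |α| ≤ 12 := abs_le.mpr hα
        rw [Real.norm_of_nonneg (integral_nonneg fun p => by positivity)]
        exact hc α α hα' hα')
    refine (le_abs_self _).trans (hb.trans (le_of_eq ?_))
    simp [Measure.real]
    norm_num
    ring

end
end
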